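/- Let a ∈ ℤ. (a) For every c ∈ ℤ with c ≠ −1, letting f(x) = x² + c, the set of primes p that divide f^n(a) for some n ≥ 1 with f^n(a) ≠ 0 has natural density 0. (b) For every c ∈ ℤ, letting f(x) = x² − c·x + c, the set of primes p that divide f^n(a) for some n ≥ 1 with f^n(a) ≠ 0 has natural density 0. -/

import Mathlib

open Filter

/-- A set of natural numbers contains primes of natural density 0 (as a set of primes):
the proportion of primes p ≤ X lying in the set tends to 0 as X → ∞. -/
def PrimeDensityZero (P : Set ℕ) : Prop :=
  Tendsto (fun X : ℕ =>
      (({p : ℕ | p.Prime ∧ p ∈ P ∧ p ≤ X}).ncard : ℝ) /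
        (({p : ℕ | p.Prime ∧ p ≤ X}).ncard : ℝ))
    atTop (nhds 0)

namespace JonesDensity

section Lattice
open Module MeasureTheory
variable {E : Type*} [NormedAddCommGroup E] [NormedSpace ℝ E] [FiniteDimensional ℝ E]
  (L : Submodule ℤ E) [DiscreteTopology L] [IsZLattice ℝ L]

theorem lattice_card_le (R : ℝ) : ∃ C : ℝ, 0 ≤ C ∧ ∀ T : ℝ, 1 ≤ T → ∃ s : Finset L,
    (∀ x : L, ‖x‖ ≤ R * T → x ∈ s) ∧ (s.card : ℝ) ≤ C * T ^ finrank ℝ E := by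
  classical
  have := ZLattice.module_finite ℝ L
  have := ZLattice.module_free ℝ L
  let b := Module.Free.chooseBasis ℤ L
  obtain ⟨ε, hε, hb⟩ := ZLattice.exists_forall_abs_repr_le_norm b
  set M := |R| / ε with hM
  have hM0 : 0 ≤ M := by positivity
  refine ⟨(2 * M + 1) ^ finrank ℝ E, by positivity, fun T hT => ?_⟩
  let N : ℤ := ⌊M * T⌋
  have hN0 : 0 ≤ N := Int.floor_nonneg.2 (by positivity)
  let e := b.equivFun
  refine ⟨(Fintype.piFinset fun _ => Finset.Icc (-N) N).map e.symm.toEquiv.toEmbedding, ?_, ?_⟩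
  · intro x hx
    simp only [Finset.mem_map_equiv, Fintype.mem_piFinset, Finset.mem_Icc, ← abs_le]
    intro i
    have h1 := hb x i
    have : |b.repr x i| ≤ N := by
      rw [Int.le_floor]
      have h2 : ε * |b.repr x i| ≤ |R| * T := h1.trans (hx.trans (by gcongr; exact le_abs_self R))
      rw [hM, div_mul_eq_mul_div, le_div_iff₀ hε]
      push_cast at h2 ⊢
      linarith
    simpa [e] using this
  · rw [Finset.card_map, Fintype.card_piFinset]
    have hc : Fintype.card (Module.Free.ChooseBasisIndex ℤ L) = finrank ℝ E := by
      rw [← ZLattice.rank ℝ L, finrank_eq_card_chooseBasisIndex]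
    simp only [Int.card_Icc, Finset.prod_const, Finset.card_univ, hc]
    push_cast
    rw [← mul_pow]
    gcongr
    have h3 : ((N + 1 - -N).toNat : ℝ) = 2 * N + 1 := by
      have : ((N + 1 - -N).toNat : ℤ) = 2 * N + 1 := by rw [Int.toNat_of_nonneg (by omega)]; ring
      exact_mod_cast this
    rw [h3]
    have : (N : ℝ) ≤ M * T := Int.floor_le _
    nlinarith

theorem lattice_sum_lipschitz {K : NNReal} {h : E → ℝ} (hK : LipschitzWith K h)
    (hs : HasCompactSupport h) (h0 : ∀ x, 0 ≤ h x) :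
    ∃ c C : ℝ, 0 ≤ c ∧ 0 ≤ C ∧ ∀ T : ℝ, 1 ≤ T →
      (Summable fun x : L => h (T⁻¹ • (x : E))) ∧
      |∑' x : L, h (T⁻¹ • (x : E)) - c * T ^ finrank ℝ E| ≤ C * T ^ finrank ℝ E / T := by
  classical
  borelize E
  let μ : Measure E := Measure.addHaar
  have := ZLattice.module_finite ℝ L
  have := ZLattice.module_free ℝ L
  let b := Module.Free.chooseBasis ℤ L
  let F := ZSpan.fundamentalDomain (b.ofZLatticeBasis ℝ)
  have : MeasurableVAdd L E := (inferInstance : MeasurableVAdd L.toAddSubgroup E)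
  have : VAddInvariantMeasure L E μ := (inferInstance : VAddInvariantMeasure L.toAddSubgroup E μ)
  have hF : IsAddFundamentalDomain L F μ := ZLattice.isAddFundamentalDomain b μ
  have hFm : MeasurableSet F := ZSpan.fundamentalDomain_measurableSet _
  have hFb : Bornology.IsBounded F := ZSpan.fundamentalDomain_isBounded _
  obtain ⟨d, hd⟩ := hFb.exists_norm_le
  obtain ⟨R, hR⟩ := hs.isCompact.isBounded.exists_norm_le
  have hR' : ∀ x, R < ‖x‖ → h x = 0 := fun x hx => by
    by_contra hne
    exact absurd (hR x (subset_tsupport _ hne)) (not_le.2 hx)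
  have hd0 : 0 ≤ d := (norm_nonneg (0:E)).trans (hd 0 (by simp [F, ZSpan.mem_fundamentalDomain]))
  set v := μ.real F with hv
  have hFfin : μ F < ⊤ := hFb.measure_lt_top
  have hv0 : 0 < v := by
    refine ENNReal.toReal_pos ?_ hFfin.ne
    exact ZSpan.measure_fundamentalDomain_ne_zero _
  obtain ⟨C, hC0, hC⟩ := lattice_card_le L (|R| + d)
  have hint : Integrable h μ := hK.continuous.integrable_of_hasCompactSupport hs
  refine ⟨(∫ x, h x ∂μ) / v, C * (K * d), div_nonneg (integral_nonneg h0) hv0.le, by positivity,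
    fun T hT => ?_⟩
  have hT0 : 0 < T := by linarith
  obtain ⟨s, hs1, hs2⟩ := hC T hT
  have hz : ∀ g : L, g ∉ s → ∀ x : E, ‖x‖ ≤ d → h (T⁻¹ • ((g : E) + x)) = 0 := by
    intro g hg x hx
    apply hR'
    have h1 : (|R| + d) * T < ‖g‖ := by
      by_contra hh; exact hg (hs1 g (not_lt.1 hh))
    rw [norm_smul, norm_inv, Real.norm_of_nonneg hT0.le, lt_inv_mul_iff₀ hT0]
    have h2 : ‖(g : E)‖ - ‖x‖ ≤ ‖(g : E) + x‖ := by
      have := norm_sub_norm_le (g : E) (-x); simpa using this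
    have h3 : ‖g‖ = ‖(g : E)‖ := rfl
    have : R ≤ |R| := le_abs_self R
    nlinarith
  have hz0 : ∀ g : L, g ∉ s → h (T⁻¹ • (g : E)) = 0 := fun g hg => by
    simpa using hz g hg 0 (by simpa using hd0)
  have hsumm : Summable fun x : L => h (T⁻¹ • (x : E)) :=
    summable_of_ne_finset_zero (s := s) (fun g hg => hz0 g hg)
  refine ⟨hsumm, ?_⟩
  have hI : Integrable (fun x => h (T⁻¹ • x)) μ := hint.comp_smul (inv_ne_zero hT0.ne')
  have e1 : ∫ x, h (T⁻¹ • x) ∂μ = T ^ finrank ℝ E * ∫ x, h x ∂μ := by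
    rw [Measure.integral_comp_smul]
    simp [abs_of_pos hT0]
  have e2 : ∫ x, h (T⁻¹ • x) ∂μ = ∑ g ∈ s, ∫ x in F, h (T⁻¹ • ((g : E) + x)) ∂μ := by
    rw [hF.integral_eq_tsum'' _ hI, tsum_eq_sum]
    · rfl
    · intro g hg
      rw [setIntegral_eq_zero_of_forall_eq_zero]
      intro x hx
      exact hz g hg x (hd x hx)
  rw [tsum_eq_sum (s := s) (fun g hg => hz0 g hg)]
  have e3 : (∑ x ∈ s, h (T⁻¹ • (x : E))) - (∫ x, h x ∂μ) / v * T ^ finrank ℝ E =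
      v⁻¹ * ∑ g ∈ s, ∫ x in F, (h (T⁻¹ • (g : E)) - h (T⁻¹ • ((g : E) + x))) ∂μ := by
    have : ∀ g ∈ s, ∫ x in F, (h (T⁻¹ • (g : E)) - h (T⁻¹ • ((g : E) + x))) ∂μ =
        v * h (T⁻¹ • (g : E)) - ∫ x in F, h (T⁻¹ • ((g : E) + x)) ∂μ := by
      intro g _
      rw [integral_sub]
      · simp [hv]
      · exact integrableOn_const hFfin.ne
      · exact (hI.comp_add_left (g : E)).integrableOn
    rw [Finset.sum_congr rfl this, Finset.sum_sub_distrib, ← e2, e1, ← Finset.mul_sum]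
    field_simp
  rw [e3, abs_mul, abs_of_pos (inv_pos.2 hv0)]
  have e4 : ∀ g ∈ s, |∫ x in F, (h (T⁻¹ • (g : E)) - h (T⁻¹ • ((g : E) + x))) ∂μ| ≤
      K * (d / T) * v := by
    intro g _
    rw [← Real.norm_eq_abs]
    refine norm_setIntegral_le_of_norm_le_const hFfin fun x hx => ?_
    rw [← dist_eq_norm]
    refine (hK.dist_le_mul _ _).trans ?_
    gcongr
    rw [dist_eq_norm, ← smul_sub, norm_smul, norm_inv, Real.norm_of_nonneg hT0.le,
      inv_mul_eq_div]
    gcongr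
    simpa using hd x hx
  calc v⁻¹ * |∑ g ∈ s, ∫ x in F, (h (T⁻¹ • (g : E)) - h (T⁻¹ • ((g : E) + x))) ∂μ|
      ≤ v⁻¹ * (s.card * (K * (d / T) * v)) := by
        gcongr
        refine (Finset.abs_sum_le_sum_abs _ _).trans ((Finset.sum_le_sum e4).trans ?_)
        simp
    _ = s.card * (K * d) / T := by field_simp
    _ ≤ C * (K * d) * T ^ finrank ℝ E / T := by
        have : (0:ℝ) ≤ K * d := by positivity
        gcongr ?_ / T
        nlinarith
end Lattice

section Cutoff
open Module MeasureTheory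

noncomputable def tent (t : ℝ) : ℝ := Real.smoothTransition (t + 1) - Real.smoothTransition t

theorem tent_eq_zero {t : ℝ} (h : 1 ≤ |t|) : tent t = 0 := by
  unfold tent
  rcases le_abs.1 h with h | h
  · rw [Real.smoothTransition.one_of_one_le h, Real.smoothTransition.one_of_one_le (by linarith),
      sub_self]
  · rw [Real.smoothTransition.zero_of_nonpos (by linarith),
      Real.smoothTransition.zero_of_nonpos (by linarith), sub_self]

theorem tent_nonneg (t : ℝ) : 0 ≤ tent t := by
  unfold tent
  rcases le_total t 0 with h | h
  · rw [Real.smoothTransition.zero_of_nonpos h, sub_zero]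
    exact Real.smoothTransition.nonneg _
  · rw [Real.smoothTransition.one_of_one_le (x := t + 1) (by linarith)]
    linarith [Real.smoothTransition.le_one t]

theorem contDiff_tent : ContDiff ℝ 1 tent := by
  unfold tent
  exact (Real.smoothTransition.contDiff.comp (contDiff_id.add contDiff_const)).sub
    Real.smoothTransition.contDiff

theorem exists_sum_tent (t : ℝ) : ∃ s : Finset ℤ, (∀ k ∉ s, tent (k + t) = 0) ∧
    ∑ k ∈ s, tent (k + t) = 1 := by
  refine ⟨{-⌊t⌋, -⌊t⌋ - 1}, ?_, ?_⟩
  · intro k hk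
    simp only [Finset.mem_insert, Finset.mem_singleton, not_or] at hk
    apply tent_eq_zero
    have h1 := Int.floor_le t
    have h2 := Int.lt_floor_add_one t
    rcases lt_or_gt_of_ne hk.1 with h | h
    · have : k ≤ -⌊t⌋ - 2 := by have := hk.2; omega
      have : (k : ℝ) ≤ -⌊t⌋ - 2 := by exact_mod_cast this
      rw [le_abs]; right; linarith
    · have : (-⌊t⌋ : ℤ) + 1 ≤ k := by omega
      have : (-⌊t⌋ : ℝ) + 1 ≤ k := by exact_mod_cast this
      rw [le_abs]; left; linarith
  · rw [Finset.sum_pair (by omega)]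
    have h1 := Int.floor_le t
    have h2 := Int.lt_floor_add_one t
    unfold tent
    push_cast
    rw [Real.smoothTransition.one_of_one_le (x := -↑⌊t⌋ + t + 1) (by linarith),
      Real.smoothTransition.zero_of_nonpos (x := -↑⌊t⌋ - 1 + t) (by linarith)]
    ring_nf

noncomputable def bump (t : ℝ) : ℝ :=
  Real.smoothTransition (2 * t - 1) * Real.smoothTransition (2 - t / 2)

theorem bump_nonneg (t : ℝ) : 0 ≤ bump t :=
  mul_nonneg (Real.smoothTransition.nonneg _) (Real.smoothTransition.nonneg _)

theorem bump_le_one (t : ℝ) : bump t ≤ 1 :=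
  mul_le_one₀ (Real.smoothTransition.le_one _) (Real.smoothTransition.nonneg _)
    (Real.smoothTransition.le_one _)

theorem bump_eq_zero_of_le {t : ℝ} (h : t ≤ 1 / 2) : bump t = 0 := by
  rw [bump, Real.smoothTransition.zero_of_nonpos (x := 2 * t - 1) (by linarith), zero_mul]

theorem bump_eq_zero_of_ge {t : ℝ} (h : 4 ≤ t) : bump t = 0 := by
  rw [bump, Real.smoothTransition.zero_of_nonpos (x := 2 - t / 2) (by linarith), mul_zero]

theorem bump_eq_one {t : ℝ} (h1 : 1 ≤ t) (h2 : t ≤ 2) : bump t = 1 := by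
  rw [bump, Real.smoothTransition.one_of_one_le (x := 2 * t - 1) (by linarith),
    Real.smoothTransition.one_of_one_le (x := 2 - t / 2) (by linarith), mul_one]

theorem contDiff_bump : ContDiff ℝ 1 bump := by
  unfold bump
  exact (Real.smoothTransition.contDiff.comp (by fun_prop)).mul
    (Real.smoothTransition.contDiff.comp (by fun_prop))

end Cutoff

section Cone
open Module MeasureTheory
open scoped Classical
open NumberField NumberField.Units NumberField.Units.dirichletUnitTheorem
  NumberField.mixedEmbedding NumberField.InfinitePlace

variable (K : Type*) [Field K] [NumberField K]

/-- The coordinates of `logMap` in the basis of the unit lattice. -/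
noncomputable def logCoord (i : Fin (rank K)) (x : mixedSpace K) : ℝ :=
  ((basisUnitLattice K).ofZLatticeBasis ℝ (unitLattice K)).repr (logMap x) i

noncomputable def coneBump (x : mixedSpace K) : ℝ :=
  (∏ i, tent (logCoord K i x)) * bump (mixedEmbedding.norm x)

theorem coneBump_nonneg (x : mixedSpace K) : 0 ≤ coneBump K x :=
  mul_nonneg (Finset.prod_nonneg fun _ _ => tent_nonneg _) (bump_nonneg _)

theorem contDiffAt_normAtPlace (w : InfinitePlace K) {x : mixedSpace K}
    (hx : normAtPlace w x ≠ 0) : ContDiffAt ℝ 1 (fun y : mixedSpace K => normAtPlace w y) x := by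
  rcases isReal_or_isComplex w with hw | hw
  · simp only [normAtPlace_apply_of_isReal hw] at hx ⊢
    have h1 : ContDiffAt ℝ 1 (fun y : mixedSpace K => y.1 ⟨w, hw⟩) x :=
      (contDiff_apply ℝ ℝ (⟨w, hw⟩ : {w : InfinitePlace K // IsReal w})).contDiffAt.comp x
        contDiff_fst.contDiffAt
    exact h1.norm ℝ (by simpa using hx)
  · simp only [normAtPlace_apply_of_isComplex hw] at hx ⊢
    have h1 : ContDiffAt ℝ 1 (fun y : mixedSpace K => y.2 ⟨w, hw⟩) x :=
      (contDiff_apply ℝ ℂ (⟨w, hw⟩ : {w : InfinitePlace K // IsComplex w})).contDiffAt.comp x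
        contDiff_snd.contDiffAt
    exact h1.norm ℝ (by simpa using hx)

theorem contDiff_coneBump : ContDiff ℝ 1 (coneBump K) := by
  rw [contDiff_iff_contDiffAt]
  intro x
  by_cases hx : mixedEmbedding.norm x = 0
  · have h1 : ∀ᶠ y in nhds x, mixedEmbedding.norm y < 1 / 2 :=
      (mixedEmbedding.continuous_norm K).continuousAt.eventually_lt_const (by rw [hx]; norm_num)
    refine (contDiffAt_const (c := (0 : ℝ))).congr_of_eventuallyEq ?_
    filter_upwards [h1] with y hy
    rw [coneBump, bump_eq_zero_of_le hy.le, mul_zero]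
  · have hw := mixedEmbedding.norm_ne_zero_iff.1 hx
    have hn : ContDiffAt ℝ 1 (fun y : mixedSpace K => mixedEmbedding.norm y) x := by
      simp only [mixedEmbedding.norm_apply]
      exact contDiffAt_prod fun w _ => (contDiffAt_normAtPlace K w (hw w)).pow _
    refine ContDiffAt.mul (contDiffAt_prod fun i _ => ?_) (contDiff_bump.contDiffAt.comp x hn)
    refine contDiff_tent.contDiffAt.comp x ?_
    have hl : ContDiffAt ℝ 1 (fun y : mixedSpace K => logMap y) x := by
      rw [contDiffAt_pi]
      intro w
      simp only [logMap_apply]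
      exact contDiffAt_const.mul (((contDiffAt_normAtPlace K w (hw w)).log (hw w)).sub
        ((hn.log hx).mul contDiffAt_const))
    let ℓ : logSpace K →ₗ[ℝ] ℝ :=
      ((basisUnitLattice K).ofZLatticeBasis ℝ (unitLattice K)).coord i
    exact (LinearMap.toContinuousLinearMap ℓ).contDiff.contDiffAt.comp x hl

set_option maxHeartbeats 1000000 in
theorem hasCompactSupport_coneBump : HasCompactSupport (coneBump K) := by
  classical
  let B := (basisUnitLattice K).ofZLatticeBasis ℝ (unitLattice K)
  set M := ∑ i, ‖B i‖ with hM
  have hM0 : 0 ≤ M := Finset.sum_nonneg fun _ _ => norm_nonneg _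
  set L := Real.log 4 with hL
  have hL0 : 0 ≤ L := Real.log_nonneg (by norm_num)
  set S := L + ∑ w : InfinitePlace K, 2 * (M + L) with hS
  refine HasCompactSupport.intro (isCompact_closedBall (0 : mixedSpace K) (Real.exp S)) ?_
  intro x hx
  by_contra hne
  apply hx
  rw [mem_closedBall_zero_iff]
  have hb : bump (mixedEmbedding.norm x) ≠ 0 := fun h => hne (by rw [coneBump, h, mul_zero])
  have hN1 : 1 / 2 < mixedEmbedding.norm x := by
    by_contra h; exact hb (bump_eq_zero_of_le (not_lt.1 h))
  have hN2 : mixedEmbedding.norm x < 4 := by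
    by_contra h; exact hb (bump_eq_zero_of_ge (not_lt.1 h))
  have hN0 : mixedEmbedding.norm x ≠ 0 := by linarith
  have hw := mixedEmbedding.norm_ne_zero_iff.1 hN0
  have hlogN : |Real.log (mixedEmbedding.norm x)| ≤ L := by
    rw [abs_le]
    constructor
    · rw [hL, ← Real.log_inv]
      exact Real.log_le_log (by norm_num) (by linarith)
    · exact Real.log_le_log (by linarith) hN2.le
  have hcoord : ∀ i, |logCoord K i x| ≤ 1 := fun i => by
    by_contra h
    exact hne (by rw [coneBump, Finset.prod_eq_zero (Finset.mem_univ i)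
      (tent_eq_zero (not_le.1 h).le), zero_mul])
  have hlm : ‖logMap x‖ ≤ M := by
    rw [← B.sum_repr (logMap x)]
    refine (norm_sum_le _ _).trans (Finset.sum_le_sum fun i _ => ?_)
    rw [_root_.norm_smul]
    exact mul_le_of_le_one_left (norm_nonneg _) (hcoord i)
  have hd : (1 : ℝ) ≤ finrank ℚ K := by exact_mod_cast finrank_pos
  have hlogNd : |Real.log (mixedEmbedding.norm x) * (finrank ℚ K : ℝ)⁻¹| ≤ L := by
    rw [abs_mul, abs_of_pos (a := (finrank ℚ K : ℝ)⁻¹) (by positivity)]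
    exact (mul_le_of_le_one_right (abs_nonneg _) (inv_le_one_of_one_le₀ hd)).trans hlogN
  have hmult : ∀ w : InfinitePlace K, (1 : ℝ) ≤ w.mult ∧ (w.mult : ℝ) ≤ 2 := by
    intro w
    rw [InfinitePlace.mult]
    split_ifs <;> norm_num
  have hlog : ∀ w : InfinitePlace K, w ≠ w₀ → |Real.log (normAtPlace w x)| ≤ M + L := by
    intro w hw0
    have h1 : |logMap x ⟨w, hw0⟩| ≤ M := (norm_le_pi_norm (logMap x) ⟨w, hw0⟩).trans hlm
    rw [logMap_apply, abs_mul, abs_of_nonneg (by positivity)] at h1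
    have h2 : |Real.log (normAtPlace w x) - Real.log (mixedEmbedding.norm x) *
        (finrank ℚ K : ℝ)⁻¹| ≤ M :=
      (le_mul_of_one_le_left (abs_nonneg _) (hmult w).1).trans h1
    have h3 := abs_sub_abs_le_abs_sub (Real.log (normAtPlace w x))
      (Real.log (mixedEmbedding.norm x) * (finrank ℚ K : ℝ)⁻¹)
    linarith
  have hsum : ∑ w : InfinitePlace K, (w.mult : ℝ) * Real.log (normAtPlace w x) =
      Real.log (mixedEmbedding.norm x) := by
    rw [mixedEmbedding.norm_apply, Real.log_prod (fun w _ => pow_ne_zero _ (hw w))]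
    simp [Real.log_pow]
  have hML : 0 ≤ 2 * (M + L) := by positivity
  have hall : ∀ w : InfinitePlace K, Real.log (normAtPlace w x) ≤ S := by
    intro w
    by_cases hw0 : w = w₀
    · rw [← Finset.add_sum_erase _ _ (Finset.mem_univ w)] at hsum
      have h1 : |∑ v ∈ Finset.univ.erase w, (v.mult : ℝ) * Real.log (normAtPlace v x)| ≤
          ∑ v : InfinitePlace K, 2 * (M + L) := by
        have h1 : ∀ v ∈ Finset.univ.erase w,
            |(v.mult : ℝ) * Real.log (normAtPlace v x)| ≤ 2 * (M + L) := by
          intro v hv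
          have hv' : v ≠ w₀ := fun h => (Finset.mem_erase.1 hv).1 (h.trans hw0.symm)
          rw [abs_mul, abs_of_nonneg (a := (v.mult : ℝ)) (Nat.cast_nonneg _)]
          exact mul_le_mul (hmult v).2 (hlog v hv') (abs_nonneg _) (by norm_num)
        exact (Finset.abs_sum_le_sum_abs _ _).trans ((Finset.sum_le_sum h1).trans
          (Finset.sum_le_sum_of_subset_of_nonneg (Finset.erase_subset _ _) fun _ _ _ => hML))
      have h2 : (w.mult : ℝ) * Real.log (normAtPlace w x) ≤ S := by
        have := neg_abs_le (∑ v ∈ Finset.univ.erase w, (v.mult : ℝ) * Real.log (normAtPlace v x))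
        have := le_abs_self (Real.log (mixedEmbedding.norm x))
        linarith
      rcases le_total 0 (Real.log (normAtPlace w x)) with h | h
      · exact (le_mul_of_one_le_left h (hmult w).1).trans h2
      · exact h.trans (by positivity)
    · have h1 := (le_abs_self _).trans (hlog w hw0)
      have h2 : 2 * (M + L) ≤ ∑ w : InfinitePlace K, 2 * (M + L) :=
by
        rw [Finset.sum_const, nsmul_eq_mul]
        refine le_mul_of_one_le_left hML ?_
        exact_mod_cast Finset.card_pos.2 ⟨w, Finset.mem_univ w⟩
      linarith
  rw [norm_eq_sup'_normAtPlace, Finset.sup'_le_iff]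
  intro w _
  have h0 : 0 < normAtPlace w x := lt_of_le_of_ne (normAtPlace_nonneg w x) (hw w).symm
  rw [← Real.log_le_iff_le_exp h0]
  exact hall w

theorem logCoord_unit_smul (ζ : torsion K) (k : Fin (rank K) → ℤ) {x : mixedSpace K}
    (hx : mixedEmbedding.norm x ≠ 0) (i : Fin (rank K)) :
    logCoord K i (((ζ : (𝓞 K)ˣ) * ∏ j, (fundSystem K j) ^ (k j)) • x) =
      k i + logCoord K i x := by
  classical
  have h1 : logEmbedding K (Additive.ofMul (∏ j, (fundSystem K j) ^ (k j))) =
      ∑ j, (k j : ℝ) • ((basisUnitLattice K).ofZLatticeBasis ℝ (unitLattice K)) j := by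
    rw [ofMul_prod, map_sum]
    refine Finset.sum_congr rfl fun j _ => ?_
    rw [ofMul_zpow, map_zsmul, logEmbedding_fundSystem, Basis.ofZLatticeBasis_apply,
      Int.cast_smul_eq_zsmul]
  rw [mul_smul, logCoord, logMap_torsion_smul _ ζ.2, logMap_unit_smul _ hx, h1, map_add,
    Finsupp.add_apply, logCoord]
  congr 1
  rw [map_sum, Finset.sum_apply']
  simp [Finsupp.single_apply]

theorem hasSum_coneBump_units {x : mixedSpace K} (hx : mixedEmbedding.norm x ≠ 0) :
    HasSum (fun u : (𝓞 K)ˣ => coneBump K (u • x))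
      (torsionOrder K * bump (mixedEmbedding.norm x)) := by
  classical
  let e : torsion K × (Fin (rank K) → ℤ) ≃ (𝓞 K)ˣ :=
    Equiv.ofBijective (fun p => (p.1 : (𝓞 K)ˣ) * ∏ i, (fundSystem K i) ^ (p.2 i)) (by
      rw [Function.bijective_iff_existsUnique]
      intro u
      obtain ⟨p, hp, hp'⟩ := exist_unique_eq_mul_prod K u
      exact ⟨p, hp.symm, fun q hq => hp' q hq.symm⟩)
  rw [← e.hasSum_iff]
  have : Fintype (torsion K) := Fintype.ofFinite _
  choose s hs1 hs2 using fun i => exists_sum_tent (logCoord K i x)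
  have key : ∀ p : torsion K × (Fin (rank K) → ℤ), coneBump K (e p • x) =
      (∏ i, tent (p.2 i + logCoord K i x)) * bump (mixedEmbedding.norm x) := by
    intro p
    rw [coneBump, norm_unit_smul]
    congr 1
    exact Finset.prod_congr rfl fun i _ => by rw [← logCoord_unit_smul K p.1 p.2 hx i]; rfl
  have := hasSum_sum_of_ne_finset_zero (L := .unconditional _)
      (f := (fun u : (𝓞 K)ˣ => coneBump K (u • x)) ∘ e)
    (s := Finset.univ ×ˢ Fintype.piFinset s) (by
      intro p hp
      simp only [Finset.mem_product, Finset.mem_univ, true_and, Fintype.mem_piFinset,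
        not_forall] at hp
      obtain ⟨i, hi⟩ := hp
      rw [Function.comp_apply, key, Finset.prod_eq_zero (Finset.mem_univ i) (hs1 i _ hi),
        zero_mul])
  convert this using 1
  simp only [Function.comp_apply, key]
  rw [Finset.sum_product]
  simp only [← Finset.sum_mul]
  rw [← Finset.prod_univ_sum s fun i k => tent (k + logCoord K i x)]
  simp only [hs2, Finset.prod_const_one, mul_one, Finset.sum_const, Finset.card_univ, nsmul_eq_mul]
  rw [torsionOrder, Nat.card_eq_fintype_card]

end Cone

section IdealSum
open Module MeasureTheory
open NumberField NumberField.Units NumberField.mixedEmbedding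
open scoped nonZeroDivisors

variable (K : Type*) [Field K] [NumberField K]

theorem norm_mixedEmbedding_eq (z : 𝓞 K) :
    mixedEmbedding.norm (mixedEmbedding K z) = Ideal.absNorm (Ideal.span {z}) := by
  rw [norm_eq_norm, Ideal.absNorm_span_singleton]
  have : Algebra.norm ℚ (z : K) = (Algebra.norm ℤ z : ℚ) := (Algebra.coe_norm_int z).symm
  rw [this, Nat.cast_natAbs, ← Int.cast_abs]
  push_cast
  rfl

/-- The lattice points attached to a nonzero ideal. -/
noncomputable def idealLatticeEquiv (J : (Ideal (𝓞 K))⁰) :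
    {z : 𝓞 K // z ∈ (J : Ideal (𝓞 K))} ≃ idealLattice K (FractionalIdeal.mk0 K J) :=
  Equiv.ofBijective (fun z => ⟨mixedEmbedding K z.1, by
    rw [mem_idealLattice]
    exact ⟨z.1, by simp, rfl⟩⟩) (by
    constructor
    · intro a b h
      have h1 := congrArg Subtype.val h
      have h2 := mixedEmbedding_injective K h1
      exact Subtype.ext (RingOfIntegers.coe_injective h2)
    · rintro ⟨x, hx⟩
      obtain ⟨y, hy, rfl⟩ := (mem_idealLattice K _).1 hx
      simp only [FractionalIdeal.coe_mk0, SetLike.mem_coe, FractionalIdeal.mem_coeIdeal] at hy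
      obtain ⟨z, hz, rfl⟩ := hy
      exact ⟨⟨z, hz⟩, rfl⟩)

open scoped Classical in
theorem tsum_ideal_lattice (J : (Ideal (𝓞 K))⁰) {T : ℝ} (hT : 0 < T)
    (hs : Summable fun x : idealLattice K (FractionalIdeal.mk0 K J) =>
      coneBump K (T⁻¹ • (x : mixedSpace K))) :
    ∑' x : idealLattice K (FractionalIdeal.mk0 K J), coneBump K (T⁻¹ • (x : mixedSpace K)) =
      torsionOrder K * ∑' I : Ideal (𝓞 K), if (I * J).IsPrincipal then
        bump ((Ideal.absNorm I * Ideal.absNorm (J : Ideal (𝓞 K)) : ℝ) / T ^ finrank ℚ K)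
        else 0 := by
  have hJ : (J : Ideal (𝓞 K)) ≠ ⊥ := nonZeroDivisors.coe_ne_zero J
  set f : {z : 𝓞 K // z ∈ (J : Ideal (𝓞 K))} → ℝ :=
    fun z => coneBump K (T⁻¹ • mixedEmbedding K z.1) with hf
  have hs' : Summable f := (idealLatticeEquiv K J).summable_iff.2 hs
  rw [← (idealLatticeEquiv K J).tsum_eq]
  change ∑' z, f z = _
  rw [← (hs'.hasSum.tsum_fiberwise (fun z => Ideal.span {z.1})).tsum_eq]
  set F : Ideal (𝓞 K) → ℝ := fun A => torsionOrder K *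
    (if A.IsPrincipal ∧ (J : Ideal (𝓞 K)) ∣ A then
    bump ((Ideal.absNorm A : ℝ) / T ^ finrank ℚ K) else 0) with hF
  have hnorm : ∀ z : 𝓞 K, mixedEmbedding.norm (T⁻¹ • mixedEmbedding K z) =
      (Ideal.absNorm (Ideal.span {z}) : ℝ) / T ^ finrank ℚ K := by
    intro z
    rw [mixedEmbedding.norm_smul, norm_mixedEmbedding_eq, abs_of_pos (inv_pos.2 hT), inv_pow,
      div_eq_inv_mul]
  have key : ∀ A : Ideal (𝓞 K),
      ∑' b : ((fun z : {z : 𝓞 K // z ∈ (J : Ideal (𝓞 K))} => Ideal.span {z.1}) ⁻¹' {A}), f b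
        = F A := by
    intro A
    by_cases hA : A.IsPrincipal ∧ (J : Ideal (𝓞 K)) ∣ A
    · simp only [hF, hA, and_self, if_true]
      obtain ⟨g, rfl⟩ := hA.1
      rw [← Ideal.span] at *
      have hgJ : g ∈ (J : Ideal (𝓞 K)) := by
        rw [← Ideal.span_singleton_le_iff_mem]; exact Ideal.le_of_dvd hA.2
      by_cases hg : g = 0
      · subst hg
        rw [Ideal.span_singleton_eq_bot.2 rfl]
        simp only [Ideal.absNorm_bot, Nat.cast_zero, zero_div]
        rw [bump_eq_zero_of_le (by norm_num), mul_zero]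
        refine (tsum_congr ?_).trans tsum_zero
        rintro ⟨b, hb⟩
        simp only [Set.mem_preimage, Set.mem_singleton_iff, Ideal.span_singleton_eq_bot] at hb
        simp only [hf, hb]
        simp [coneBump, bump_eq_zero_of_le]
      have hgn : mixedEmbedding.norm (T⁻¹ • mixedEmbedding K g) ≠ 0 := by
        rw [hnorm]
        have : Ideal.absNorm (Ideal.span {g}) ≠ 0 := by
          rw [Ne, Ideal.absNorm_eq_zero_iff, Ideal.span_singleton_eq_bot]; exact hg
        positivity
      have h1 := hasSum_coneBump_units K hgn
      rw [hnorm] at h1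
      rw [← h1.tsum_eq]
      let e : (𝓞 K)ˣ ≃ ((fun z : {z : 𝓞 K // z ∈ (J : Ideal (𝓞 K))} => Ideal.span {z.1}) ⁻¹'
          {Ideal.span {g}}) := Equiv.ofBijective
        (fun u => ⟨⟨u * g, Ideal.mul_mem_left _ _ hgJ⟩, by
          simp [Ideal.span_singleton_mul_left_unit u.isUnit]⟩) (by
          constructor
          · intro u v h
            have := congrArg (fun x => x.1.1) h
            exact Units.ext (mul_right_cancel₀ hg this)
          · rintro ⟨⟨b, hb⟩, hb'⟩
            simp only [Set.mem_preimage, Set.mem_singleton_iff] at hb'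
            obtain ⟨u, hu⟩ := (Ideal.span_singleton_eq_span_singleton.1 hb').symm
            refine ⟨u, ?_⟩
            ext
            simp [← hu, mul_comm])
      rw [← e.tsum_eq]
      refine tsum_congr fun u => ?_
      simp only [e, hf]
      congr 1
      rw [unitSMul_smul, mul_smul_comm, ← map_mul]
      change T⁻¹ • mixedEmbedding K ((u.1 * g : 𝓞 K) : K) = _
      simp
    · simp only [hF, hA, if_false, mul_zero]
      have : IsEmpty
          ((fun z : {z : 𝓞 K // z ∈ (J : Ideal (𝓞 K))} => Ideal.span {z.1}) ⁻¹' {A}) := by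
        refine ⟨fun b => hA ?_⟩
        have hb : Ideal.span {b.1.1} = A := b.2
        rw [← hb]
        exact ⟨⟨⟨_, rfl⟩⟩, Ideal.dvd_iff_le.2 ((Ideal.span_singleton_le_iff_mem _).2 b.1.2)⟩
      exact tsum_empty
  rw [tsum_congr key, hF, tsum_mul_left]
  congr 1
  have hinj : Function.Injective (fun I : Ideal (𝓞 K) => I * J) := mul_left_injective₀ hJ
  rw [← hinj.tsum_eq]
  · refine tsum_congr fun I => ?_
    simp
  · intro A hA
    simp only [Function.mem_support, ne_eq, ite_eq_right_iff, Classical.not_imp] at hA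
    obtain ⟨B, hB⟩ := hA.1.2
    exact ⟨B, by simp [hB, mul_comm]⟩

open scoped Classical in
theorem ideal_sum : ∃ c C δ : ℝ, 0 ≤ c ∧ 0 ≤ C ∧ 0 < δ ∧ ∀ x : ℝ, 1 ≤ x →
    |∑' I : Ideal (𝓞 K), bump (Ideal.absNorm I / x) - c * x| ≤ C * x ^ (1 - δ) := by
  obtain ⟨k, hk⟩ := (contDiff_coneBump K).lipschitzWith_of_hasCompactSupport
    (hasCompactSupport_coneBump K) one_ne_zero
  have hrep : ∀ c : ClassGroup (𝓞 K), ∃ J : (Ideal (𝓞 K))⁰, ClassGroup.mk0 J = c⁻¹ :=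
    fun c => ClassGroup.mk0_surjective _
  choose J hJ using hrep
  have H := fun c => lattice_sum_lipschitz (idealLattice K (FractionalIdeal.mk0 K (J c))) hk
    (hasCompactSupport_coneBump K) (coneBump_nonneg K)
  choose a C ha hC h using H
  simp only [mixedEmbedding.finrank] at h
  set n := finrank ℚ K with hn
  have hn0 : 0 < n := finrank_pos
  have hw : (0 : ℝ) < torsionOrder K := by
    have := torsionOrder_pos K
    exact_mod_cast this
  set N : ClassGroup (𝓞 K) → ℝ := fun c => Ideal.absNorm (J c : Ideal (𝓞 K)) with hN
  have hN1 : ∀ c, 1 ≤ N c := fun c => by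
    have : Ideal.absNorm (J c : Ideal (𝓞 K)) ≠ 0 := by
      rw [Ne, Ideal.absNorm_eq_zero_iff]; exact nonZeroDivisors.coe_ne_zero (J c)
    have : 1 ≤ Ideal.absNorm (J c : Ideal (𝓞 K)) := Nat.one_le_iff_ne_zero.2 this
    simp only [hN]
    exact_mod_cast this
  refine ⟨∑ c, (torsionOrder K : ℝ)⁻¹ * (a c * N c), ∑ c, (torsionOrder K : ℝ)⁻¹ * (C c * N c),
    1 / n,
    Finset.sum_nonneg fun c _ => by have := hN1 c; have := ha c; positivity,
    Finset.sum_nonneg fun c _ => by have := hN1 c; have := hC c; positivity, by positivity, ?_⟩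
  intro x hx
  have hx0 : 0 < x := by linarith
  have hfin : (Function.support fun I : Ideal (𝓞 K) => bump (Ideal.absNorm I / x)).Finite := by
    refine (Ideal.finite_setOfPred_absNorm_le (S := 𝓞 K) ⌊4 * x⌋₊).subset fun I hI => ?_
    simp only [Function.mem_support] at hI
    by_contra hcon
    apply hI
    apply bump_eq_zero_of_ge
    rw [le_div_iff₀ hx0]
    simp only [Set.mem_ofPred_eq, not_le] at hcon
    exact (Nat.lt_of_floor_lt hcon).le
  have hbot : bump ((Ideal.absNorm (⊥ : Ideal (𝓞 K)) : ℝ) / x) = 0 :=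
    bump_eq_zero_of_le (by simp)
  have hsplit : ∀ I : Ideal (𝓞 K), bump (Ideal.absNorm I / x) = ∑ c,
      if (I * J c).IsPrincipal then bump (Ideal.absNorm I / x) else 0 := by
    intro I
    by_cases hI : I = ⊥
    · subst hI
      have h0 : bump 0 = 0 := bump_eq_zero_of_le (by norm_num)
      simp [h0]
    have hI' : I ∈ (Ideal (𝓞 K))⁰ := mem_nonZeroDivisors_of_ne_zero hI
    rw [Finset.sum_eq_single (ClassGroup.mk0 ⟨I, hI'⟩)]
    · rw [if_pos]
      have : ClassGroup.mk0 (⟨I, hI'⟩ * J (ClassGroup.mk0 ⟨I, hI'⟩)) = 1 := by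
        rw [map_mul, hJ, mul_inv_cancel]
      exact (ClassGroup.mk0_eq_one_iff _).1 this
    · intro c _ hc
      rw [if_neg]
      intro hp
      apply hc
      have : ClassGroup.mk0 (⟨I, hI'⟩ * J c) = 1 := (ClassGroup.mk0_eq_one_iff _).2 hp
      rw [map_mul, hJ] at this
      exact (mul_inv_eq_one.1 this).symm
    · simp
  have hsumm : ∀ c, Summable fun I : Ideal (𝓞 K) =>
      if (I * J c).IsPrincipal then bump (Ideal.absNorm I / x) else 0 := fun c => by
    refine summable_of_hasFiniteSupport (hfin.subset fun I hI => ?_)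
    simp only [Function.mem_support, ne_eq, ite_eq_right_iff, Classical.not_imp] at hI
    exact hI.2
  rw [tsum_congr hsplit, Summable.tsum_finsetSum fun c _ => hsumm c, Finset.sum_mul,
    ← Finset.sum_sub_distrib, Finset.sum_mul]
  refine (Finset.abs_sum_le_sum_abs _ _).trans (Finset.sum_le_sum fun c _ => ?_)
  have hN0 : 0 < N c := by linarith [hN1 c]
  set T : ℝ := (x * N c) ^ (1 / n : ℝ) with hTdef
  have hTn : T ^ n = x * N c := by
    rw [hTdef, ← Real.rpow_natCast, ← Real.rpow_mul (by positivity)]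
    rw [one_div, inv_mul_cancel₀ (by positivity), Real.rpow_one]
  have hT1 : 1 ≤ T := Real.one_le_rpow (by nlinarith [hN1 c]) (by positivity)
  obtain ⟨hs, hb⟩ := h c T hT1
  rw [tsum_ideal_lattice K (J c) (by linarith) hs, ← hn, hTn] at hb
  have e1 : ∀ I : Ideal (𝓞 K), ((Ideal.absNorm I : ℝ) * (Ideal.absNorm (J c : Ideal (𝓞 K)) : ℝ))
      / (x * N c) = Ideal.absNorm I / x := by
    intro I
    change _ * N c / (x * N c) = _
    field_simp
  simp only [e1] at hb
  have hTx : x ^ (1 / n : ℝ) ≤ T := Real.rpow_le_rpow hx0.le (by nlinarith [hN1 c]) (by positivity)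
  have hxp : x ^ (1 - 1 / n : ℝ) = x / x ^ (1 / n : ℝ) := by
    rw [Real.rpow_sub hx0, Real.rpow_one]
  have hxpos : 0 < x ^ (1 / n : ℝ) := by positivity
  have e2 : C c * (x * N c) / T ≤ C c * N c * x ^ (1 - 1 / n : ℝ) := by
    rw [hxp, ← mul_div_assoc]
    rw [show C c * (x * N c) = C c * N c * x by ring]
    have := hC c
    gcongr
  calc _ = |(torsionOrder K : ℝ)⁻¹ * (torsionOrder K * (∑' I : Ideal (𝓞 K),
        if (I * J c).IsPrincipal then bump (Ideal.absNorm I / x) else 0) - a c * (x * N c))| := by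
        congr 1
        field_simp
    _ = (torsionOrder K : ℝ)⁻¹ * |(torsionOrder K * (∑' I : Ideal (𝓞 K),
        if (I * J c).IsPrincipal then bump (Ideal.absNorm I / x) else 0) - a c * (x * N c))| := by
        rw [abs_mul, abs_of_pos (inv_pos.2 hw)]
    _ ≤ (torsionOrder K : ℝ)⁻¹ * (C c * N c * x ^ (1 - 1 / n : ℝ)) := by
        gcongr
        exact hb.trans e2
    _ = _ := by ring

end IdealSum

section Selberg
open Finset
variable {ι : Type*} [DecidableEq ι] (N : ι → ℝ) (S : Finset (Finset ι))

/-- The Selberg mass `∑ ∏ 1/(N i - 1)`. -/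
noncomputable def selbergMass : ℝ := ∑ s ∈ S, ∏ i ∈ s, (N i - 1)⁻¹

/-- The Selberg weights. -/
noncomputable def selbergWeight (a : Finset ι) : ℝ :=
  (-1) ^ #a * (∏ i ∈ a, N i) * ∑ s ∈ S with a ⊆ s, ∏ i ∈ s, (N i - 1)⁻¹

variable {N S}

theorem selbergWeight_empty : selbergWeight N S ∅ = selbergMass N S := by
  simp [selbergWeight, selbergMass]

theorem selberg_diag (hS : ∀ s ∈ S, ∀ t ⊆ s, t ∈ S) (m : Finset ι → ℝ) :
    ∑ a ∈ S, ∑ b ∈ S, m a * m b * ∏ i ∈ a ∩ b, N i =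
      ∑ e ∈ S, (∏ i ∈ e, (N i - 1)) * (∑ a ∈ S with e ⊆ a, m a) ^ 2 := by
  have h1 : ∀ a ∈ S, ∀ b ∈ S, ∏ i ∈ a ∩ b, N i =
      ∑ e ∈ S, if e ⊆ a ∧ e ⊆ b then ∏ i ∈ e, (N i - 1) else 0 := by
    intro a ha b hb
    rw [← sum_filter]
    have : S.filter (fun e => e ⊆ a ∧ e ⊆ b) = (a ∩ b).powerset := by
      ext e
      simp only [mem_filter, mem_powerset, subset_inter_iff]
      exact ⟨fun h => h.2, fun h => ⟨hS a ha e h.1, h⟩⟩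
    rw [this, ← prod_one_add]
    simp
  have h2 : ∀ e : Finset ι, (∑ a ∈ S with e ⊆ a, m a) = ∑ a ∈ S, if e ⊆ a then m a else 0 :=
    fun e => sum_filter _ _
  calc _ = ∑ a ∈ S, ∑ b ∈ S, ∑ e ∈ S, (∏ i ∈ e, (N i - 1)) *
        ((if e ⊆ a then m a else 0) * (if e ⊆ b then m b else 0)) := by
        refine sum_congr rfl fun a ha => sum_congr rfl fun b hb => ?_
        rw [h1 a ha b hb, mul_sum]
        refine sum_congr rfl fun e _ => ?_
        by_cases h : e ⊆ a <;> by_cases h' : e ⊆ b <;> simp [h, h']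
        ring
    _ = ∑ e ∈ S, ∑ a ∈ S, ∑ b ∈ S, (∏ i ∈ e, (N i - 1)) *
        ((if e ⊆ a then m a else 0) * (if e ⊆ b then m b else 0)) := by
        rw [sum_congr rfl fun a _ => sum_comm, sum_comm]
    _ = _ := by
        refine sum_congr rfl fun e _ => ?_
        rw [h2, sq, sum_mul_sum, mul_sum]
        exact sum_congr rfl fun a _ => by rw [mul_sum]

theorem sum_superset_neg_one_pow (s e : Finset ι) (h : e ⊆ s) :
    ∑ a ∈ s.powerset with e ⊆ a, (-1 : ℝ) ^ #a = if s = e then (-1) ^ #e else 0 := by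
  have h1 := prod_add (fun _ : ι => (-1 : ℝ)) (fun i => if i ∈ e then 0 else 1) s
  have h2 : ∏ i ∈ s, ((-1 : ℝ) + if i ∈ e then 0 else 1) = if s = e then (-1) ^ #e else 0 := by
    split_ifs with hs
    · subst hs
      rw [prod_congr rfl (g := fun _ => (-1 : ℝ)) (fun i hi => by simp [hi])]
      simp
    · obtain ⟨i, hi, hi'⟩ : ∃ i ∈ s, i ∉ e := by
        by_contra! hc
        exact hs (Subset.antisymm hc h)
      exact prod_eq_zero hi (by simp [hi'])
  rw [← h2, h1, sum_filter]
  refine sum_congr rfl fun a ha => ?_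
  rw [prod_const]
  split_ifs with hea
  · rw [prod_eq_one, mul_one]
    intro i hi
    rw [if_neg]
    exact fun hie => (mem_sdiff.1 hi).2 (hea hie)
  · obtain ⟨i, hi, hi'⟩ := not_subset.1 hea
    rw [prod_eq_zero (i := i) (mem_sdiff.2 ⟨h hi, hi'⟩) (by simp [hi]), mul_zero]

theorem prod_union_inv_eq (hN : ∀ s ∈ S, ∀ i ∈ s, 1 < N i) {a b : Finset ι} (ha : a ∈ S)
    (hb : b ∈ S) : (∏ i ∈ a ∪ b, N i)⁻¹ =
      (∏ i ∈ a, N i)⁻¹ * (∏ i ∈ b, N i)⁻¹ * ∏ i ∈ a ∩ b, N i := by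
  have h0 : ∏ i ∈ a, N i ≠ 0 := prod_ne_zero_iff.2 fun i hi => by have := hN a ha i hi; positivity
  have h1 : ∏ i ∈ b, N i ≠ 0 := prod_ne_zero_iff.2 fun i hi => by have := hN b hb i hi; positivity
  have h2 := prod_union_inter (s₁ := a) (s₂ := b) (f := N)
  have h3 : ∏ i ∈ a ∪ b, N i ≠ 0 := by
    intro h; rw [h, zero_mul] at h2; exact mul_ne_zero h0 h1 h2.symm
  field_simp
  linarith

theorem selberg_main (hN : ∀ s ∈ S, ∀ i ∈ s, 1 < N i) (hS : ∀ s ∈ S, ∀ t ⊆ s, t ∈ S) :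
    ∑ a ∈ S, ∑ b ∈ S, selbergWeight N S a * selbergWeight N S b * (∏ i ∈ a ∪ b, N i)⁻¹ =
      selbergMass N S := by
  set m : Finset ι → ℝ := fun a => selbergWeight N S a * (∏ i ∈ a, N i)⁻¹ with hm
  have h1 : ∑ a ∈ S, ∑ b ∈ S, selbergWeight N S a * selbergWeight N S b * (∏ i ∈ a ∪ b, N i)⁻¹ =
      ∑ a ∈ S, ∑ b ∈ S, m a * m b * ∏ i ∈ a ∩ b, N i :=
    sum_congr rfl fun a ha => sum_congr rfl fun b hb => by
      rw [prod_union_inv_eq hN ha hb]; simp only [hm]; ring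
  rw [h1, selberg_diag hS, selbergMass]
  refine sum_congr rfl fun e he => ?_
  have hphi : ∀ s ∈ S, ∏ i ∈ s, (N i - 1) ≠ 0 := fun s hs => prod_ne_zero_iff.2 fun i hi => by
    have := hN s hs i hi; linarith
  have hm' : ∀ a ∈ S, m a = ∑ s ∈ S, if a ⊆ s then (-1) ^ #a * ∏ i ∈ s, (N i - 1)⁻¹ else 0 := by
    intro a ha
    have h0 : ∏ i ∈ a, N i ≠ 0 := prod_ne_zero_iff.2 fun i hi => by have := hN a ha i hi; positivity
    simp only [hm, selbergWeight]
    rw [← sum_filter, ← mul_sum]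
    field_simp
  have key : ∑ a ∈ S with e ⊆ a, m a = (-1) ^ #e * ∏ i ∈ e, (N i - 1)⁻¹ := by
    rw [sum_congr rfl fun a ha => hm' a (mem_filter.1 ha).1, sum_comm]
    rw [sum_eq_single_of_mem e he]
    · rw [sum_eq_single_of_mem e (by simp [he])]
      · simp
      · intro a ha hae
        rw [if_neg]
        exact fun h => hae (Subset.antisymm h (mem_filter.1 ha).2)
    · intro s hs hse
      rw [← sum_filter, filter_filter, ← sum_mul]
      by_cases hes : e ⊆ s
      · have h3 := sum_superset_neg_one_pow s e hes
        rw [if_neg hse] at h3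
        have : S.filter (fun a => e ⊆ a ∧ a ⊆ s) = s.powerset.filter (fun a => e ⊆ a) := by
          ext a
          simp only [mem_filter, mem_powerset]
          exact ⟨fun h => ⟨h.2.2, h.2.1⟩, fun h => ⟨hS s hs a h.1, h.2, h.1⟩⟩
        rw [this, h3, zero_mul]
      · rw [filter_eq_empty_iff.2, sum_empty, zero_mul]
        exact fun a _ h => hes (h.1.trans h.2)
  rw [key, prod_inv_distrib]
  have := hphi e he
  field_simp
  rw [← pow_mul, mul_comm, pow_mul]; simp

omit [DecidableEq ι] in
theorem selbergMass_nonneg (hN : ∀ s ∈ S, ∀ i ∈ s, 1 < N i) : 0 ≤ selbergMass N S :=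
  sum_nonneg fun s hs => prod_nonneg fun i hi => inv_nonneg.2 (by linarith [hN s hs i hi])

theorem sum_superset_le (hN : ∀ s ∈ S, ∀ i ∈ s, 1 < N i) (hS : ∀ s ∈ S, ∀ t ⊆ s, t ∈ S)
    (a : Finset ι) (ha : a ∈ S) :
    ∑ s ∈ S with a ⊆ s, ∏ i ∈ s, (N i - 1)⁻¹ ≤ (∏ i ∈ a, (N i - 1)⁻¹) * selbergMass N S := by
  rw [selbergMass, mul_sum]
  have h0 : ∀ s ∈ S, 0 ≤ ∏ i ∈ s, (N i - 1)⁻¹ := fun s hs =>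
    prod_nonneg fun i hi => inv_nonneg.2 (by linarith [hN s hs i hi])
  have h1 : ∑ s ∈ S with a ⊆ s, ∏ i ∈ s, (N i - 1)⁻¹ = ∑ s ∈ S with a ⊆ s,
      (fun t => (∏ i ∈ a, (N i - 1)⁻¹) * ∏ i ∈ t, (N i - 1)⁻¹) (s \ a) :=
    sum_congr rfl fun s hs => by
      beta_reduce; rw [mul_comm]; exact (prod_sdiff (mem_filter.1 hs).2).symm
  rw [h1, ← sum_image (f := fun t => (∏ i ∈ a, (N i - 1)⁻¹) * ∏ i ∈ t, (N i - 1)⁻¹)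
    (g := fun s => s \ a) (s := S.filter (a ⊆ ·))]
  · refine sum_le_sum_of_subset_of_nonneg ?_ fun s hs _ => mul_nonneg (h0 a ha) (h0 s hs)
    intro t ht
    obtain ⟨s, hs, rfl⟩ := mem_image.1 ht
    exact hS s (mem_filter.1 hs).1 _ sdiff_subset
  · intro s hs t ht h
    have hs' := (mem_filter.1 hs).2
    have ht' := (mem_filter.1 ht).2
    rw [← sdiff_union_of_subset hs', ← sdiff_union_of_subset ht']
    simp only at h
    rw [h]

theorem selberg_error (hN : ∀ s ∈ S, ∀ i ∈ s, 1 < N i) (hS : ∀ s ∈ S, ∀ t ⊆ s, t ∈ S) :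
    ∑ a ∈ S, ∑ b ∈ S, |selbergWeight N S a| * |selbergWeight N S b| * (∏ i ∈ a ∪ b, N i)⁻¹ ≤
      selbergMass N S ^ 5 := by
  set G := selbergMass N S with hG
  have hG0 : 0 ≤ G := selbergMass_nonneg hN
  have hphi : ∀ s ∈ S, 0 < ∏ i ∈ s, (N i - 1)⁻¹ := fun s hs =>
    prod_pos fun i hi => inv_pos.2 (by linarith [hN s hs i hi])
  have hNpos : ∀ s ∈ S, 0 < ∏ i ∈ s, N i := fun s hs =>
    prod_pos fun i hi => by linarith [hN s hs i hi]
  have hw : ∀ a ∈ S, |selbergWeight N S a| ≤ (∏ i ∈ a, N i) * ((∏ i ∈ a, (N i - 1)⁻¹) * G) := by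
    intro a ha
    rw [selbergWeight, abs_mul, abs_mul, abs_pow, abs_neg, abs_one, one_pow, one_mul,
      abs_of_pos (hNpos a ha)]
    gcongr
    · exact (hNpos a ha).le
    rw [abs_of_nonneg (sum_nonneg fun s hs => (hphi s (mem_filter.1 hs).1).le)]
    exact sum_superset_le hN hS a ha
  calc _ ≤ ∑ a ∈ S, ∑ b ∈ S, G ^ 2 * ((∏ i ∈ a, (N i - 1)⁻¹) * (∏ i ∈ b, (N i - 1)⁻¹) *
        ∏ i ∈ a ∩ b, N i) := by
        refine sum_le_sum fun a ha => sum_le_sum fun b hb => ?_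
        rw [prod_union_inv_eq hN ha hb]
        have h1 := hNpos a ha
        have h2 := hNpos b hb
        have h3 : 0 < ∏ i ∈ a ∩ b, N i := hNpos _ (hS a ha _ inter_subset_left)
        calc _ ≤ ((∏ i ∈ a, N i) * ((∏ i ∈ a, (N i - 1)⁻¹) * G)) *
              ((∏ i ∈ b, N i) * ((∏ i ∈ b, (N i - 1)⁻¹) * G)) *
              ((∏ i ∈ a, N i)⁻¹ * (∏ i ∈ b, N i)⁻¹ * ∏ i ∈ a ∩ b, N i) := by
              gcongr
              · exact mul_nonneg h1.le (mul_nonneg (hphi a ha).le hG0)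
              · exact hw a ha
              · exact hw b hb
          _ = _ := by field_simp
    _ = G ^ 2 * ∑ e ∈ S, (∏ i ∈ e, (N i - 1)) *
        (∑ a ∈ S with e ⊆ a, ∏ i ∈ a, (N i - 1)⁻¹) ^ 2 := by
        rw [← selberg_diag hS (fun a => ∏ i ∈ a, (N i - 1)⁻¹), mul_sum]
        exact sum_congr rfl fun a _ => by rw [mul_sum]
    _ ≤ G ^ 2 * ∑ e ∈ S, (∏ i ∈ e, (N i - 1)) * ((∏ i ∈ e, (N i - 1)⁻¹) * G) ^ 2 := by
        gcongr with e he
        · exact prod_nonneg fun i hi => by linarith [hN e he i hi]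
        · exact sum_nonneg fun s hs => (hphi s (mem_filter.1 hs).1).le
        · exact sum_superset_le hN hS e he
    _ = G ^ 2 * ∑ e ∈ S, (∏ i ∈ e, (N i - 1)⁻¹) * G ^ 2 := by
        congr 1
        refine sum_congr rfl fun e he => ?_
        have : ∏ i ∈ e, (N i - 1) ≠ 0 := prod_ne_zero_iff.2 fun i hi => by
          linarith [hN e he i hi]
        rw [prod_inv_distrib]
        field_simp
    _ = G ^ 5 := by
        rw [← sum_mul]
        change G ^ 2 * (G * G ^ 2) = _
        ring

end Selberg

section IdealSieve
open Finset NumberField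
open scoped Classical

variable (E : Type*) [Field E] [NumberField E]

/-- The smoothed count of ideals of norm about `x`. -/
noncomputable def idealCount (x : ℝ) : ℝ := ∑' I : Ideal (𝓞 E), bump (Ideal.absNorm I / x)

theorem finite_primesLE (D : ℕ) :
    {P : Ideal (𝓞 E) | P.IsPrime ∧ P ≠ ⊥ ∧ Ideal.absNorm P ≤ D}.Finite :=
  (Ideal.finite_setOfPred_absNorm_le D).subset fun _ h => h.2.2

noncomputable def primesLE (D : ℕ) : Finset (Ideal (𝓞 E)) := (finite_primesLE E D).toFinset

noncomputable def sieveSets (D : ℕ) : Finset (Finset (Ideal (𝓞 E))) :=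
  (primesLE E D).powerset.filter fun s => ∏ P ∈ s, Ideal.absNorm P ≤ D

noncomputable def idealNorm (I : Ideal (𝓞 E)) : ℝ := Ideal.absNorm I

/-- The sieve denominator. -/
noncomputable def sieveMass (D : ℕ) : ℝ := selbergMass (idealNorm E) (sieveSets E D)

variable {E}

theorem mem_primesLE {D : ℕ} {P : Ideal (𝓞 E)} :
    P ∈ primesLE E D ↔ P.IsPrime ∧ P ≠ ⊥ ∧ Ideal.absNorm P ≤ D := by
  simp [primesLE]

theorem mem_sieveSets {D : ℕ} {s : Finset (Ideal (𝓞 E))} :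
    s ∈ sieveSets E D ↔ s ⊆ primesLE E D ∧ ∏ P ∈ s, Ideal.absNorm P ≤ D := by
  simp [sieveSets]

theorem absNorm_pos_of_ne_bot {I : Ideal (𝓞 E)} (h : I ≠ ⊥) : 0 < Ideal.absNorm I :=
  Nat.pos_of_ne_zero (by rwa [Ne, Ideal.absNorm_eq_zero_iff])

theorem one_lt_absNorm {P : Ideal (𝓞 E)} (h : P.IsPrime) (h0 : P ≠ ⊥) : 1 < Ideal.absNorm P := by
  have h1 := absNorm_pos_of_ne_bot h0
  have h2 : Ideal.absNorm P ≠ 1 := fun h' => h.ne_top (Ideal.absNorm_eq_one_iff.1 h')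
  omega

theorem one_lt_idealNorm {D : ℕ} : ∀ s ∈ sieveSets E D, ∀ i ∈ s, 1 < idealNorm E i := by
  intro s hs i hi
  have h := mem_primesLE.1 ((mem_sieveSets.1 hs).1 hi)
  have h1 := one_lt_absNorm h.1 h.2.1
  change (1 : ℝ) < (Ideal.absNorm i : ℝ)
  exact_mod_cast h1

theorem sieveSets_down {D : ℕ} : ∀ s ∈ sieveSets E D, ∀ t ⊆ s, t ∈ sieveSets E D := by
  intro s hs t ht
  rw [mem_sieveSets] at hs ⊢
  refine ⟨ht.trans hs.1, le_trans ?_ hs.2⟩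
  refine prod_le_prod_of_subset_of_one_le' ht fun i hi _ => ?_
  have h := mem_primesLE.1 (hs.1 hi)
  exact (one_lt_absNorm h.1 h.2.1).le

theorem prime_of_mem_primesLE {D : ℕ} {P : Ideal (𝓞 E)} (h : P ∈ primesLE E D) : Prime P :=
  (Ideal.prime_iff_isPrime (mem_primesLE.1 h).2.1).2 (mem_primesLE.1 h).1

theorem prod_union_dvd_iff {D : ℕ} {a b : Finset (Ideal (𝓞 E))} (ha : a ∈ sieveSets E D)
    (hb : b ∈ sieveSets E D) (I : Ideal (𝓞 E)) :
    ∏ P ∈ a ∪ b, P ∣ I ↔ ∏ P ∈ a, P ∣ I ∧ ∏ P ∈ b, P ∣ I := by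
  constructor
  · exact fun h => ⟨(prod_dvd_prod_of_subset _ _ (fun P : Ideal (𝓞 E) => P) subset_union_left).trans
      h,
      (prod_dvd_prod_of_subset _ _ (fun P : Ideal (𝓞 E) => P) subset_union_right).trans h⟩
  · rintro ⟨h1, h2⟩
    refine prod_primes_dvd I (fun P hP => ?_) fun P hP => ?_
    · rcases mem_union.1 hP with h | h
      · exact prime_of_mem_primesLE ((mem_sieveSets.1 ha).1 h)
      · exact prime_of_mem_primesLE ((mem_sieveSets.1 hb).1 h)
    · rcases mem_union.1 hP with h | h
      · exact (dvd_prod_of_mem (fun P : Ideal (𝓞 E) => P) h).trans h1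
      · exact (dvd_prod_of_mem (fun P : Ideal (𝓞 E) => P) h).trans h2

theorem bump_support_finite {x : ℝ} (hx : 0 < x) :
    (Function.support fun I : Ideal (𝓞 E) => bump (Ideal.absNorm I / x)).Finite := by
  refine (Ideal.finite_setOfPred_absNorm_le (S := 𝓞 E) ⌊4 * x⌋₊).subset fun I hI => ?_
  simp only [Function.mem_support] at hI
  by_contra hcon
  apply hI
  apply bump_eq_zero_of_ge
  rw [le_div_iff₀ hx]
  simp only [Set.mem_ofPred_eq, not_le] at hcon
  exact (Nat.lt_of_floor_lt hcon).le

theorem summable_bump_mul {x : ℝ} (hx : 0 < x) (g : Ideal (𝓞 E) → ℝ) :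
    Summable fun I : Ideal (𝓞 E) => bump (Ideal.absNorm I / x) * g I :=
  summable_of_hasFiniteSupport ((bump_support_finite hx).subset fun I hI => by
    simp only [Function.mem_support] at hI ⊢
    exact left_ne_zero_of_mul hI)

theorem tsum_bump_dvd {x : ℝ} {A : Ideal (𝓞 E)} (hA : A ≠ ⊥) :
    ∑' I : Ideal (𝓞 E), bump (Ideal.absNorm I / x) * (if A ∣ I then 1 else 0) =
      idealCount E (x / Ideal.absNorm A) := by
  have hinj : Function.Injective (fun I : Ideal (𝓞 E) => A * I) := mul_right_injective₀ hA
  rw [← hinj.tsum_eq]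
  · rw [idealCount]
    refine tsum_congr fun I => ?_
    simp only [dvd_mul_right, if_true, mul_one, map_mul]
    congr 1
    push_cast
    rw [div_div_eq_mul_div, mul_comm]
  · intro I hI
    simp only [Function.mem_support] at hI
    have := right_ne_zero_of_mul hI
    simp only [ne_eq, ite_eq_right_iff, one_ne_zero, imp_false, not_not] at this
    obtain ⟨B, rfl⟩ := this
    exact ⟨B, rfl⟩

theorem idealNorm_prod (s : Finset (Ideal (𝓞 E))) :
    (Ideal.absNorm (∏ P ∈ s, P) : ℝ) = ∏ P ∈ s, idealNorm E P := by
  rw [map_prod]; push_cast; rfl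

theorem sieve_bound {c C δ : ℝ} (hC : 0 ≤ C) (hδ : 0 < δ)
    (h : ∀ x : ℝ, 1 ≤ x → |idealCount E x - c * x| ≤ C * x ^ (1 - δ))
    {D : ℕ} (hD : 2 ≤ D) {x : ℝ} (hx : (D : ℝ) ^ 4 ≤ x) (Q : Finset (Ideal (𝓞 E)))
    (hQ : ∀ P ∈ Q, P.IsPrime ∧ P ≠ ⊥ ∧ x ≤ Ideal.absNorm P ∧ (Ideal.absNorm P : ℝ) ≤ 2 * x) :
    #Q * sieveMass E D ^ 2 ≤ c * x * sieveMass E D +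
      C * x * (D : ℝ) ^ (-(2 * δ)) * sieveMass E D ^ 5 := by
  set S := sieveSets E D with hSdef
  set l := selbergWeight (idealNorm E) S with hl
  have hD' : (2 : ℝ) ≤ D := by exact_mod_cast hD
  have hDx : (D : ℝ) < x := lt_of_lt_of_le (by
    calc (D : ℝ) = D ^ 1 := by ring
      _ < D ^ 4 := pow_lt_pow_right₀ (by linarith) (by norm_num)) hx
  have hx0 : 0 < x := by linarith
  set W : Ideal (𝓞 E) → ℝ := fun I => ∑ a ∈ S, l a * (if ∏ P ∈ a, P ∣ I then 1 else 0) with hW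
  have hlow : #Q * sieveMass E D ^ 2 ≤
      ∑' I : Ideal (𝓞 E), bump (Ideal.absNorm I / x) * W I ^ 2 := by
    rw [← nsmul_eq_mul, ← sum_const]
    refine le_trans (sum_le_sum fun P hP => ?_) ((summable_bump_mul hx0 _).sum_le_tsum Q
      fun I _ => mul_nonneg (bump_nonneg _) (sq_nonneg _))
    obtain ⟨h1, h2, h3, h4⟩ := hQ P hP
    rw [bump_eq_one (by rwa [le_div_iff₀ hx0, one_mul]) (by rwa [div_le_iff₀ hx0]), one_mul]
    have : W P = sieveMass E D := by
      simp only [hW]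
      rw [sum_eq_single_of_mem ∅ (by simp [hSdef, mem_sieveSets]; omega)]
      · simp [hl, selbergWeight_empty, sieveMass, hSdef]
      · intro a ha hne
        rw [if_neg, mul_zero]
        intro hdvd
        obtain ⟨R, hR⟩ := Finset.nonempty_iff_ne_empty.2 hne
        have hR' := mem_primesLE.1 ((mem_sieveSets.1 ha).1 hR)
        have hRP : R ∣ P := (dvd_prod_of_mem (fun P : Ideal (𝓞 E) => P) hR).trans hdvd
        have hle := Ideal.le_of_dvd hRP
        have hm : P.IsMaximal := h1.isMaximal h2
        have := hm.eq_of_le hR'.1.ne_top hle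
        subst this
        have : (Ideal.absNorm P : ℝ) ≤ D := by exact_mod_cast hR'.2.2
        linarith
    rw [this]
  refine hlow.trans ?_
  have hexp : ∑' I : Ideal (𝓞 E), bump (Ideal.absNorm I / x) * W I ^ 2 =
      ∑ a ∈ S, ∑ b ∈ S, l a * l b * idealCount E (x * (∏ P ∈ a ∪ b, idealNorm E P)⁻¹) := by
    have e1 : ∀ I : Ideal (𝓞 E), bump (Ideal.absNorm I / x) * W I ^ 2 =
        ∑ a ∈ S, ∑ b ∈ S, l a * l b * (bump (Ideal.absNorm I / x) *
          if ∏ P ∈ a ∪ b, P ∣ I then 1 else 0) := by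
      intro I
      simp only [hW]
      rw [sq, sum_mul_sum, mul_sum]
      refine sum_congr rfl fun a ha => ?_
      rw [mul_sum]
      refine sum_congr rfl fun b hb => ?_
      by_cases h1 : ∏ P ∈ a, P ∣ I <;> by_cases h2 : ∏ P ∈ b, P ∣ I <;>
        simp [prod_union_dvd_iff ha hb, h1, h2]
      ring
    rw [tsum_congr e1, Summable.tsum_finsetSum fun a _ => summable_sum fun b _ =>
      (summable_bump_mul hx0 _).mul_left _]
    refine sum_congr rfl fun a ha => ?_
    rw [Summable.tsum_finsetSum fun b _ => (summable_bump_mul hx0 _).mul_left _]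
    refine sum_congr rfl fun b hb => ?_
    rw [tsum_mul_left, tsum_bump_dvd, idealNorm_prod, div_eq_mul_inv]
    rw [← Ideal.zero_eq_bot, prod_ne_zero_iff]
    intro P hP
    rcases mem_union.1 hP with h | h
    · exact (mem_primesLE.1 ((mem_sieveSets.1 ha).1 h)).2.1
    · exact (mem_primesLE.1 ((mem_sieveSets.1 hb).1 h)).2.1
  rw [hexp]
  have hmain := selberg_main (N := idealNorm E) (S := S) one_lt_idealNorm sieveSets_down
  have herr := selberg_error (N := idealNorm E) (S := S) one_lt_idealNorm sieveSets_down
  rw [← hl] at hmain herr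
  change _ = sieveMass E D at hmain
  change _ ≤ sieveMass E D ^ 5 at herr
  rw [← hmain]
  have hstep : ∀ a ∈ S, ∀ b ∈ S, l a * l b * idealCount E (x * (∏ P ∈ a ∪ b, idealNorm E P)⁻¹) ≤
      c * x * (l a * l b * (∏ P ∈ a ∪ b, idealNorm E P)⁻¹) +
      C * x * (D : ℝ) ^ (-(2 * δ)) * (|l a| * |l b| * (∏ P ∈ a ∪ b, idealNorm E P)⁻¹) := by
    intro a ha b hb
    set n : ℝ := ∏ P ∈ a ∪ b, idealNorm E P with hn
    have hprod : ∀ s ∈ S, 1 ≤ ∏ P ∈ s, idealNorm E P ∧ ∏ P ∈ s, idealNorm E P ≤ D := by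
      intro s hs
      constructor
      · rw [← idealNorm_prod]
        have : ∏ P ∈ s, P ≠ ⊥ := by
          rw [← Ideal.zero_eq_bot, prod_ne_zero_iff]
          exact fun P hP => (mem_primesLE.1 ((mem_sieveSets.1 hs).1 hP)).2.1
        exact_mod_cast absNorm_pos_of_ne_bot this
      · have := (mem_sieveSets.1 hs).2
        have h2 : ((∏ P ∈ s, Ideal.absNorm P : ℕ) : ℝ) ≤ D := by exact_mod_cast this
        push_cast at h2
        exact h2
    have hn0 : 0 < n := by
      refine prod_pos fun P hP => ?_
      rcases mem_union.1 hP with h | h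
      · linarith [one_lt_idealNorm a ha P h]
      · linarith [one_lt_idealNorm b hb P h]
    have hnD : n ≤ (D : ℝ) ^ 2 := by
      have h2 := prod_union_inter (s₁ := a) (s₂ := b) (f := idealNorm E)
      have h3 := (hprod (a ∩ b) (sieveSets_down a ha _ inter_subset_left)).1
      have h4 := (hprod a ha)
      have h5 := (hprod b hb)
      rw [← hn] at h2
      nlinarith
    have hy : (D : ℝ) ^ 2 ≤ x * n⁻¹ := by
      rw [← div_eq_mul_inv, le_div_iff₀ hn0]
      calc (D : ℝ) ^ 2 * n ≤ (D : ℝ) ^ 2 * (D : ℝ) ^ 2 := by gcongr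
        _ = (D : ℝ) ^ 4 := by ring
        _ ≤ x := hx
    have hD2 : (1 : ℝ) ≤ (D : ℝ) ^ 2 := by nlinarith
    have h1 := h (x * n⁻¹) (hD2.trans hy)
    have hy0 : 0 < x * n⁻¹ := by positivity
    have h2 : (x * n⁻¹) ^ (1 - δ) ≤ x * n⁻¹ * (D : ℝ) ^ (-(2 * δ)) := by
      rw [sub_eq_add_neg, Real.rpow_add hy0, Real.rpow_one]
      gcongr
      calc (x * n⁻¹) ^ (-δ) ≤ ((D : ℝ) ^ 2) ^ (-δ) :=
            Real.rpow_le_rpow_of_nonpos (by positivity) hy (by linarith)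
        _ = _ := by
            rw [← Real.rpow_natCast, ← Real.rpow_mul (by positivity)]
            congr 1; push_cast; ring
    have h3 : |l a * l b * (idealCount E (x * n⁻¹) - c * (x * n⁻¹))| ≤
        |l a| * |l b| * (C * (x * n⁻¹ * (D : ℝ) ^ (-(2 * δ)))) := by
      rw [abs_mul, abs_mul]
      gcongr
      exact h1.trans (by gcongr)
    have h4 := (le_abs_self _).trans h3
    nlinarith
  calc _ ≤ ∑ a ∈ S, ∑ b ∈ S, (c * x * (l a * l b * (∏ P ∈ a ∪ b, idealNorm E P)⁻¹) +
      C * x * (D : ℝ) ^ (-(2 * δ)) * (|l a| * |l b| * (∏ P ∈ a ∪ b, idealNorm E P)⁻¹)) :=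
        sum_le_sum fun a ha => sum_le_sum fun b hb => hstep a ha b hb
    _ = c * x * (∑ a ∈ S, ∑ b ∈ S, l a * l b * (∏ P ∈ a ∪ b, idealNorm E P)⁻¹) +
        C * x * (D : ℝ) ^ (-(2 * δ)) *
          (∑ a ∈ S, ∑ b ∈ S, |l a| * |l b| * (∏ P ∈ a ∪ b, idealNorm E P)⁻¹) := by
        simp_rw [mul_sum, sum_add_distrib]
    _ ≤ _ := by
        rw [hmain]
        gcongr

end IdealSieve

section MassBounds
open Finset NumberField UniqueFactorizationMonoid
open scoped Classical

variable (E : Type*) [Field E] [NumberField E]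

/-- Nonzero ideals of norm at most `D`. -/
noncomputable def idealsLE (D : ℕ) : Finset (Ideal (𝓞 E)) :=
  (Ideal.finite_setOfPred_absNorm_le (S := 𝓞 E) D).toFinset.filter (· ≠ ⊥)

variable {E}

theorem mem_idealsLE {D : ℕ} {I : Ideal (𝓞 E)} :
    I ∈ idealsLE E D ↔ Ideal.absNorm I ≤ D ∧ I ≠ ⊥ := by
  simp [idealsLE]

theorem geom_inv_le {N : ℝ} (hN : 1 < N) (M : ℕ) : ∑ k ∈ Icc 1 M, (N ^ k)⁻¹ ≤ (N - 1)⁻¹ := by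
  have h : ∀ M : ℕ, ∑ k ∈ Icc 1 M, (N ^ k)⁻¹ = (N - 1)⁻¹ - (N - 1)⁻¹ * (N ^ M)⁻¹ := by
    intro M
    have h1 : N - 1 ≠ 0 := by linarith
    have h2 : N ≠ 0 := by linarith
    induction M with
    | zero => simp
    | succ M ih =>
      rw [sum_Icc_succ_top (by omega), ih, pow_succ]
      field_simp
      ring
  rw [h]
  have : 0 < (N - 1)⁻¹ * (N ^ M)⁻¹ := by
    have : 0 < N - 1 := by linarith
    positivity
  linarith

theorem prod_support_pow {I : Ideal (𝓞 E)} (hI : I ≠ ⊥) :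
    ∏ P ∈ (normalizedFactors I).toFinset, P ^ (normalizedFactors I).count P = I := by
  rw [← Finset.prod_multiset_count]
  exact associated_iff_eq.1 (prod_normalizedFactors hI)

theorem support_mem_sieveSets {D : ℕ} {I : Ideal (𝓞 E)} (hI : I ∈ idealsLE E D) :
    (normalizedFactors I).toFinset ∈ sieveSets E D := by
  obtain ⟨h1, h2⟩ := mem_idealsLE.1 hI
  have hpr : ∀ P ∈ (normalizedFactors I).toFinset, Prime P ∧ P ∣ I := fun P hP => by
    rw [Multiset.mem_toFinset] at hP
    exact ⟨prime_of_normalized_factor P hP, dvd_of_mem_normalizedFactors hP⟩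
  have hle : ∀ J : Ideal (𝓞 E), J ∣ I → Ideal.absNorm J ≤ D := fun J hJ =>
    (Nat.le_of_dvd (absNorm_pos_of_ne_bot h2) (map_dvd Ideal.absNorm hJ)).trans h1
  rw [mem_sieveSets]
  refine ⟨fun P hP => mem_primesLE.2 ?_, ?_⟩
  · obtain ⟨h3, h4⟩ := hpr P hP
    exact ⟨Ideal.isPrime_of_prime h3, h3.ne_zero, hle P h4⟩
  · rw [← map_prod]
    exact hle _ (prod_primes_dvd I (fun P hP => (hpr P hP).1) fun P hP => (hpr P hP).2)

theorem sum_inv_norm_le_mass (D : ℕ) :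
    ∑ I ∈ idealsLE E D, ((Ideal.absNorm I : ℝ))⁻¹ ≤ sieveMass E D := by
  set A := idealsLE E D with hA
  obtain ⟨M, hM⟩ : ∃ M : ℕ, ∀ I ∈ A, (normalizedFactors I).card ≤ M :=
    ⟨A.sup fun I => (normalizedFactors I).card, fun I hI => le_sup (f := fun I =>
      (normalizedFactors I).card) hI⟩
  rw [sieveMass, selbergMass, ← sum_fiberwise_of_maps_to
    (g := fun I => (normalizedFactors I).toFinset) fun I hI => support_mem_sieveSets hI]
  refine sum_le_sum fun s hs => ?_
  have hN := fun P hP => one_lt_idealNorm s hs P hP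
  calc ∑ I ∈ A with (normalizedFactors I).toFinset = s, ((Ideal.absNorm I : ℝ))⁻¹
      = ∑ I ∈ A with (normalizedFactors I).toFinset = s,
        (fun p : (∀ P ∈ s, ℕ) => ∏ P ∈ s.attach, (idealNorm E P.1 ^ p P.1 P.2)⁻¹)
          (fun P _ => (normalizedFactors I).count P) := by
        refine sum_congr rfl fun I hI => ?_
        obtain ⟨h1, h2⟩ := mem_filter.1 hI
        have h3 := prod_support_pow (mem_idealsLE.1 h1).2
        rw [h2] at h3
        beta_reduce
        rw [prod_attach s (fun P => (idealNorm E P ^ (normalizedFactors I).count P)⁻¹)]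
        conv_lhs => rw [← h3]
        rw [map_prod]
        push_cast
        rw [← prod_inv_distrib]
        refine prod_congr rfl fun P _ => ?_
        rw [map_pow]; push_cast; rfl
    _ ≤ ∑ p ∈ s.pi (fun _ => Icc 1 M), ∏ P ∈ s.attach, (idealNorm E P.1 ^ p P.1 P.2)⁻¹ := by
        rw [← sum_image (f := fun p : (∀ P ∈ s, ℕ) =>
            ∏ P ∈ s.attach, (idealNorm E P.1 ^ p P.1 P.2)⁻¹)
            (g := fun I => (fun P _ => (normalizedFactors I).count P : ∀ P ∈ s, ℕ))]
        · refine sum_le_sum_of_subset_of_nonneg ?_ ?_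
          · intro p hp
            obtain ⟨I, hI, rfl⟩ := mem_image.1 hp
            obtain ⟨h1, h2⟩ := mem_filter.1 hI
            rw [Finset.mem_pi]
            intro P hP
            rw [mem_Icc]
            rw [← h2, Multiset.mem_toFinset] at hP
            exact ⟨Multiset.one_le_count_iff_mem.2 hP,
              (Multiset.count_le_card _ _).trans (hM I h1)⟩
          · intro p _ _
            exact prod_nonneg fun P _ => inv_nonneg.2 (pow_nonneg (by
              linarith [hN P.1 P.2]) _)
        · intro I hI J hJ hIJ
          obtain ⟨h1, h2⟩ := mem_filter.1 (mem_coe.1 hI)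
          obtain ⟨h1', h2'⟩ := mem_filter.1 (mem_coe.1 hJ)
          rw [← prod_support_pow (mem_idealsLE.1 h1).2, ← prod_support_pow (mem_idealsLE.1 h1').2,
            h2, h2']
          refine prod_congr rfl fun P hP => ?_
          have := congrFun (congrFun hIJ P) hP
          simp only at this
          rw [this]
    _ = ∏ P ∈ s, ∑ k ∈ Icc 1 M, (idealNorm E P ^ k)⁻¹ := by
        rw [prod_sum]
    _ ≤ ∏ P ∈ s, (idealNorm E P - 1)⁻¹ := prod_le_prod
        (fun P hP => sum_nonneg fun k _ => inv_nonneg.2 (pow_nonneg (by linarith [hN P hP]) _))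
        fun P hP => geom_inv_le (hN P hP) M

theorem idealCount_eq_sum {D : ℕ} {x : ℝ} (hx : 0 < x) (h : 4 * x ≤ D) :
    idealCount E x = ∑ I ∈ idealsLE E D, bump (Ideal.absNorm I / x) := by
  rw [idealCount, tsum_eq_sum]
  intro I hI
  rw [mem_idealsLE, not_and_or, not_le, not_not] at hI
  rcases hI with hI | hI
  · apply bump_eq_zero_of_ge
    rw [le_div_iff₀ hx]
    have : (D : ℝ) < Ideal.absNorm I := by exact_mod_cast hI
    linarith
  · rw [hI]; exact bump_eq_zero_of_le (by simp)

theorem sum_bump_le_inv {t : ℝ} (ht : 0 < t) (s : Finset ℕ) :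
    ∑ k ∈ s, bump (t / 16 ^ k) / (4 * 16 ^ k) ≤ t⁻¹ := by
  by_cases h : ∀ k ∈ s, bump (t / 16 ^ k) / (4 * 16 ^ k) = 0
  · rw [sum_eq_zero h]; positivity
  push Not at h
  obtain ⟨k, hk, hne⟩ := h
  have hsup : ∀ j : ℕ, bump (t / 16 ^ j) / (4 * 16 ^ j) ≠ 0 →
      (16 : ℝ) ^ j < 2 * t ∧ t < 4 * 16 ^ j := by
    intro j hj
    have hp : (0 : ℝ) < 16 ^ j := by positivity
    constructor
    · by_contra hc
      exact hj (by rw [bump_eq_zero_of_le (by rw [div_le_iff₀ hp]; linarith), zero_div])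
    · by_contra hc
      exact hj (by rw [bump_eq_zero_of_ge (by rw [le_div_iff₀ hp]; linarith), zero_div])
  have hk' := hsup k hne
  rw [sum_eq_single_of_mem k hk]
  · rw [div_le_iff₀ (by positivity)]
    calc bump (t / 16 ^ k) ≤ 1 := bump_le_one _
      _ ≤ t⁻¹ * (4 * 16 ^ k) := by
        rw [← div_eq_inv_mul, le_div_iff₀ ht]; linarith [hk'.2]
  · intro j _ hjk
    by_contra hj
    have hj' := hsup j hj
    rcases lt_or_gt_of_ne hjk with h | h
    · have : (16 : ℝ) ^ (j + 1) ≤ 16 ^ k := pow_le_pow_right₀ (by norm_num) h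
      rw [pow_succ] at this
      have : (0 : ℝ) < 16 ^ j := by positivity
      linarith [hk'.1, hj'.2]
    · have : (16 : ℝ) ^ (k + 1) ≤ 16 ^ j := pow_le_pow_right₀ (by norm_num) h
      rw [pow_succ] at this
      have : (0 : ℝ) < 16 ^ k := by positivity
      linarith [hk'.2, hj'.1]

theorem sum_idealCount_le_mass (K : ℕ) (s : Finset ℕ) (hs : ∀ k ∈ s, k ≤ K) :
    ∑ k ∈ s, idealCount E (16 ^ k) / (4 * 16 ^ k) ≤ sieveMass E (2 ^ (4 * K + 2)) := by
  refine le_trans ?_ (sum_inv_norm_le_mass _)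
  calc _ = ∑ k ∈ s, ∑ I ∈ idealsLE E (2 ^ (4 * K + 2)),
        bump (Ideal.absNorm I / 16 ^ k) / (4 * 16 ^ k) := by
        refine sum_congr rfl fun k hk => ?_
        rw [idealCount_eq_sum (D := 2 ^ (4 * K + 2)) (by positivity), sum_div]
        push_cast
        rw [pow_add, pow_mul, show (2 : ℝ) ^ 4 = 16 by norm_num, show (2 : ℝ) ^ 2 = 4 by norm_num]
        have : (16 : ℝ) ^ k ≤ 16 ^ K := pow_le_pow_right₀ (by norm_num) (hs k hk)
        linarith
    _ ≤ _ := by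
        rw [sum_comm]
        refine sum_le_sum fun I hI => ?_
        exact sum_bump_le_inv (by exact_mod_cast absNorm_pos_of_ne_bot (mem_idealsLE.1 hI).2) s

theorem sum_inv_norm_le (K : ℕ) :
    ∑ I ∈ idealsLE E (2 ^ K), ((Ideal.absNorm I : ℝ))⁻¹ ≤
      ∑ k ∈ range (K + 1), idealCount E (2 ^ k) / 2 ^ k := by
  calc _ ≤ ∑ I ∈ idealsLE E (2 ^ K), ∑ k ∈ range (K + 1),
        bump (Ideal.absNorm I / 2 ^ k) / 2 ^ k := by
        refine sum_le_sum fun I hI => ?_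
        obtain ⟨h1, h2⟩ := mem_idealsLE.1 hI
        have h0 := absNorm_pos_of_ne_bot h2
        have hk : Nat.log 2 (Ideal.absNorm I) ∈ range (K + 1) := by
          rw [mem_range, Nat.lt_succ_iff]
          calc _ ≤ Nat.log 2 (2 ^ K) := Nat.log_mono_right h1
            _ = K := Nat.log_pow (by norm_num) K
        refine le_trans ?_ (single_le_sum (f := fun k => bump (Ideal.absNorm I / 2 ^ k) / 2 ^ k)
          (fun k _ => div_nonneg (bump_nonneg _) (by positivity)) hk)
        have h3 : ((2 ^ Nat.log 2 (Ideal.absNorm I) : ℕ) : ℝ) ≤ Ideal.absNorm I := by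
          exact_mod_cast Nat.pow_log_le_self 2 h0.ne'
        have h4 : (Ideal.absNorm I : ℝ) < (2 ^ (Nat.log 2 (Ideal.absNorm I) + 1) : ℕ) := by
          exact_mod_cast Nat.lt_pow_succ_log_self (by norm_num) _
        push_cast at h3 h4
        rw [pow_succ] at h4
        rw [bump_eq_one (by rw [le_div_iff₀ (by positivity)]; linarith)
          (by rw [div_le_iff₀ (by positivity)]; linarith), one_div]
        exact inv_anti₀ (by positivity) h3
    _ = ∑ k ∈ range (K + 1),
        (∑ I ∈ idealsLE E (2 ^ K), bump (Ideal.absNorm I / 2 ^ k)) / 2 ^ k := by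
        rw [sum_comm]; simp_rw [sum_div]
    _ ≤ _ := by
        refine sum_le_sum fun k _ => ?_
        gcongr
        exact (summable_of_hasFiniteSupport (bump_support_finite (by positivity))).sum_le_tsum _
          fun I _ => bump_nonneg _

theorem sieveMass_le {B : ℝ} (hB : ∀ k : ℕ, idealCount E (2 ^ k) ≤ B * 2 ^ k) {η : ℝ} (hη : 0 < η) :
    ∃ C : ℝ, 0 ≤ C ∧ ∀ K : ℕ, sieveMass E (2 ^ K) ≤ C * (K + 1) * ((2 : ℝ) ^ K) ^ η := by
  have hB0 : 0 ≤ B := by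
    have h1 := hB 0
    have : 0 ≤ idealCount E (2 ^ 0) := tsum_nonneg fun I => bump_nonneg _
    simp at h1 this
    linarith
  obtain ⟨N0, hN0⟩ : ∃ N0 : ℕ, ∀ N : ℕ, N0 ≤ N → (2 : ℝ) ≤ (N : ℝ) ^ η := by
    have h := ((tendsto_rpow_atTop hη).comp tendsto_natCast_atTop_atTop).eventually_ge_atTop 2
    exact Filter.eventually_atTop.1 h
  set A := primesLE E N0 with hA
  refine ⟨2 ^ #A * B, by positivity, fun K => ?_⟩
  set D : ℕ := 2 ^ K with hD
  have hs : ∀ s ∈ sieveSets E D, ∏ P ∈ s, (idealNorm E P - 1)⁻¹ ≤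
      (2 ^ #A * ((2 : ℝ) ^ K) ^ η) * ((Ideal.absNorm (∏ P ∈ s, P) : ℝ))⁻¹ := by
    intro s hs
    have hN := one_lt_idealNorm s hs
    have h2 : ∀ P ∈ s, 2 ≤ idealNorm E P := fun P hP => by
      have h := mem_primesLE.1 ((mem_sieveSets.1 hs).1 hP)
      have h1 : 2 ≤ Ideal.absNorm P := one_lt_absNorm h.1 h.2.1
      change (2 : ℝ) ≤ (Ideal.absNorm P : ℝ)
      exact_mod_cast h1
    rw [idealNorm_prod]
    have h3 : ∏ P ∈ s, idealNorm E P ≤ (2 : ℝ) ^ K := by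
      have := (mem_sieveSets.1 hs).2
      have h2 : ((∏ P ∈ s, Ideal.absNorm P : ℕ) : ℝ) ≤ D := by exact_mod_cast this
      simp only [hD] at h2
      push_cast at h2
      exact h2
    have h4 : ∏ P ∈ s, (2 : ℝ) ≤ 2 ^ #A * (∏ P ∈ s, idealNorm E P) ^ η := by
      rw [← Real.finsetProd_rpow _ _ (fun P hP => by linarith [h2 P hP])]
      rw [← prod_filter_mul_prod_filter_not s (· ∈ A)]
      have h5 : ∏ P ∈ s with P ∈ A, (2 : ℝ) ≤ 2 ^ #A := by
        rw [prod_const]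
        exact pow_le_pow_right₀ (by norm_num) (card_le_card fun P hP => (mem_filter.1 hP).2)
      have h6 : ∏ P ∈ s with P ∉ A, (2 : ℝ) ≤ ∏ P ∈ s, idealNorm E P ^ η := by
        refine le_trans (prod_le_prod (g := fun P => idealNorm E P ^ η) (fun _ _ => by norm_num) ?_)
          ?_
        · intro P hP
          obtain ⟨h7, h8⟩ := mem_filter.1 hP
          have h := mem_primesLE.1 ((mem_sieveSets.1 hs).1 h7)
          apply hN0
          by_contra hcon
          exact h8 (mem_primesLE.2 ⟨h.1, h.2.1, by omega⟩)
        · rw [← prod_filter_mul_prod_filter_not s (· ∉ A) (f := fun P => idealNorm E P ^ η)]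
          refine le_mul_of_one_le_right (prod_nonneg fun P hP => ?_) ?_
          · have := h2 P (mem_filter.1 hP).1
            positivity
          · calc (1 : ℝ) = ∏ P ∈ s with ¬ P ∉ A, 1 := by simp
              _ ≤ _ := prod_le_prod (fun _ _ => by norm_num) fun P hP =>
                Real.one_le_rpow (by linarith [h2 P (mem_filter.1 hP).1]) hη.le
      have : (0 : ℝ) ≤ ∏ P ∈ s with P ∉ A, (2 : ℝ) := prod_nonneg fun _ _ => by norm_num
      gcongr
    have h5 : 0 < ∏ P ∈ s, idealNorm E P := prod_pos fun P hP => by linarith [h2 P hP]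
    calc ∏ P ∈ s, (idealNorm E P - 1)⁻¹ ≤ ∏ P ∈ s, (2 * (idealNorm E P)⁻¹) := by
          refine prod_le_prod (fun P hP => inv_nonneg.2 (by linarith [h2 P hP])) fun P hP => ?_
          have := h2 P hP
          rw [inv_le_comm₀ (by linarith) (by positivity), mul_inv, inv_inv]
          linarith
      _ = (∏ P ∈ s, (2 : ℝ)) * (∏ P ∈ s, idealNorm E P)⁻¹ := by
          rw [prod_mul_distrib, prod_inv_distrib]
      _ ≤ _ := by
          gcongr
          refine h4.trans ?_
          gcongr
  have hinj : Set.InjOn (fun s : Finset (Ideal (𝓞 E)) => ∏ P ∈ s, P) (sieveSets E D) := by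
    have hmem : ∀ s ∈ sieveSets E D, ∀ P, Prime P → (P ∣ ∏ Q ∈ s, Q ↔ P ∈ s) := by
      intro s hs P hP
      refine ⟨fun h => ?_, fun h => dvd_prod_of_mem (fun P : Ideal (𝓞 E) => P) h⟩
      obtain ⟨Q, hQ, hPQ⟩ := (hP.dvd_finsetProd_iff _).1 h
      have hQ' := prime_of_mem_primesLE ((mem_sieveSets.1 hs).1 hQ)
      have : P = Q := associated_iff_eq.1 ((hP.dvd_prime_iff_associated hQ').1 hPQ)
      rwa [this]
    intro s hs t ht hst
    simp only at hst
    ext P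
    constructor
    · intro h
      have hP := prime_of_mem_primesLE ((mem_sieveSets.1 hs).1 h)
      rw [← hmem t ht P hP, ← hst, hmem s hs P hP]; exact h
    · intro h
      have hP := prime_of_mem_primesLE ((mem_sieveSets.1 ht).1 h)
      rw [← hmem s hs P hP, hst, hmem t ht P hP]; exact h
  calc sieveMass E D ≤ ∑ s ∈ sieveSets E D,
        (2 ^ #A * ((2 : ℝ) ^ K) ^ η) * ((Ideal.absNorm (∏ P ∈ s, P) : ℝ))⁻¹ := sum_le_sum hs
    _ = (2 ^ #A * ((2 : ℝ) ^ K) ^ η) * ∑ I ∈ (sieveSets E D).image (fun s => ∏ P ∈ s, P),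
          ((Ideal.absNorm I : ℝ))⁻¹ := by
        rw [← mul_sum, sum_image hinj]
    _ ≤ (2 ^ #A * ((2 : ℝ) ^ K) ^ η) * ∑ I ∈ idealsLE E D, ((Ideal.absNorm I : ℝ))⁻¹ := by
        gcongr ?_ * ?_
        refine sum_le_sum_of_subset_of_nonneg ?_ fun _ _ _ => by positivity
        intro I hI
        obtain ⟨s, hs, rfl⟩ := mem_image.1 hI
        rw [mem_idealsLE, map_prod]
        refine ⟨(mem_sieveSets.1 hs).2, ?_⟩
        rw [← Ideal.zero_eq_bot, prod_ne_zero_iff]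
        exact fun P hP => (prime_of_mem_primesLE ((mem_sieveSets.1 hs).1 hP)).ne_zero
    _ ≤ (2 ^ #A * ((2 : ℝ) ^ K) ^ η) * ∑ k ∈ range (K + 1), B := by
        gcongr ?_ * ?_
        refine (sum_inv_norm_le K).trans (sum_le_sum fun k _ => ?_)
        rw [div_le_iff₀ (by positivity)]
        exact hB k
    _ = _ := by
        rw [sum_const, card_range, nsmul_eq_mul]; push_cast; ring

end MassBounds

section PrimeBound
open Finset NumberField Filter
open scoped Classical

variable (E : Type*) [Field E] [NumberField E]

variable {E} in
theorem sieveMass_ge {c C δ : ℝ} (hc : 0 < c) (hδ : 0 < δ)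
    (h : ∀ x : ℝ, 1 ≤ x → |idealCount E x - c * x| ≤ C * x ^ (1 - δ)) :
    ∀ᶠ K : ℕ in atTop, c * K / 16 ≤ sieveMass E (2 ^ (4 * K + 2)) := by
  have h1 : Tendsto (fun k : ℕ => C * ((16 : ℝ) ^ k) ^ (-δ)) atTop (nhds 0) := by
    have := ((tendsto_rpow_neg_atTop hδ).comp
      (tendsto_pow_atTop_atTop_of_one_lt (r := (16 : ℝ)) (by norm_num))).const_mul C
    simpa using this
  obtain ⟨k0, hk0⟩ := eventually_atTop.1 (h1.eventually_le_const (u := c / 2) (by positivity))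
  filter_upwards [eventually_ge_atTop (2 * k0)] with K hK
  refine le_trans ?_ (sum_idealCount_le_mass K (Ico k0 K) fun k hk => (mem_Ico.1 hk).2.le)
  have h2 : ∀ k ∈ Ico k0 K, c / 8 ≤ idealCount E (16 ^ k) / (4 * 16 ^ k) := by
    intro k hk
    have hx : (1 : ℝ) ≤ 16 ^ k := one_le_pow₀ (by norm_num)
    have hx0 : (0 : ℝ) < 16 ^ k := by positivity
    have h3 := h _ hx
    rw [sub_eq_add_neg (1 : ℝ), Real.rpow_add hx0, Real.rpow_one] at h3
    have h4 := hk0 k (mem_Ico.1 hk).1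
    rw [le_div_iff₀ (by positivity)]
    have h5 := (abs_le.1 h3).1
    nlinarith
  calc c * K / 16 ≤ ∑ k ∈ Ico k0 K, c / 8 := by
        rw [sum_const, Nat.card_Ico, nsmul_eq_mul, Nat.cast_sub (by omega)]
        have : (2 : ℝ) * k0 ≤ K := by exact_mod_cast hK
        nlinarith
    _ ≤ _ := sum_le_sum h2

theorem primes_dyadic_bound : ∃ m0 : ℕ, ∀ m : ℕ, m0 ≤ m → ∀ Q : Finset (Ideal (𝓞 E)),
    (∀ P ∈ Q, P.IsPrime ∧ P ≠ ⊥ ∧ 2 ^ m ≤ Ideal.absNorm P ∧ Ideal.absNorm P < 2 ^ (m + 1)) →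
    (#Q : ℝ) ≤ 300 * 2 ^ m / m := by
  obtain ⟨c, C, δ, hc, hC, hδ, h⟩ := ideal_sum E
  replace h : ∀ x : ℝ, 1 ≤ x → |idealCount E x - c * x| ≤ C * x ^ (1 - δ) := h
  have hB : ∀ k : ℕ, idealCount E (2 ^ k) ≤ (c + C) * 2 ^ k := by
    intro k
    have hx : (1 : ℝ) ≤ 2 ^ k := one_le_pow₀ (by norm_num)
    have h1 := (abs_le.1 (h _ hx)).2
    have h2 : ((2 : ℝ) ^ k) ^ (1 - δ) ≤ 2 ^ k := by
      conv_rhs => rw [← Real.rpow_one ((2 : ℝ) ^ k)]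
      exact Real.rpow_le_rpow_of_exponent_le hx (by linarith)
    nlinarith
  obtain ⟨C', hC', hG⟩ := sieveMass_le hB (η := δ / 3) (by positivity)
  set r : ℝ := 2 ^ (-δ) with hr
  have hr0 : 0 < r := by positivity
  have hr1 : r < 1 := Real.rpow_lt_one_of_one_lt_of_neg (by norm_num) (by linarith)
  have hone : ∀ D : ℕ, 1 ≤ D → 1 ≤ sieveMass E D := by
    intro D hD
    have h0 : (∅ : Finset (Ideal (𝓞 E))) ∈ sieveSets E D := by simp [mem_sieveSets]; omega
    have := single_le_sum (f := fun s => ∏ i ∈ s, (idealNorm E i - 1)⁻¹)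
      (fun s hs => prod_nonneg fun i hi => inv_nonneg.2
        (by linarith [one_lt_idealNorm s hs i hi])) h0
    simpa [sieveMass, selbergMass] using this
  have hlim : ∀ᶠ K : ℕ in atTop, C * ((2 ^ (4 * K + 2) : ℕ) : ℝ) ^ (-(2 * δ)) *
      sieveMass E (2 ^ (4 * K + 2)) ^ 3 * K ≤ 1 := by
    have h1 : Tendsto (fun n : ℕ => (8 * C * C' ^ 3) * ((n : ℝ) ^ 4 * r ^ n)) atTop (nhds 0) := by
      have := (tendsto_pow_const_mul_const_pow_of_abs_lt_one 4 (r := r)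
        (by rwa [abs_of_pos hr0])).const_mul (8 * C * C' ^ 3)
      simpa using this
    have h2 : Tendsto (fun K : ℕ => 4 * K + 2) atTop atTop :=
      tendsto_atTop_mono (fun K => by simp only [id]; omega) tendsto_id
    filter_upwards [(h1.comp h2).eventually_le_const (u := 1) (by norm_num)] with K hK
    refine le_trans ?_ hK
    set n : ℕ := 4 * K + 2 with hn
    simp only [Function.comp]
    have hG1 := hG n
    have hG0 := hone (2 ^ n) Nat.one_le_two_pow
    set D : ℝ := (2 : ℝ) ^ n with hD
    have hD0 : 0 < D := by positivity
    have e1 : ((2 ^ n : ℕ) : ℝ) = D := by push_cast; rfl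
    rw [e1]
    have hn1 : (n : ℝ) + 1 ≤ 2 * n := by
      have : (1 : ℝ) ≤ n := by exact_mod_cast (by omega : 1 ≤ n)
      linarith
    have hKn : (K : ℝ) ≤ n := by exact_mod_cast (by omega : K ≤ n)
    have h3 : sieveMass E (2 ^ n) ^ 3 ≤ (C' * (2 * n) * D ^ (δ / 3)) ^ 3 := by
      gcongr
      exact hG1.trans (by gcongr)
    have e2 : (D ^ (δ / 3)) ^ 3 = D ^ δ := by
      rw [← Real.rpow_natCast, ← Real.rpow_mul hD0.le]; congr 1; push_cast; ring
    have e3 : D ^ (-(2 * δ)) * D ^ δ = r ^ n := by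
      rw [← Real.rpow_add hD0, hr, hD, ← Real.rpow_natCast, ← Real.rpow_natCast,
        ← Real.rpow_mul (by norm_num), ← Real.rpow_mul (by norm_num)]
      congr 1; ring
    calc C * D ^ (-(2 * δ)) * sieveMass E (2 ^ n) ^ 3 * K
        ≤ C * D ^ (-(2 * δ)) * (C' * (2 * n) * D ^ (δ / 3)) ^ 3 * n := by gcongr
      _ = 8 * C * C' ^ 3 * (n ^ 4 * (D ^ (-(2 * δ)) * (D ^ (δ / 3)) ^ 3)) := by ring
      _ = _ := by rw [e2, e3]
  have hG2 : ∀ᶠ K : ℕ in atTop, c * K ≤ 16 * sieveMass E (2 ^ (4 * K + 2)) := by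
    rcases hc.eq_or_lt with h0 | h0
    · filter_upwards with K
      rw [← h0, zero_mul]
      have := hone (2 ^ (4 * K + 2)) Nat.one_le_two_pow
      linarith
    · filter_upwards [sieveMass_ge h0 hδ h] with K hK
      linarith
  obtain ⟨K0, hK0⟩ := eventually_atTop.1 (hlim.and (hG2.and (eventually_ge_atTop 15)))
  refine ⟨16 * K0 + 24, fun m hm Q hQ => ?_⟩
  obtain ⟨K, hK1, hK2⟩ : ∃ K, 16 * K + 8 ≤ m ∧ m ≤ 16 * K + 24 := ⟨(m - 8) / 16, by omega, by omega⟩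
  obtain ⟨h1, h2, h3⟩ := hK0 K (by omega)
  set D : ℕ := 2 ^ (4 * K + 2) with hD
  set G := sieveMass E D with hGdef
  have hG0 : 1 ≤ G := hone D Nat.one_le_two_pow
  have hx : (D : ℝ) ^ 4 ≤ (2 : ℝ) ^ m := by
    rw [hD]; push_cast; rw [← pow_mul]
    exact pow_le_pow_right₀ (by norm_num) (by omega)
  have hmain := sieve_bound hC hδ h (D := D) (by
    rw [hD]; exact le_trans (by norm_num) (Nat.pow_le_pow_right (n := 2) (by norm_num)
      (by omega : 1 ≤ 4 * K + 2))) hx Q (fun P hP => by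
    obtain ⟨q1, q2, q3, q4⟩ := hQ P hP
    have q3' : ((2 ^ m : ℕ) : ℝ) ≤ Ideal.absNorm P := by exact_mod_cast q3
    have q4' : (Ideal.absNorm P : ℝ) ≤ (2 ^ (m + 1) : ℕ) := by exact_mod_cast q4.le
    push_cast at q3' q4'
    exact ⟨q1, q2, q3', by rw [pow_succ] at q4'; linarith⟩)
  rw [← hGdef] at hmain
  have hKpos : (0 : ℝ) < K := by exact_mod_cast (by omega : 0 < K)
  have hmpos : (0 : ℝ) < m := by exact_mod_cast (by omega : 0 < m)
  set x : ℝ := 2 ^ m with hxdef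
  have hx0 : 0 < x := by positivity
  have h4 : (#Q : ℝ) * K ≤ 17 * x := by
    have e1 : (#Q * K : ℝ) * G ^ 2 ≤ 17 * x * G ^ 2 := by
      calc (#Q * K : ℝ) * G ^ 2 = (#Q * G ^ 2) * K := by ring
        _ ≤ (c * x * G + C * x * (D : ℝ) ^ (-(2 * δ)) * G ^ 5) * K := by gcongr
        _ = x * G * (c * K) + x * G ^ 2 * (C * (D : ℝ) ^ (-(2 * δ)) * G ^ 3 * K) := by ring
        _ ≤ x * G * (16 * G) + x * G ^ 2 * 1 := by gcongr
        _ = _ := by ring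
    exact le_of_mul_le_mul_right e1 (by positivity)
  rw [le_div_iff₀ hmpos]
  have h5 : (m : ℝ) ≤ 16 * K + 24 := by exact_mod_cast hK2
  have h6 : (15 : ℝ) ≤ K := by exact_mod_cast h3
  have h7 : (17 : ℝ) * m ≤ 300 * K := by linarith
  have h8 : (0 : ℝ) ≤ #Q := by positivity
  nlinarith

theorem primeCounting_two_pow_ge {M : ℕ} (hM : 3 ≤ M) :
    (2 : ℝ) ^ M / (2 * M) ≤ Nat.primeCounting (2 ^ M) := by
  refine le_trans ?_ (Chebyshev.pi_ge (2 ^ M))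
  push_cast
  have hl2 : 0 < Real.log 2 := Real.log_pos (by norm_num)
  have hMp : (0 : ℝ) < M := by exact_mod_cast (by omega : 0 < M)
  rw [Real.log_pow, le_div_iff₀ (by positivity)]
  have h1 : Real.log (2 ^ M + 1) ≤ (M + 1) * Real.log 2 := by
    have : Real.log (2 ^ (M + 1)) = (M + 1) * Real.log 2 := by
      rw [Real.log_pow]; push_cast; ring
    rw [← this]
    apply Real.log_le_log (by positivity)
    rw [pow_succ]
    have : (1 : ℝ) ≤ 2 ^ M := one_le_pow₀ (by norm_num)
    linarith
  have h2 : (M : ℝ) + 1 ≤ 2 ^ M / 2 := by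
    have : ∀ n : ℕ, 3 ≤ n → 2 * (n + 1) ≤ 2 ^ n := by
      intro n hn
      induction n, hn using Nat.le_induction with
      | base => norm_num
      | succ n hn ih => rw [pow_succ]; omega
    have h3 : ((2 * (M + 1) : ℕ) : ℝ) ≤ (2 ^ M : ℕ) := by exact_mod_cast this M hM
    push_cast at h3
    linarith
  have e : (2 : ℝ) ^ M / (2 * M) * (M * Real.log 2) = 2 ^ M / 2 * Real.log 2 := by field_simp
  rw [e]
  nlinarith

theorem sum_two_pow_div_le (M : ℕ) (hM : 1 ≤ M) :
    ∑ m ∈ Icc 1 M, (2 : ℝ) ^ m / m ≤ 6 * 2 ^ M / M := by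
  induction M, hM using Nat.le_induction with
  | base => norm_num
  | succ M hM ih =>
    rw [sum_Icc_succ_top (by omega)]
    have hp : (0 : ℝ) < 2 ^ M := by positivity
    have hM0 : (1 : ℝ) ≤ M := by exact_mod_cast hM
    rcases hM.eq_or_lt with h1 | h1
    · subst h1; norm_num
    have hM2 : (2 : ℝ) ≤ M := by exact_mod_cast h1
    have : 6 * (2 : ℝ) ^ M / M ≤ 10 * 2 ^ M / (M + 1) := by
      rw [div_le_div_iff₀ (by positivity) (by positivity)]
      nlinarith
    calc _ ≤ 10 * (2 : ℝ) ^ M / (M + 1) + 2 ^ (M + 1) / ((M + 1 : ℕ) : ℝ) := by linarith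
      _ = _ := by push_cast; rw [pow_succ]; ring

/-- The number of primes of a number field of norm at most `X` is eventually bounded by an
absolute multiple of the number of rational primes. -/
theorem card_primesLE_le : ∀ᶠ X : ℕ in atTop,
    (#(primesLE E X) : ℝ) ≤ 4000 * Nat.primeCounting X := by
  obtain ⟨m0, hm0⟩ := primes_dyadic_bound E
  set B := #(primesLE E (2 ^ (m0 + 1))) with hB
  have hlim : Tendsto (fun M : ℕ => (2 : ℝ) ^ M / M) atTop atTop := by
    have h1 := tendsto_pow_const_div_const_pow_of_one_lt 1 (r := (2 : ℝ)) (by norm_num)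
    have h2 : Tendsto (fun M : ℕ => ((M : ℝ) ^ 1 / 2 ^ M)) atTop (nhdsWithin 0 (Set.Ioi 0)) :=
      tendsto_nhdsWithin_iff.2 ⟨h1, by
        filter_upwards [eventually_gt_atTop 0] with M hM
        have : (0 : ℝ) < M := by exact_mod_cast hM
        simp only [Set.mem_Ioi]; positivity⟩
    refine h2.inv_tendsto_nhdsGT_zero.congr fun M => ?_
    simp
  have hlog : Tendsto (fun X : ℕ => Nat.log 2 X) atTop atTop := by
    refine tendsto_atTop.2 fun b => ?_
    filter_upwards [eventually_ge_atTop (2 ^ b)] with X hX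
    calc b = Nat.log 2 (2 ^ b) := (Nat.log_pow (by norm_num) b).symm
      _ ≤ _ := Nat.log_mono_right hX
  filter_upwards [hlog.eventually_ge_atTop 3, (hlim.comp hlog).eventually_ge_atTop (B : ℝ),
    eventually_gt_atTop 0] with X hX hXB hX0
  set M := Nat.log 2 X with hM
  simp only [Function.comp] at hXB
  have hMX : 2 ^ M ≤ X := Nat.pow_log_le_self 2 hX0.ne'
  have hXM : X < 2 ^ (M + 1) := Nat.lt_pow_succ_log_self (by norm_num) X
  set Q : ℕ → Finset (Ideal (𝓞 E)) := fun m => (primesLE E X).filter fun P =>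
    2 ^ m ≤ Ideal.absNorm P ∧ Ideal.absNorm P < 2 ^ (m + 1) with hQ
  have hsub : primesLE E X ⊆ primesLE E (2 ^ (m0 + 1)) ∪
      ((Icc 1 M).filter (m0 ≤ ·)).biUnion Q := by
    intro P hP
    obtain ⟨h1, h2, h3⟩ := mem_primesLE.1 hP
    rw [mem_union]
    by_cases h : Ideal.absNorm P ≤ 2 ^ (m0 + 1)
    · exact Or.inl (mem_primesLE.2 ⟨h1, h2, h⟩)
    · right
      rw [mem_biUnion]
      have hN0 := absNorm_pos_of_ne_bot h2
      have hlo : m0 + 1 ≤ Nat.log 2 (Ideal.absNorm P) := by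
        calc m0 + 1 = Nat.log 2 (2 ^ (m0 + 1)) := (Nat.log_pow (by norm_num) _).symm
          _ ≤ _ := Nat.log_mono_right (by omega)
      refine ⟨Nat.log 2 (Ideal.absNorm P), ?_, ?_⟩
      · rw [mem_filter, mem_Icc]
        exact ⟨⟨by omega, Nat.log_mono_right h3⟩, by omega⟩
      · exact mem_filter.2 ⟨hP, Nat.pow_log_le_self 2 hN0.ne',
          Nat.lt_pow_succ_log_self (by norm_num) _⟩
  have h1 : (#(primesLE E X) : ℝ) ≤ B + ∑ m ∈ Icc 1 M, 300 * ((2 : ℝ) ^ m / m) := by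
    have h2 := (card_le_card hsub).trans (card_union_le _ _)
    have h3 := h2.trans (Nat.add_le_add_left card_biUnion_le _)
    calc (#(primesLE E X) : ℝ) ≤ ((B + ∑ m ∈ Icc 1 M with m0 ≤ m, #(Q m) : ℕ) : ℝ) := by
          exact_mod_cast h3
      _ = B + ∑ m ∈ Icc 1 M with m0 ≤ m, (#(Q m) : ℝ) := by push_cast; rfl
      _ ≤ B + ∑ m ∈ Icc 1 M with m0 ≤ m, 300 * ((2 : ℝ) ^ m / m) := by
          gcongr with m hm
          rw [← mul_div_assoc]
          refine hm0 m (mem_filter.1 hm).2 _ fun P hP => ?_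
          obtain ⟨h4, h5⟩ := mem_filter.1 hP
          obtain ⟨h6, h7, _⟩ := mem_primesLE.1 h4
          exact ⟨h6, h7, h5⟩
      _ ≤ _ := by
          gcongr
          exact filter_subset _ _
  rw [← mul_sum] at h1
  have h2 := sum_two_pow_div_le M (by omega)
  have h3 := primeCounting_two_pow_ge hX
  have h4 : (Nat.primeCounting (2 ^ M) : ℝ) ≤ Nat.primeCounting X := by
    exact_mod_cast Nat.monotone_primeCounting hMX
  have hMp : (0 : ℝ) < M := by exact_mod_cast (by omega : 0 < M)
  have e1 : (2 : ℝ) ^ M / (2 * M) = (2 ^ M / M) / 2 := by rw [mul_comm, div_div]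
  rw [e1] at h3
  rw [mul_div_assoc] at h2
  linarith

end PrimeBound

section FrobeniusGenerates
open scoped Pointwise

attribute [local instance] Ideal.Quotient.field

theorem exists_pow_eq_of_inertia_eq_bot {R S G : Type*} [CommRing R] [CommRing S] [Algebra R S]
    [Group G] [MulSemiringAction G S] [SMulCommClass G R S] {Q : Ideal S} [Q.IsMaximal]
    [(Q.under R).IsMaximal] [Finite (S ⧸ Q)] {σ δ : G} (hσ : IsArithFrobAt R σ Q)
    (hI : Q.inertia G = ⊥) (hδ : δ ∈ MulAction.stabilizer G Q) : ∃ k : ℕ, δ = σ ^ k := by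
  have : Finite (R ⧸ Q.under R) := .of_injective _ Ideal.algebraMap_quotient_injective
  cases nonempty_fintype (R ⧸ Q.under R)
  obtain ⟨k, hk⟩ := (FiniteField.bijective_frobeniusAlgEquivOfAlgebraic_pow (R ⧸ Q.under R)
    (S ⧸ Q)).surjective (Ideal.Quotient.stabilizerHom Q (Q.under R) G ⟨δ, hδ⟩)
  refine ⟨k, ?_⟩
  have h1 (x : S) : Ideal.Quotient.mk Q (δ • x) =
      Ideal.Quotient.mk Q x ^ Nat.card (R ⧸ Q.under R) ^ (k : ℕ) := by
    have := DFunLike.congr_fun hk (Ideal.Quotient.mk Q x)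
    simp only [Ideal.Quotient.stabilizerHom_apply] at this
    rw [AlgEquiv.coe_pow, FiniteField.coe_frobeniusAlgEquivOfAlgebraic_iterate] at this
    rw [Nat.card_eq_fintype_card]
    exact this.symm
  have h2 (j : ℕ) (x : S) : Ideal.Quotient.mk Q (σ ^ j • x) =
      Ideal.Quotient.mk Q x ^ Nat.card (R ⧸ Q.under R) ^ j := by
    induction j generalizing x with
    | zero => simp
    | succ j ih =>
      rw [pow_succ, mul_smul, ih, pow_succ', pow_mul, ← hσ.mk_apply]
      rfl
  have : δ * (σ ^ (k : ℕ))⁻¹ ∈ Q.inertia G := by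
    intro x
    refine Ideal.Quotient.eq.mp ?_
    rw [mul_smul, h1, ← h2, smul_inv_smul]
  rw [hI, Subgroup.mem_bot] at this
  exact mul_inv_eq_one.mp this

end FrobeniusGenerates

section FixedFieldPrimes
open scoped Pointwise
open NumberField IntermediateField

variable {K : Type*} [Field K] [NumberField K] [IsGalois ℚ K]

theorem card_eq_of_forall_pow_eq {F : Type*} [Field F] [Finite F] {p : ℕ} (hp : p.Prime)
    (h0 : (p : F) = 0) (h : ∀ x : F, x ^ p = x) : Nat.card F = p := by
  classical
  cases nonempty_fintype F
  rw [Nat.card_eq_fintype_card]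
  apply le_antisymm
  · have h1 : (Polynomial.X ^ p - Polynomial.X : Polynomial F) ≠ 0 :=
      FiniteField.X_pow_card_sub_X_ne_zero F hp.one_lt
    have := Polynomial.card_le_degree_of_subset_roots (p := Polynomial.X ^ p - Polynomial.X)
      (Z := (Finset.univ : Finset F)) (fun x _ => by simp [h1, h])
    rwa [FiniteField.X_pow_card_sub_X_natDegree_eq F hp.one_lt, Finset.card_univ] at this
  · have : addOrderOf (1 : F) = p :=
      addOrderOf_eq_prime (hp := ⟨hp⟩) (by simpa using h0) one_ne_zero
    exact this ▸ addOrderOf_le_card_univ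

instance isInvariant_fixedField (H : Subgroup Gal(K/ℚ)) :
    Algebra.IsInvariant (𝓞 (fixedField H)) (𝓞 K) H where
  isInvariant b hb := by
    have : (b : K) ∈ fixedField H := fun h => by
      have := congrArg (algebraMap (𝓞 K) K) (hb h)
      exact this
    refine ⟨⟨⟨b, this⟩, ?_⟩, ?_⟩
    · have := b.2
      exact (isIntegral_algHom_iff ((fixedField H).val.restrictScalars ℤ)
        (fixedField H).val.injective).mp this
    · rfl

instance smulCommClass_fixedField (H : Subgroup Gal(K/ℚ)) :
    SMulCommClass H (𝓞 (fixedField H)) (𝓞 K) where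
  smul_comm h x y := by
    rw [Algebra.smul_def, Algebra.smul_def, smul_mul']
    congr 1
    exact RingOfIntegers.ext (x.1.2 h)

omit [IsGalois ℚ K] in
theorem smul_algebraMap_fixedField (H : Subgroup Gal(K/ℚ)) {τ : Gal(K/ℚ)} (hτ : τ ∈ H)
    (x : 𝓞 (fixedField H)) : τ • algebraMap (𝓞 (fixedField H)) (𝓞 K) x = algebraMap _ _ x :=
  RingOfIntegers.ext (x.1.2 ⟨τ, hτ⟩)

omit [IsGalois ℚ K] in
theorem absNorm_under_fixedField {H : Subgroup Gal(K/ℚ)} {τ : Gal(K/ℚ)} (hτ : τ ∈ H)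
    {Q : Ideal (𝓞 K)} [hQ : Q.IsPrime] {p : ℕ} (hp : p.Prime) (hpQ : (p : 𝓞 K) ∈ Q)
    (hF : ∀ x : 𝓞 K, τ • x - x ^ p ∈ Q) :
    Ideal.absNorm (Q.under (𝓞 (fixedField H))) = p := by
  have hpu : (p : 𝓞 (fixedField H)) ∈ Q.under (𝓞 (fixedField H)) := by
    rw [Ideal.mem_comap]; simpa using hpQ
  have hne : Q.under (𝓞 (fixedField H)) ≠ ⊥ := by
    intro h
    rw [h, Ideal.mem_bot] at hpu
    exact hp.ne_zero (by exact_mod_cast hpu)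
  have hmax : (Q.under (𝓞 (fixedField H))).IsMaximal :=
    Ideal.IsPrime.isMaximal inferInstance hne
  let := Ideal.Quotient.field (Q.under (𝓞 (fixedField H)))
  have : Finite (𝓞 (fixedField H) ⧸ Q.under (𝓞 (fixedField H))) :=
    Ring.HasFiniteQuotients.finiteQuotient hne
  rw [Ideal.absNorm_apply, Submodule.cardQuot_apply]
  refine card_eq_of_forall_pow_eq hp ?_ fun x => ?_
  · have := Ideal.Quotient.eq_zero_iff_mem.mpr hpu
    simpa using this
  · obtain ⟨x, rfl⟩ := Ideal.Quotient.mk_surjective x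
    rw [← map_pow]
    symm
    rw [Ideal.Quotient.eq, Ideal.mem_comap, map_sub, map_pow]
    have := hF (algebraMap _ _ x)
    rwa [smul_algebraMap_fixedField H hτ] at this

end FixedFieldPrimes

section FrobeniusCount
open scoped Pointwise Classical
open NumberField IntermediateField Finset

noncomputable def normPrimes (E : Type*) [Field E] [NumberField E] (p : ℕ) : Finset (Ideal (𝓞 E)) :=
  (primesLE E p).filter fun P => Ideal.absNorm P = p

theorem sum_card_normPrimes_le (E : Type*) [Field E] [NumberField E] (X : ℕ) :
    ∑ p ∈ range (X + 1), #(normPrimes E p) ≤ #(primesLE E X) := by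
  rw [← card_biUnion]
  · refine card_le_card fun P hP => ?_
    simp only [mem_biUnion, normPrimes, mem_filter, mem_primesLE, Finset.mem_range] at hP ⊢
    obtain ⟨p, hp, ⟨h1, h2, h3⟩, h4⟩ := hP
    exact ⟨h1, h2, by omega⟩
  · intro p _ q _ hpq
    rw [Function.onFun, Finset.disjoint_left]
    intro P hP hQ
    exact hpq ((mem_filter.mp hP).2.symm.trans (mem_filter.mp hQ).2)

variable {K : Type*} [Field K] [NumberField K]

omit [NumberField K] in
theorem card_int_quotient_under {Q : Ideal (𝓞 K)} [hQ : Q.IsPrime] {p : ℕ} (hp : p.Prime)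
    (hpQ : (p : 𝓞 K) ∈ Q) : Nat.card (ℤ ⧸ Q.under ℤ) = p := by
  have h1 : Ideal.span {(p : ℤ)} ≤ Q.under ℤ := by
    rw [Ideal.span_singleton_le_iff_mem, Ideal.mem_comap]; simpa using hpQ
  have hm : (Ideal.span {(p : ℤ)}).IsMaximal :=
    PrincipalIdealRing.isMaximal_of_irreducible (Nat.prime_iff_prime_int.mp hp).irreducible
  rw [← hm.eq_of_le (Ideal.IsPrime.ne_top inferInstance) h1, ← Submodule.cardQuot_apply,
    ← Ideal.absNorm_apply, Ideal.absNorm_span_singleton]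
  simp

variable [IsGalois ℚ K]

omit [IsGalois ℚ K] in
theorem card_conj_mem_le (H : Subgroup Gal(K/ℚ)) {Q : Ideal (𝓞 K)} [hQ : Q.IsPrime] {p : ℕ}
    (hp : p.Prime) (hpQ : (p : 𝓞 K) ∈ Q) {σ : Gal(K/ℚ)} (hσ : IsArithFrobAt ℤ σ Q)
    (hI : Q.inertia Gal(K/ℚ) = ⊥) :
    #{g : Gal(K/ℚ) | g⁻¹ * σ * g ∈ H} ≤ Nat.card H * #(normPrimes (fixedField H) p) := by
  have hne : Q ≠ ⊥ := by
    rintro rfl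
    rw [Ideal.mem_bot] at hpQ
    exact hp.ne_zero (by exact_mod_cast hpQ)
  have hmax : Q.IsMaximal := hQ.isMaximal hne
  have : Finite (𝓞 K ⧸ Q) := Ring.HasFiniteQuotients.finiteQuotient hne
  have hmaxZ : (Q.under ℤ).IsMaximal := by
    exact Ideal.isMaximal_comap_of_isIntegral_of_isMaximal Q
  refine card_le_mul_card_image_of_maps_to
    (f := fun g => (g⁻¹ • Q).under (𝓞 (fixedField H))) ?_ _ ?_
  · intro g hg
    rw [mem_filter] at hg
    have hpg : (p : 𝓞 K) ∈ g⁻¹ • Q := by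
      rw [Ideal.mem_inv_pointwise_smul_iff]
      have : g • (p : 𝓞 K) = p := map_natCast (MulSemiringAction.toRingHom _ _ g) p
      rwa [this]
    have hfr := hσ.conj g⁻¹
    rw [inv_inv] at hfr
    have hfr' (x : 𝓞 K) : (g⁻¹ * σ * g) • x - x ^ p ∈ g⁻¹ • Q := by
      have := hfr x
      rwa [card_int_quotient_under hp hpg] at this
    have hN := absNorm_under_fixedField hg.2 hp hpg hfr'
    rw [normPrimes, mem_filter, mem_primesLE]
    refine ⟨⟨inferInstance, ?_, hN.le⟩, hN⟩
    intro h
    rw [h, Ideal.absNorm_bot] at hN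
    exact hp.ne_zero hN.symm
  · intro P _
    rcases Finset.eq_empty_or_nonempty
      (filter (fun g : Gal(K/ℚ) => (g⁻¹ • Q).under (𝓞 (fixedField H)) = P)
        {g : Gal(K/ℚ) | g⁻¹ * σ * g ∈ H}) with h | ⟨g₁, h₁⟩
    · rw [h]; simp
    have : filter (fun g : Gal(K/ℚ) => (g⁻¹ • Q).under (𝓞 (fixedField H)) = P)
        {g : Gal(K/ℚ) | g⁻¹ * σ * g ∈ H} ⊆ (univ.filter (· ∈ H)).image fun h => g₁ * h := by
      intro g₂ h₂
      simp only [mem_filter, mem_univ, true_and] at h₁ h₂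
      obtain ⟨h, hh⟩ := Algebra.IsInvariant.exists_smul_of_under_eq (𝓞 (fixedField H)) (𝓞 K) H
        (g₁⁻¹ • Q) (g₂⁻¹ • Q) (h₁.2.trans h₂.2.symm)
      have hst : g₂ * h * g₁⁻¹ ∈ MulAction.stabilizer Gal(K/ℚ) Q := by
        rw [MulAction.mem_stabilizer_iff, mul_smul, mul_smul]
        have : (h : Gal(K/ℚ)) • g₁⁻¹ • Q = g₂⁻¹ • Q := hh.symm
        rw [this, smul_inv_smul]
      obtain ⟨k, hk⟩ := exists_pow_eq_of_inertia_eq_bot hσ hI hst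
      have hmem : (g₁⁻¹ * σ * g₁) ^ k * (h : Gal(K/ℚ))⁻¹ ∈ H :=
        H.mul_mem (H.pow_mem h₁.1 _) (H.inv_mem h.2)
      refine mem_image.mpr ⟨_, mem_filter.mpr ⟨mem_univ _, hmem⟩, ?_⟩
      have e : (g₁⁻¹ * σ * g₁) ^ k = g₁⁻¹ * σ ^ k * g₁ := by
        have := conj_pow (i := k) (a := g₁⁻¹) (b := σ)
        rwa [inv_inv] at this
      simp only [e, ← hk]
      group
    refine (card_le_card this).trans (card_image_le.trans ?_)
    rw [Nat.card_eq_fintype_card, Fintype.card_subtype]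

end FrobeniusCount

section TwoGroupAverage
open Finset
open scoped Classical

theorem totient_le_card_generators {G : Type*} [Group G] [Finite G] (Fix : Finset G)
    (hpow : ∀ s ∈ Fix, ∀ k : ℕ, s ^ k ∈ Fix) {s : G} (hs : s ∈ Fix) :
    (orderOf s).totient ≤ #{τ ∈ Fix | orderOf τ = orderOf s ∧ s ∈ Subgroup.zpowers τ} := by
  rw [Nat.totient]
  refine card_le_card_of_injOn (fun k => s ^ k) (fun k hk => ?_) ?_
  · simp only [coe_filter, Finset.mem_range, Set.mem_ofPred_eq] at hk ⊢
    exact ⟨hpow s hs k, (Nat.Coprime.orderOf_pow hk.2), mem_zpowers_pow_iff.mpr hk.2.symm⟩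
  · intro a ha b hb hab
    simp only [coe_filter, Finset.mem_range, Set.mem_ofPred_eq] at ha hb
    exact pow_injOn_Iio_orderOf ha.1 hb.1 hab

theorem card_le_two_mul_sum {G : Type*} [Group G] [Fintype G] (hG : IsPGroup 2 G) (Fix : Finset G)
    (hconj : ∀ s ∈ Fix, ∀ g : G, g⁻¹ * s * g ∈ Fix) (hpow : ∀ s ∈ Fix, ∀ k : ℕ, s ^ k ∈ Fix)
    {σ : G} (hσ : σ ∈ Fix) (N : G → ℕ)
    (hN : ∀ τ ∈ Fix, #{g : G | g⁻¹ * σ * g ∈ Subgroup.zpowers τ} ≤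
      Nat.card (Subgroup.zpowers τ) * N τ) :
    Nat.card G ≤ 2 * ∑ τ ∈ Fix, N τ := by
  set m := orderOf σ with hm
  have ho (g : G) : orderOf (g⁻¹ * σ * g) = m := by
    have := orderOf_injective (MulAut.conj g⁻¹).toMonoidHom (MulAut.conj g⁻¹).injective σ
    simpa using this
  have h1 : Nat.card G * m.totient ≤ m * ∑ τ ∈ Fix, N τ := by
    calc Nat.card G * m.totient = ∑ _g : G, m.totient := by simp
      _ ≤ ∑ g : G, #{τ ∈ Fix.filter (orderOf · = m) | g⁻¹ * σ * g ∈ Subgroup.zpowers τ} := by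
          refine sum_le_sum fun g _ => ?_
          have := totient_le_card_generators Fix hpow (hconj σ hσ g)
          rw [ho] at this
          rwa [filter_filter]
      _ = ∑ τ ∈ Fix.filter (orderOf · = m), #{g : G | g⁻¹ * σ * g ∈ Subgroup.zpowers τ} := by
          simp only [card_filter]
          exact sum_comm
      _ ≤ ∑ τ ∈ Fix.filter (orderOf · = m), m * N τ := by
          refine sum_le_sum fun τ hτ => ?_
          rw [mem_filter] at hτ
          have := hN τ hτ.1
          rwa [Nat.card_zpowers, hτ.2] at this
      _ ≤ ∑ τ ∈ Fix, m * N τ := sum_le_sum_of_subset (filter_subset _ _)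
      _ = _ := (mul_sum _ _ _).symm
  have h2 : m ≤ 2 * m.totient := by
    obtain ⟨k, hk⟩ := (IsPGroup.iff_orderOf.mp hG) σ
    rw [hm, hk]
    rcases k with _ | k
    · simp
    · rw [Nat.totient_prime_pow_succ Nat.prime_two, pow_succ]; omega
  have hm0 : 0 < m := orderOf_pos σ
  have : m * Nat.card G ≤ m * (2 * ∑ τ ∈ Fix, N τ) := by nlinarith
  exact Nat.le_of_mul_le_mul_left this hm0

end TwoGroupAverage

section FrobeniusDensity
open scoped Pointwise Classical
open NumberField IntermediateField Finset Filter

variable {K : Type*} [Field K] [NumberField K]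

theorem exists_bound_of_mem_prime {x : 𝓞 K} (hx : x ≠ 0) : ∃ B : ℕ, ∀ p : ℕ, p.Prime → B < p →
    ∀ Q : Ideal (𝓞 K), Q.IsPrime → (p : 𝓞 K) ∈ Q → x ∉ Q := by
  refine ⟨Ideal.absNorm (Ideal.span {x}), fun p hp hB Q hQ hpQ hxQ => ?_⟩
  have h0 : Ideal.absNorm (Ideal.span {x}) ≠ 0 := by
    rw [Ne, Ideal.absNorm_eq_zero_iff]; simpa using hx
  have hcop : Nat.Coprime (Ideal.absNorm (Ideal.span {x})) p :=
    (Nat.coprime_of_lt_prime h0 hB hp).symm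
  obtain ⟨a, b, hab⟩ := hcop.isCoprime.map (Int.castRingHom (𝓞 K))
  have hN : ((Ideal.absNorm (Ideal.span {x}) : ℕ) : 𝓞 K) ∈ Q :=
    (Ideal.span_singleton_le_iff_mem _).mpr hxQ (Ideal.absNorm_mem _)
  refine hQ.ne_top ((Ideal.eq_top_iff_one Q).mpr ?_)
  rw [← hab]
  refine Q.add_mem (Q.mul_mem_left _ ?_) (Q.mul_mem_left _ ?_)
  · simpa using hN
  · simpa using hpQ

theorem exists_card_le [IsGalois ℚ K] (hG : IsPGroup 2 Gal(K/ℚ)) (g : ℤ → ℤ) (s : Multiset (𝓞 K))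
    (hs : ∀ z : ℤ, ((g z : ℤ) : 𝓞 K) = (s.map fun r => (z : 𝓞 K) - r).prod)
    (hst : ∀ σ : Gal(K/ℚ), ∀ r ∈ s, σ • r ∈ s) :
    ∃ C : ℝ, ∀ᶠ X : ℕ in atTop,
      (#{p ∈ (range (X + 1) : Finset ℕ) | Nat.Prime p ∧ ∃ z : ℤ, (p : ℤ) ∣ g z} : ℝ) *
        Nat.card Gal(K/ℚ) ≤
        8000 * #{σ : Gal(K/ℚ) | ∃ r ∈ s, σ • r = r} * Nat.primeCounting X + C := by
  set Fix : Finset Gal(K/ℚ) := {σ : Gal(K/ℚ) | ∃ r ∈ s, σ • r = r} with hFix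
  -- a bound beyond which primes are unramified and separate the roots
  obtain ⟨B, hB⟩ : ∃ B : ℕ, ∀ p : ℕ, p.Prime → B < p → ∀ Q : Ideal (𝓞 K), Q.IsPrime →
      (p : 𝓞 K) ∈ Q → Q.inertia Gal(K/ℚ) = ⊥ ∧
        ∀ σ : Gal(K/ℚ), ∀ r ∈ s, σ • r - r ∈ Q → σ • r = r := by
    have h1 (σ : Gal(K/ℚ)) : ∃ x : 𝓞 K, σ ≠ 1 → σ • x ≠ x := by
      by_cases h : σ = 1
      · exact ⟨0, fun h' => absurd h h'⟩
      by_contra! hc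
      have : FaithfulSMul Gal(K/ℚ) (𝓞 K) := IsGaloisGroup.faithful ℤ
      exact h (eq_of_smul_eq_smul (M := Gal(K/ℚ)) (α := 𝓞 K) fun x => by rw [(hc x).2, one_smul])
    choose θ hθ using h1
    have h2 (x : 𝓞 K) : ∃ B : ℕ, ∀ p : ℕ, p.Prime → B < p →
        ∀ Q : Ideal (𝓞 K), Q.IsPrime → (p : 𝓞 K) ∈ Q → x ∈ Q → x = 0 := by
      by_cases hx : x = 0
      · exact ⟨0, fun _ _ _ _ _ _ _ => hx⟩
      · obtain ⟨B, hB⟩ := exists_bound_of_mem_prime hx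
        exact ⟨B, fun p hp hBp Q hQ hpQ h => absurd h (hB p hp hBp Q hQ hpQ)⟩
    choose β hβ using h2
    refine ⟨∑ σ : Gal(K/ℚ), (β (σ • θ σ - θ σ) + ∑ r ∈ s.toFinset, β (σ • r - r)),
      fun p hp hp' Q hQ hpQ => ⟨?_, ?_⟩⟩
    · rw [eq_bot_iff]
      intro σ hσ
      rw [Subgroup.mem_bot]
      by_contra hne
      refine hθ σ hne (sub_eq_zero.mp (hβ _ p hp (lt_of_le_of_lt ?_ hp') Q hQ hpQ (hσ (θ σ))))
      exact le_trans (Nat.le_add_right _ _) (single_le_sum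
        (f := fun σ : Gal(K/ℚ) => (β (σ • θ σ - θ σ) + ∑ r ∈ s.toFinset, β (σ • r - r)))
        (fun _ _ => Nat.zero_le _) (mem_univ σ))
    · intro σ r hr hrQ
      refine sub_eq_zero.mp (hβ _ p hp (lt_of_le_of_lt ?_ hp') Q hQ hpQ hrQ)
      refine le_trans (le_trans (single_le_sum (f := fun r => β (σ • r - r))
        (fun _ _ => Nat.zero_le _) (Multiset.mem_toFinset.mpr hr)) (Nat.le_add_left _ _))
        (single_le_sum
        (f := fun σ : Gal(K/ℚ) => (β (σ • θ σ - θ σ) + ∑ r ∈ s.toFinset, β (σ • r - r)))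
        (fun _ _ => Nat.zero_le _) (mem_univ σ))
  have key (p : ℕ) (hp : p.Prime) (hBp : B < p) (z : ℤ) (hz : (p : ℤ) ∣ g z) :
      Nat.card Gal(K/ℚ) ≤
        2 * ∑ τ ∈ Fix, #(normPrimes (fixedField (Subgroup.zpowers τ)) p) := by
    obtain ⟨Q, hQmax, hQ⟩ : ∃ Q : Ideal (𝓞 K), Q.IsMaximal ∧ (p : 𝓞 K) ∈ Q := by
      have hm : (Ideal.span {(p : ℤ)}).IsMaximal :=
        PrincipalIdealRing.isMaximal_of_irreducible (Nat.prime_iff_prime_int.mp hp).irreducible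
      obtain ⟨Q, hQ, hle⟩ := Ideal.exists_maximal_ideal_liesOver_of_isIntegral (S := 𝓞 K)
        (Ideal.span {(p : ℤ)})
      refine ⟨Q, hQ, ?_⟩
      have : (p : ℤ) ∈ Q.under ℤ := hle.over ▸ Ideal.mem_span_singleton_self _
      rw [Ideal.mem_comap] at this
      simpa using this
    have hne : Q ≠ ⊥ := by
      rintro rfl
      rw [Ideal.mem_bot] at hQ
      exact hp.ne_zero (by exact_mod_cast hQ)
    have : Finite (𝓞 K ⧸ Q) := Ring.HasFiniteQuotients.finiteQuotient hne
    obtain ⟨σ, hσ⟩ := IsArithFrobAt.exists_of_isInvariant ℤ Gal(K/ℚ) Q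
    obtain ⟨hI, hsep⟩ := hB p hp hBp Q inferInstance hQ
    have hgz : ((g z : ℤ) : 𝓞 K) ∈ Q := by
      obtain ⟨w, hw⟩ := hz
      rw [hw]; push_cast
      exact Q.mul_mem_right _ hQ
    rw [hs z, Ideal.IsPrime.multiset_prod_mem_iff_exists_mem inferInstance] at hgz
    obtain ⟨y, hy, hyQ⟩ := hgz
    obtain ⟨r, hr, rfl⟩ := Multiset.mem_map.mp hy
    have hσr : σ • r = r := by
      refine hsep σ r hr ?_
      have h1 := Q.neg_mem (hσ ((z : 𝓞 K) - r))
      have hpc := card_int_quotient_under hp hQ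
      have h2 : ((z : 𝓞 K) - r) ^ Nat.card (ℤ ⧸ Q.under ℤ) ∈ Q :=
        Ideal.pow_mem_of_mem _ hyQ _ (by rw [hpc]; exact hp.pos)
      have h3 : σ • ((z : 𝓞 K) - r) = z - σ • r := by
        rw [smul_sub]; congr 1; exact map_intCast (MulSemiringAction.toRingHom _ _ σ) z
      have h4 := Q.sub_mem (Q.add_mem h1 hyQ) h2
      have : σ • r - r = -((MulSemiringAction.toAlgHom ℤ (𝓞 K) σ) ((z : 𝓞 K) - r) -
        ((z : 𝓞 K) - r) ^ Nat.card (ℤ ⧸ Q.under ℤ)) + ((z : 𝓞 K) - r) -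
        ((z : 𝓞 K) - r) ^ Nat.card (ℤ ⧸ Q.under ℤ) := by
        rw [MulSemiringAction.toAlgHom_apply, h3]; ring
      rwa [this]
    refine card_le_two_mul_sum hG Fix ?_ ?_ (σ := σ) ?_ _ fun τ _ =>
      card_conj_mem_le (Subgroup.zpowers τ) hp hQ hσ hI
    · intro σ' h g'
      simp only [hFix, mem_filter, mem_univ, true_and] at h ⊢
      obtain ⟨r', hr', h'⟩ := h
      refine ⟨g'⁻¹ • r', hst _ _ hr', ?_⟩
      rw [mul_smul, mul_smul, smul_inv_smul, h']
    · intro σ' h k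
      simp only [hFix, mem_filter, mem_univ, true_and] at h ⊢
      obtain ⟨r', hr', h'⟩ := h
      refine ⟨r', hr', ?_⟩
      induction k with
      | zero => simp
      | succ k ih => rw [pow_succ, mul_smul, h', ih]
    · simp only [hFix, mem_filter, mem_univ, true_and]
      exact ⟨r, hr, hσr⟩
  refine ⟨(B + 1 : ℕ) * Nat.card Gal(K/ℚ), ?_⟩
  have hev : ∀ᶠ X : ℕ in atTop, ∀ τ : Gal(K/ℚ),
      (#(primesLE (fixedField (Subgroup.zpowers τ)) X) : ℝ) ≤ 4000 * Nat.primeCounting X :=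
    eventually_all.mpr fun τ => card_primesLE_le _
  filter_upwards [hev] with X hX
  set S := {p ∈ (range (X + 1) : Finset ℕ) | Nat.Prime p ∧ ∃ z : ℤ, (p : ℤ) ∣ g z}
  have h1 : #S ≤ (B + 1) + #(S.filter (B < ·)) := by
    rw [← card_filter_add_card_filter_not (s := S) (B < ·), add_comm]
    gcongr
    calc _ ≤ #(range (B + 1)) := card_le_card fun p hp => by
          simp only [mem_filter, not_lt, Finset.mem_range] at hp ⊢; omega
      _ = _ := card_range _
  have h2 : #(S.filter (B < ·)) * Nat.card Gal(K/ℚ) ≤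
      2 * ∑ τ ∈ Fix, #(primesLE (fixedField (Subgroup.zpowers τ)) X) := by
    calc _ = ∑ _p ∈ S.filter (B < ·), Nat.card Gal(K/ℚ) := by simp
      _ ≤ ∑ p ∈ S.filter (B < ·),
          2 * ∑ τ ∈ Fix, #(normPrimes (fixedField (Subgroup.zpowers τ)) p) := by
        refine sum_le_sum fun p hp => ?_
        simp only [S, mem_filter] at hp
        obtain ⟨⟨_, hp, z, hz⟩, hb⟩ := hp
        exact key p hp hb z hz
      _ ≤ ∑ p ∈ range (X + 1),
          2 * ∑ τ ∈ Fix, #(normPrimes (fixedField (Subgroup.zpowers τ)) p) :=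
        sum_le_sum_of_subset ((filter_subset _ _).trans (filter_subset _ _))
      _ = 2 * ∑ τ ∈ Fix, ∑ p ∈ range (X + 1),
          #(normPrimes (fixedField (Subgroup.zpowers τ)) p) := by
        rw [← mul_sum, sum_comm]
      _ ≤ _ := by
        gcongr
        exact sum_card_normPrimes_le _ X
  have h3 : ((∑ τ ∈ Fix, #(primesLE (fixedField (Subgroup.zpowers τ)) X) : ℕ) : ℝ) ≤
      #Fix * (4000 * Nat.primeCounting X) := by
    push_cast
    refine (sum_le_sum fun τ _ => hX τ).trans (by simp)
  have h2' : (#(S.filter (B < ·)) : ℝ) * Nat.card Gal(K/ℚ) ≤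
      2 * ((∑ τ ∈ Fix, #(primesLE (fixedField (Subgroup.zpowers τ)) X) : ℕ) : ℝ) := by
    exact_mod_cast h2
  have h1' : (#S : ℝ) ≤ ((B + 1 : ℕ) : ℝ) + #(S.filter (B < ·)) := by exact_mod_cast h1
  have hc : (0 : ℝ) ≤ Nat.card Gal(K/ℚ) := by positivity
  nlinarith [mul_le_mul_of_nonneg_right h1' hc]

end FrobeniusDensity

section TreeAction
open Finset
open scoped Classical

theorem sum_card_fixed_eq {G X : Type*} [Group G] [Fintype G] [Fintype X] [MulAction G X]
    [Nonempty X] [MulAction.IsPretransitive G X] :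
    ∑ σ : G, #{x : X | σ • x = x} = Fintype.card G := by
  have h := MulAction.sum_card_fixedBy_eq_card_orbits_mul_card_group G X
  have h1 : Fintype.card (Quotient (MulAction.orbitRel G X)) = 1 := by
    rw [Fintype.card_eq_one_iff_nonempty_unique]
    have := (MulAction.pretransitive_iff_subsingleton_quotient G X).mp inferInstance
    exact ⟨⟨⟨Quotient.mk _ (Classical.arbitrary X)⟩, fun a => Subsingleton.elim _ _⟩⟩
  rw [h1, one_mul] at h
  rw [← h]
  refine sum_congr rfl fun σ _ => ?_
  rw [Fintype.card_subtype]
  rfl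

theorem mul_card_many_fixed_le {G X : Type*} [Group G] [Fintype G] [Fintype X] [MulAction G X]
    [Nonempty X] [MulAction.IsPretransitive G X] (T : ℕ) :
    #{σ : G | T < #{x : X | σ • x = x}} * (T + 1) ≤ Fintype.card G := by
  rw [← sum_card_fixed_eq (G := G) (X := X), ← smul_eq_mul]
  refine (card_nsmul_le_sum _ _ _ fun σ hσ => ?_).trans
    (sum_le_sum_of_subset (filter_subset _ _))
  exact (mem_filter.mp hσ).2

variable {G X X' : Type*} [Group G] [Fintype G] [Fintype X] [MulAction G X] [MulAction G X']
  {π : X' → X} {ι : X' → X'} {s : X → X'}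

omit [Fintype G] [Fintype X] in
theorem smul_section_eq (hπ : ∀ (g : G) x, π (g • x) = g • π x)
    (hfib : ∀ x y, π x = π y ↔ y = x ∨ y = ι x) (hs : ∀ x, π (s x) = x) (g : G) (x : X) :
    g • s x = s (g • x) ∨ g • s x = ι (s (g • x)) :=
  (hfib _ _).mp (by rw [hπ, hs, hs])

omit [Fintype G] in
theorem exists_flip_eq [MulAction.IsPretransitive G X] (hG : IsPGroup 2 G)
    (hπ : ∀ (g : G) x, π (g • x) = g • π x)
    (hι : ∀ (g : G) x, ι (g • x) = g • ι x)
    (hfib : ∀ x y, π x = π y ↔ y = x ∨ y = ι x) (hne : ∀ x, ι x ≠ x) (hs : ∀ x, π (s x) = x)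
    (hodd : ∃ ν : G, (∀ x : X, ν • x = x) ∧ Odd #{x : X | ν • s x ≠ s x}) (S : X → Prop) :
    ∃ ν : G, (∀ x : X, ν • x = x) ∧ ∀ x, (ν • s x ≠ s x ↔ S x) := by
  have hιι (x : X') : ι (ι x) = x := by
    rcases (hfib (ι x) x).mp (((hfib x (ι x)).mpr (Or.inr rfl)).symm) with h | h
    · exact absurd h.symm (hne x)
    · exact h.symm
  let v (ν : G) : X → ZMod 2 := fun x => if ν • s x ≠ s x then 1 else 0
  have hmulv (ν μ : G) (hν : ∀ x : X, ν • x = x) (hμ : ∀ x : X, μ • x = x) :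
      v (ν * μ) = v ν + v μ := by
    funext x
    have h1 := smul_section_eq hπ hfib hs ν x
    have h2 := smul_section_eq hπ hfib hs μ x
    rw [hν] at h1
    rw [hμ] at h2
    simp only [v, Pi.add_apply, mul_smul]
    have two : (0 : ZMod 2) = 1 + 1 := by decide
    rcases h1 with h1 | h1 <;> rcases h2 with h2 | h2 <;>
      simp [h1, h2, hne, ← hι, hιι, two.symm]
  let W : Submodule (ZMod 2) (X → ZMod 2) :=
    { carrier := {w | ∃ ν : G, (∀ x : X, ν • x = x) ∧ v ν = w}
      zero_mem' := ⟨1, fun x => one_smul _ _, by funext x; simp [v]⟩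
      add_mem' := by
        rintro _ _ ⟨ν, hν, rfl⟩ ⟨μ, hμ, rfl⟩
        exact ⟨ν * μ, fun x => by rw [mul_smul, hμ, hν], hmulv ν μ hν hμ⟩
      smul_mem' := by
        rintro c _ ⟨ν, hν, rfl⟩
        have : c = 0 ∨ c = 1 := by revert c; decide
        rcases this with rfl | rfl
        · exact ⟨1, fun x => one_smul _ _, by funext x; simp [v]⟩
        · exact ⟨ν, hν, by simp⟩ }
  suffices hW : W = ⊤ by
    have : (fun x => if S x then (1 : ZMod 2) else 0) ∈ W := by rw [hW]; trivial
    obtain ⟨ν, hν, h⟩ := this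
    refine ⟨ν, hν, fun x => ?_⟩
    have := congrFun h x
    simp only [v] at this
    by_cases h1 : ν • s x = s x <;> by_cases h2 : S x <;> simp_all
  by_contra hW
  -- the annihilator of `W` under the standard pairing
  let A : Type _ := {u : X → ZMod 2 // ∀ ν : G, (∀ x : X, ν • x = x) → ∑ x, u x * v ν x = 0}
  have hA : ∃ u : A, u.1 ≠ 0 := by
    obtain ⟨φ, hφ0, hφ⟩ := Submodule.exists_le_ker_of_lt_top W (lt_top_iff_ne_top.mpr hW)
    have hrep (w : X → ZMod 2) : φ w = ∑ x, φ (Pi.single x 1) * w x := by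
      conv_lhs => rw [← Finset.univ_sum_single w]
      rw [map_sum]
      refine sum_congr rfl fun x _ => ?_
      have : Pi.single x (w x) = w x • (Pi.single x (1 : ZMod 2) : X → ZMod 2) := by
        rw [← Pi.single_smul]; simp
      rw [this, map_smul, smul_eq_mul, mul_comm]
    refine ⟨⟨fun x => φ (Pi.single x 1), fun ν hν => ?_⟩, fun h0 => hφ0 ?_⟩
    · rw [← hrep]
      exact hφ ⟨ν, hν, rfl⟩
    · refine LinearMap.ext fun w => ?_
      rw [hrep w]
      refine sum_eq_zero fun x _ => ?_
      have : φ (Pi.single x 1) = 0 := congrFun h0 x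
      rw [this, zero_mul]
  have hvconj (g ν : G) (hν : ∀ x : X, ν • x = x) (x : X) : v (g⁻¹ * ν * g) x = v ν (g • x) := by
    have h1 := smul_section_eq hπ hfib hs g x
    have h2 : (g⁻¹ * ν * g) • s x = s x ↔ ν • (g • s x) = g • s x := by
      rw [mul_smul, mul_smul, inv_smul_eq_iff]
    have h3 : ν • (g • s x) = g • s x ↔ ν • s (g • x) = s (g • x) := by
      rcases h1 with h1 | h1
      · rw [h1]
      · rw [h1, ← hι]
        exact ⟨fun h => by rw [← hιι (ν • _), h, hιι], fun h => by rw [h]⟩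
    simp only [v, ne_eq, h2, h3]
  have hconjN (g ν : G) (hν : ∀ x : X, ν • x = x) (x : X) : (g⁻¹ * ν * g) • x = x := by
    rw [mul_smul, mul_smul, hν, inv_smul_smul]
  let act : MulAction G A :=
    { smul := fun g u => ⟨fun x => u.1 (g⁻¹ • x), fun ν hν => by
        refine Eq.trans ?_ (u.2 (g⁻¹ * ν * g) (hconjN g ν hν))
        refine Fintype.sum_equiv (MulAction.toPerm g⁻¹) _ _ fun x => ?_
        rw [hvconj g ν hν]
        simp⟩
      one_smul := fun u => by
        apply Subtype.ext; funext x
        change u.1 ((1 : G)⁻¹ • x) = u.1 x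
        simp
      mul_smul := fun g h u => by
        apply Subtype.ext; funext x
        change u.1 ((g * h)⁻¹ • x) = u.1 (h⁻¹ • g⁻¹ • x)
        rw [mul_inv_rev, mul_smul] }
  have hsm (g : G) (u : A) (x : X) : (g • u).1 x = u.1 (g⁻¹ • x) := rfl
  let z : A := ⟨0, fun ν _ => by simp⟩
  have hcard : 2 ∣ Nat.card A := by
    let B : AddSubgroup (X → ZMod 2) :=
      { carrier := {u | ∀ ν : G, (∀ x : X, ν • x = x) → ∑ x, u x * v ν x = 0}
        zero_mem' := z.2
        add_mem' := fun {a b} ha hb ν hν => by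
          simp only [Pi.add_apply, add_mul, sum_add_distrib, ha ν hν, hb ν hν, add_zero]
        neg_mem' := fun {a} ha ν hν => by
          simp only [Pi.neg_apply, neg_mul, sum_neg_distrib, ha ν hν, neg_zero] }
    obtain ⟨u, hu⟩ := hA
    have : addOrderOf (⟨u.1, u.2⟩ : B) = 2 := by
      refine addOrderOf_eq_prime ?_ fun h => hu (congrArg Subtype.val h)
      apply Subtype.ext; funext x
      change (2 • u.1) x = 0
      rw [Pi.smul_apply, two_nsmul]
      exact CharTwo.add_self_eq_zero _
    exact this ▸ addOrderOf_dvd_natCard (⟨u.1, u.2⟩ : B)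
  have : Finite A := Subtype.finite
  obtain ⟨u, hu, hzu⟩ := hG.exists_fixed_point_of_prime_dvd_card_of_fixed_point A hcard
    (a := z) (fun g => by apply Subtype.ext; funext x; rfl)
  have hconst (x y : X) : u.1 x = u.1 y := by
    obtain ⟨g, rfl⟩ := MulAction.exists_smul_eq G x y
    have := congrArg (fun u => u.1 (g • x)) (hu g)
    simp only [hsm, inv_smul_smul] at this
    exact this
  have hone (x : X) : u.1 x = 1 := by
    by_contra h
    have h0 : u.1 x = 0 := by revert h; generalize u.1 x = c; revert c; decide
    exact hzu (Subtype.ext (funext fun y => by rw [hconst y x, h0]; rfl))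
  obtain ⟨ν, hν, hodd⟩ := hodd
  have := u.2 ν hν
  simp only [hone, one_mul, v, sum_boole] at this
  rw [ZMod.natCast_eq_zero_iff_even] at this
  exact (Nat.not_even_iff_odd.mpr hodd) this

omit [Fintype G] [Fintype X] in
theorem exists_equivariant_section [Nonempty X] [MulAction.IsPretransitive G X]
    (hπ : ∀ (g : G) x, π (g • x) = g • π x)
    (hι : ∀ (g : G) x, ι (g • x) = g • ι x)
    (hfib : ∀ x y, π x = π y ↔ y = x ∨ y = ι x) (hsurj : Function.Surjective π)
    (hnot : ¬MulAction.IsPretransitive G X') :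
    ∃ s : X → X', (∀ x, π (s x) = x) ∧ ∀ (g : G) x, s (g • x) = g • s x := by
  have hιι (x : X') : ι (ι x) = x := by
    rcases (hfib (ι x) x).mp (((hfib x (ι x)).mpr (Or.inr rfl)).symm) with h | h
    · rw [← h, ← h]
    · exact h.symm
  obtain ⟨x₀⟩ := ‹Nonempty X›
  obtain ⟨β, hβ⟩ := hsurj x₀
  have hno (g : G) : g • β ≠ ι β ∨ g • β = β := by
    by_contra! hc
    refine hnot ((MulAction.isPretransitive_iff_base β).mpr fun x' => ?_)
    obtain ⟨h, hh⟩ := MulAction.exists_smul_eq G x₀ (π x')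
    rcases (hfib x' (h • β)).mp (by rw [hπ, hβ, hh]) with h1 | h1
    · exact ⟨h, h1⟩
    · exact ⟨h * g, by rw [mul_smul, hc.1, ← hι, h1, hιι]⟩
  choose t ht using fun x => MulAction.exists_smul_eq G x₀ x
  have huniq (g h : G) (hgh : g • x₀ = h • x₀) : g • β = h • β := by
    have h1 : π β = π ((h⁻¹ * g) • β) := by
      rw [hπ, hβ, mul_smul, hgh, inv_smul_smul]
    have h2 : (h⁻¹ * g) • β = β := by
      rcases (hfib _ _).mp h1 with h3 | h3
      · exact h3
      · exact (hno _).resolve_left (not_not.mpr h3)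
    rw [mul_smul, inv_smul_eq_iff] at h2
    exact h2
  refine ⟨fun x => t x • β, fun x => by rw [hπ, hβ, ht], fun g x => ?_⟩
  rw [← mul_smul]
  exact huniq _ _ (by rw [ht, mul_smul, ht])

theorem card_fixing_le_of_flip [MulAction.IsPretransitive G X] (hG : IsPGroup 2 G)
    (hπ : ∀ (g : G) x, π (g • x) = g • π x)
    (hι : ∀ (g : G) x, ι (g • x) = g • ι x)
    (hfib : ∀ x y, π x = π y ↔ y = x ∨ y = ι x) (hne : ∀ x, ι x ≠ x) (hs : ∀ x, π (s x) = x)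
    (hodd : ∃ ν : G, (∀ x : X, ν • x = x) ∧ Odd #{x : X | ν • s x ≠ s x}) (F S : Finset X) :
    #{ν : G | ∀ x : X, ν • x = x} ≤
      2 ^ #F * #{ν : G | (∀ x : X, ν • x = x) ∧ ∀ x ∈ F, (ν • s x ≠ s x ↔ x ∈ S)} := by
  have hιι (x : X') : ι (ι x) = x := by
    rcases (hfib (ι x) x).mp (((hfib x (ι x)).mpr (Or.inr rfl)).symm) with h | h
    · exact absurd h.symm (hne x)
    · exact h.symm
  rw [← card_powerset, mul_comm]
  refine card_le_mul_card_image_of_maps_to (f := fun ν => F.filter fun x => ν • s x ≠ s x)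
    (fun ν _ => mem_powerset.mpr (filter_subset _ _)) _ fun T hT => ?_
  obtain ⟨μ, hμ, hμS⟩ := exists_flip_eq hG hπ hι hfib hne hs hodd fun x => ¬(x ∈ S ↔ x ∈ T)
  refine card_le_card_of_injOn (fun ν => ν * μ) ?_ fun a _ b _ h => mul_right_cancel h
  intro ν hν
  simp only [coe_filter, mem_filter, mem_univ, true_and, Set.mem_ofPred_eq] at hν ⊢
  refine ⟨fun x => by rw [mul_smul, hμ, hν.1], fun x hx => ?_⟩
  have h1 := smul_section_eq hπ hfib hs ν x
  have h2 := smul_section_eq hπ hfib hs μ x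
  rw [hν.1] at h1
  rw [hμ] at h2
  have h3 : ν • s x ≠ s x ↔ x ∈ T := by
    rw [← hν.2]; simp [hx]
  have h4 := hμS x
  rw [mul_smul]
  rcases h1 with h1 | h1 <;> rcases h2 with h2 | h2 <;>
    simp only [h1, h2, ne_eq, not_true_eq_false, hne, not_false_eq_true, ← hι, hιι, true_iff,
      false_iff] at h3 h4 ⊢ <;> tauto

theorem exists_fix_card_step [Fintype X'] [Nonempty X] [MulAction.IsPretransitive G X]
    (hG : IsPGroup 2 G)
    (hπ : ∀ (g : G) x, π (g • x) = g • π x)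
    (hι : ∀ (g : G) x, ι (g • x) = g • ι x)
    (hfib : ∀ x y, π x = π y ↔ y = x ∨ y = ι x) (hne : ∀ x, ι x ≠ x) (hs : ∀ x, π (s x) = x)
    (hodd : ∃ ν : G, (∀ x : X, ν • x = x) ∧ Odd #{x : X | ν • s x ≠ s x}) (T : ℕ) :
    (#{σ : G | ∃ x : X, σ • x = x} : ℝ) ≤
      2 ^ T * (#{σ : G | ∃ x : X, σ • x = x} - #{σ : G | ∃ x : X', σ • x = x}) +
        Fintype.card G / (T + 1) := by
  have hιι (x : X') : ι (ι x) = x := by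
    rcases (hfib (ι x) x).mp (((hfib x (ι x)).mpr (Or.inr rfl)).symm) with h | h
    · exact absurd h.symm (hne x)
    · exact h.symm
  set N : Finset G := {ν : G | ∀ x : X, ν • x = x} with hN
  set B : Finset G := {σ : G | (∃ x : X, σ • x = x) ∧ #{x : X | σ • x = x} ≤ T} with hB
  set D : Finset G := {σ : G | (∃ x : X, σ • x = x) ∧ ¬∃ x : X', σ • x = x} with hD
  have hN0 : 0 < #N := card_pos.mpr ⟨1, by simp [hN]⟩
  have h1 (σ : G) (hσ : σ ∈ B) : #N ≤ 2 ^ T * #{ν ∈ N | σ * ν ∈ D} := by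
    simp only [hB, mem_filter, mem_univ, true_and] at hσ
    refine (card_fixing_le_of_flip hG hπ hι hfib hne hs hodd {x : X | σ • x = x}
      {x : X | σ • x = x ∧ σ • s x = s x}).trans
      (Nat.mul_le_mul (Nat.pow_le_pow_right two_pos hσ.2) (card_le_card fun ν hν => ?_))
    simp only [mem_filter, mem_univ, true_and] at hν
    simp only [hN, hD, mem_filter, mem_univ, true_and, mul_smul, hν.1, implies_true]
    refine ⟨hσ.1, ?_⟩
    rintro ⟨x', hx'⟩
    have hx : σ • π x' = π x' := by
      conv_rhs => rw [← hx', hπ, hπ, hν.1]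
    have h5 : σ • ν • s (π x') = s (π x') := by
      rcases (hfib x' (s (π x'))).mp (hs _).symm with h | h
      · rw [h, hx']
      · rw [h, ← hι, ← hι, hx']
    have h6 := hν.2 (π x') hx
    have h7 := smul_section_eq hπ hfib hs ν (π x')
    rw [hν.1] at h7
    rcases h7 with h7 | h7
    · rw [h7] at h5 h6
      simp [hx, h5] at h6
    · rw [h7] at h5 h6
      rw [← hι] at h5
      have : σ • s (π x') ≠ s (π x') := fun h => hne _ (by rw [h] at h5; exact h5)
      simp [hne, this] at h6
  have h2 : #B * #N ≤ 2 ^ T * (#D * #N) := by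
    calc #B * #N = ∑ _σ ∈ B, #N := by simp
      _ ≤ ∑ σ ∈ B, 2 ^ T * #{ν ∈ N | σ * ν ∈ D} := sum_le_sum h1
      _ ≤ ∑ σ : G, 2 ^ T * #{ν ∈ N | σ * ν ∈ D} := sum_le_sum_of_subset (subset_univ _)
      _ = 2 ^ T * ∑ ν ∈ N, #{σ : G | σ * ν ∈ D} := by
          rw [← mul_sum]; simp only [card_filter]; rw [sum_comm]
      _ = 2 ^ T * ∑ _ν ∈ N, #D := by
          congr 1
          refine sum_congr rfl fun ν _ => ?_
          refine card_bij (fun σ _ => σ * ν) (fun σ h => by simpa using h)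
            (fun a _ b _ h => mul_right_cancel h) fun b hb => ⟨b * ν⁻¹, by simpa using hb, by simp⟩
      _ = _ := by simp [mul_comm]
  have h3 : #B ≤ 2 ^ T * #D := Nat.le_of_mul_le_mul_right (by rw [mul_assoc]; exact h2) hN0
  have h4 : #{σ : G | ∃ x : X, σ • x = x} = #D + #{σ : G | ∃ x : X', σ • x = x} := by
    rw [← card_filter_add_card_filter_not (s := {σ : G | ∃ x : X, σ • x = x})
      fun σ => ¬∃ x : X', σ • x = x, filter_filter, filter_filter]
    congr 2
    ext σ
    simp only [not_not, mem_filter, mem_univ, true_and, and_iff_right_iff_imp]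
    rintro ⟨x, hx⟩
    exact ⟨π x, by rw [← hπ, hx]⟩
  have h5 : #{σ : G | ∃ x : X, σ • x = x} ≤ #B + #{σ : G | T < #{x : X | σ • x = x}} := by
    rw [← card_filter_add_card_filter_not (s := {σ : G | ∃ x : X, σ • x = x})
      fun σ => #{x : X | σ • x = x} ≤ T, filter_filter, filter_filter]
    gcongr with σ
    intro h
    exact not_le.mp h.2
  have h6 := mul_card_many_fixed_le (G := G) (X := X) T
  have h6' : (#{σ : G | T < #{x : X | σ • x = x}} : ℝ) ≤ Fintype.card G / (T + 1) := by
    rw [le_div_iff₀ (by positivity)]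
    exact_mod_cast h6
  have h3' : (#B : ℝ) ≤ 2 ^ T * #D := by exact_mod_cast h3
  have h4' : (#{σ : G | ∃ x : X, σ • x = x} : ℝ) = #D + #{σ : G | ∃ x : X', σ • x = x} := by
    exact_mod_cast h4
  have h5' : (#{σ : G | ∃ x : X, σ • x = x} : ℝ) ≤ #B + #{σ : G | T < #{x : X | σ • x = x}} := by
    exact_mod_cast h5
  have : (#{σ : G | ∃ x : X, σ • x = x} : ℝ) - #{σ : G | ∃ x : X', σ • x = x} = #D := by linarith
  rw [this]
  linarith

end TreeAction

section InertiaValuation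
open scoped Pointwise
open NumberField IntermediateField

theorem emultiplicity_span_algebraMap {A B : Type*} [CommRing A] [IsDedekindDomain A] [CommRing B]
    [IsDedekindDomain B] [Algebra A B] [FaithfulSMul A B] [Algebra.IsIntegral A B]
    (P : Ideal B) [P.IsPrime] (hP : P ≠ ⊥) {a : A} (ha : a ≠ 0) :
    emultiplicity P (Ideal.span {algebraMap A B a}) =
      P.ramificationIdx A * emultiplicity (P.under A) (Ideal.span {a}) := by
  have hp : P.under A ≠ ⊥ := Ideal.under_ne_bot (A := A) hP
  have h := Ideal.IsDedekindDomain.emultiplicity_map_eq_ramificationIdx'_mul (v := P.under A)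
    (w := P) (I := Ideal.span {a}) (by simpa using ha)
    (Ideal.prime_of_isPrime hp inferInstance).irreducible
    (Ideal.prime_of_isPrime hP inferInstance).irreducible hP
  rw [Ideal.map_span, Set.image_singleton, Ideal.ramificationIdx'_eq_ramificationIdx] at h
  · exact h
  · exact hp

variable {K : Type*} [Field K] [NumberField K] [IsGalois ℚ K]

theorem even_padicValInt_of_inertia {q : ℕ} (hq : q.Prime) (Q : Ideal (𝓞 K)) [Q.IsPrime]
    (hqQ : (q : 𝓞 K) ∈ Q) {x : 𝓞 K} {d : ℤ} (hd : d ≠ 0) (hx : x ^ 2 = (d : 𝓞 K))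
    (hfix : ∀ τ ∈ Q.inertia Gal(K/ℚ), τ • x = x) : Even (padicValInt q d) := by
  set I := Q.inertia Gal(K/ℚ) with hI
  have hQ : Q ≠ ⊥ := by
    rintro rfl
    exact hq.ne_zero (by exact_mod_cast (Ideal.mem_bot.mp hqQ))
  have hunder : Q.under ℤ = Ideal.span {(q : ℤ)} := by
    have hmax : (Ideal.span {(q : ℤ)}).IsMaximal :=
      PrincipalIdealRing.isMaximal_of_irreducible (Nat.prime_iff_prime_int.mp hq).irreducible
    refine (hmax.eq_of_le (Ideal.IsPrime.ne_top inferInstance) ?_).symm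
    rw [Ideal.span_singleton_le_iff_mem, Ideal.mem_comap]
    simpa using hqQ
  have : IsGaloisGroup I (fixedField I) K := IsGaloisGroup.subgroup Gal(K/ℚ) ℚ K I
  have : IsGaloisGroup I (𝓞 (fixedField I)) (𝓞 K) :=
    IsGaloisGroup.of_isFractionRing I _ _ (fixedField I) K
  have : IsGaloisGroup Gal(K/ℚ) ℤ (𝓞 K) :=
    IsGaloisGroup.of_isFractionRing Gal(K/ℚ) ℤ (𝓞 K) ℚ K
  have hp : Q.under (𝓞 (fixedField I)) ≠ ⊥ := Ideal.under_ne_bot _ hQ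
  have hpZ : Q.under ℤ ≠ ⊥ := Ideal.under_ne_bot _ hQ
  have : (Q.under (𝓞 (fixedField I))).IsMaximal := Ideal.IsPrime.isMaximal inferInstance hp
  have : (Q.under ℤ).IsMaximal := Ideal.IsPrime.isMaximal inferInstance hpZ
  have : Finite (𝓞 (fixedField I) ⧸ Q.under (𝓞 (fixedField I))) :=
    Ring.HasFiniteQuotients.finiteQuotient hp
  have : Finite (ℤ ⧸ Q.under ℤ) := Ring.HasFiniteQuotients.finiteQuotient hpZ
  have h1 := Ideal.card_inertia_eq_ramificationIdxIn (G := Gal(K/ℚ)) (Q.under ℤ) Q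
  have h2 := Ideal.card_inertia_eq_ramificationIdxIn (G := I) (Q.under (𝓞 (fixedField I))) Q
  rw [Ideal.ramificationIdxIn_eq_ramificationIdx (Q.under ℤ) Q Gal(K/ℚ)] at h1
  rw [Ideal.ramificationIdxIn_eq_ramificationIdx (Q.under (𝓞 (fixedField I))) Q I] at h2
  have h3 : Q.inertia I = ⊤ := by
    refine eq_top_iff.mpr fun τ _ => ?_
    exact fun y => τ.2 y
  rw [h3, Subgroup.card_top] at h2
  have he : Q.ramificationIdx (𝓞 (fixedField I)) = Q.ramificationIdx ℤ := by rw [← h1, ← h2]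
  obtain ⟨y, hy⟩ := (IsGaloisGroup.isInvariant (G := I) (A := 𝓞 (fixedField I))
    (B := 𝓞 K)).isInvariant x (fun τ => hfix τ τ.2)
  have hx0 : x ≠ 0 := by
    rintro rfl
    rw [zero_pow two_ne_zero] at hx
    exact hd (by exact_mod_cast hx.symm)
  have hy0 : y ≠ 0 := by
    rintro rfl
    exact hx0 (by rw [← hy, map_zero])
  have hfin : FiniteMultiplicity (Q.under (𝓞 (fixedField I))) (Ideal.span {y}) :=
    FiniteMultiplicity.of_prime_left (Ideal.prime_of_isPrime hp inferInstance) (by simpa using hy0)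
  have e1 := emultiplicity_span_algebraMap Q hQ hy0
  have e2 := emultiplicity_span_algebraMap Q hQ hd
  rw [hy, he, hfin.emultiplicity_eq_multiplicity] at e1
  have e3 : algebraMap ℤ (𝓞 K) d = x ^ 2 := by rw [hx]; simp
  rw [e3, ← Ideal.span_singleton_pow,
    emultiplicity_pow (Ideal.prime_of_isPrime hQ inferInstance), e1, hunder,
    Ideal.emultiplicity_eq_emultiplicity_span, ← Int.emultiplicity_natAbs,
    ← padicValNat_eq_emultiplicity (hp := ⟨hq⟩) (by simpa using hd)] at e2
  have he0 : 0 < Q.ramificationIdx ℤ := h1 ▸ Nat.card_pos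
  have e4 : 2 * (Q.ramificationIdx ℤ * multiplicity (Q.under (𝓞 (fixedField I))) (Ideal.span {y}))
      = Q.ramificationIdx ℤ * padicValNat q d.natAbs := by exact_mod_cast e2
  refine (even_iff_exists_two_mul).mpr
    ⟨multiplicity (Q.under (𝓞 (fixedField I))) (Ideal.span {y}), ?_⟩
  rw [padicValInt]
  apply Nat.eq_of_mul_eq_mul_left he0
  rw [← e4]
  ring

end InertiaValuation

section QuadraticPreimages
open Finset NumberField
open scoped Classical

/-- The quadratic polynomial map `x ↦ x² + b x + c`. -/
def quad {R : Type*} [CommRing R] (b c : ℤ) (x : R) : R := x ^ 2 + b * x + c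

theorem map_iterate_quad {R S H : Type*} [CommRing R] [CommRing S] [FunLike H R S]
    [RingHomClass H R S] (f : H) (b c : ℤ) (n : ℕ) (x : R) :
    f ((quad b c)^[n] x) = (quad b c)^[n] (f x) := by
  have h : Function.Semiconj f (quad b c) (quad b c) := fun x => by simp [quad]
  exact (h.iterate_right n) x

theorem quad_sub_quad {R : Type*} [CommRing R] (b c : ℤ) (s t : R) :
    quad b c t - quad b c s = (t - s) * (t - (-b - s)) := by
  unfold quad; ring

theorem quad_reflect {R : Type*} [CommRing R] (b c : ℤ) (s : R) :
    quad b c (-b - s) = quad b c s := by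
  unfold quad; ring

theorem quad_eq_quad_iff {R : Type*} [CommRing R] [IsDomain R] (b c : ℤ) (s t : R) :
    quad b c s = quad b c t ↔ t = s ∨ t = -b - s := by
  rw [eq_comm, ← sub_eq_zero, quad_sub_quad, mul_eq_zero, sub_eq_zero, sub_eq_zero]

/-- The difference between the `n`-th iterate at the critical point of `quad b c` and `y`. -/
def critDiff (b c y : ℤ) (n : ℕ) : ℚ := (quad b c)^[n] (-b / 2 : ℚ) - y

variable {K : Type*} [Field K] {b c y : ℤ} {n : ℕ}

variable (K b c y n) in
/-- The points of `K` mapped to `y` by the `n`-th iterate of `quad b c`. -/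
def Preim : Type _ := {x : K // (quad b c)^[n] x = y}

instance finite_preim : Finite (Preim K b c y n) := by
  change Set.Finite {x : K | (quad b c)^[n] x = y}
  induction n with
  | zero => simp
  | succ n ih =>
    refine Set.Finite.preimage' (f := quad b c) ih fun z _ => ?_
    rcases Set.eq_empty_or_nonempty ((quad b c : K → K) ⁻¹' {z}) with h | ⟨s, hs⟩
    · rw [h]; exact Set.finite_empty
    · refine (Set.toFinite {s, -b - s}).subset fun t ht => ?_
      exact (quad_eq_quad_iff b c s t).mp (hs.trans ht.symm)

noncomputable instance fintype_preim : Fintype (Preim K b c y n) := Fintype.ofFinite _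

instance mulAction_preim [Algebra ℚ K] : MulAction Gal(K/ℚ) (Preim K b c y n) where
  smul g x := ⟨g x.1, by rw [← map_iterate_quad, x.2, map_intCast]⟩
  one_smul _ := rfl
  mul_smul _ _ _ := rfl

theorem coe_smul_preim [Algebra ℚ K] (g : Gal(K/ℚ)) (x : Preim K b c y n) :
    (g • x).1 = g x.1 := rfl

theorem preim_ext {x z : Preim K b c y n} (h : x.1 = z.1) : x = z := Subtype.ext h

instance uniquePreimZero : Unique (Preim K b c y 0) where
  default := ⟨(y : K), id rfl⟩
  uniq x := preim_ext x.2

/-- The map `quad b c` from one level of the preimage tree to the previous one. -/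
def up (x : Preim K b c y (n + 1)) : Preim K b c y n := ⟨quad b c x.1, x.2⟩

/-- The reflection of a level of the preimage tree in the critical point. -/
def reflect (x : Preim K b c y (n + 1)) : Preim K b c y (n + 1) :=
  ⟨-b - x.1, by
    rw [Function.iterate_succ_apply, quad_reflect, ← Function.iterate_succ_apply]; exact x.2⟩

theorem up_eq_up_iff (s t : Preim K b c y (n + 1)) : up s = up t ↔ t = s ∨ t = reflect s := by
  have h := quad_eq_quad_iff b c s.1 t.1
  exact ⟨fun e => (h.mp (congrArg Subtype.val e)).imp preim_ext preim_ext, fun e =>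
    preim_ext (h.mpr (e.imp (congrArg Subtype.val) (congrArg Subtype.val)))⟩

theorem up_smul [Algebra ℚ K] (g : Gal(K/ℚ)) (x : Preim K b c y (n + 1)) :
    up (g • x) = g • up x :=
  preim_ext (show quad b c (g x.1) = g (quad b c x.1) by simp [quad])

theorem reflect_smul [Algebra ℚ K] (g : Gal(K/ℚ)) (x : Preim K b c y (n + 1)) :
    reflect (g • x) = g • reflect x :=
  preim_ext (show -b - g x.1 = g (-b - x.1) by simp)

theorem reflect_ne [CharZero K] (h : critDiff b c y (n + 1) ≠ 0) (x : Preim K b c y (n + 1)) :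
    reflect x ≠ x := by
  intro hx
  have h1 : -b - x.1 = x.1 := congrArg Subtype.val hx
  have h2 : x.1 = algebraMap ℚ K (-b / 2) := by
    rw [map_div₀, map_neg, map_intCast, map_ofNat]
    field_simp
    linear_combination -h1
  have h3 := x.2
  rw [h2, ← map_iterate_quad] at h3
  apply h
  apply (algebraMap ℚ K).injective
  rw [critDiff, map_sub, h3, map_intCast, sub_self, map_zero]

theorem prod_sub_up [CharZero K] (hup : Function.Surjective (up : Preim K b c y (n + 1) → _))
    (h : critDiff b c y (n + 1) ≠ 0) (t : K) :
    ∏ x : Preim K b c y (n + 1), (t - x.1) = ∏ x : Preim K b c y n, (quad b c t - x.1) := by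
  rw [← prod_fiberwise (univ : Finset (Preim K b c y (n + 1))) up]
  refine prod_congr rfl fun α _ => ?_
  obtain ⟨s, rfl⟩ := hup α
  have : (univ.filter fun x => up x = up s) = {s, reflect s} := by
    ext t
    rw [mem_insert, mem_singleton, ← up_eq_up_iff, mem_filter_univ, eq_comm]
  rw [this, prod_pair (reflect_ne h s).symm]
  exact (quad_sub_quad b c s.1 t).symm

theorem prod_sub_preim [CharZero K]
    (hup : ∀ m < n, Function.Surjective (up : Preim K b c y (m + 1) → _))
    (h : ∀ m < n, critDiff b c y (m + 1) ≠ 0) (t : K) :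
    ∏ x : Preim K b c y n, (t - x.1) = (quad b c)^[n] t - y := by
  induction n generalizing t with
  | zero => rw [Fintype.prod_unique]; rfl
  | succ n ih =>
    rw [prod_sub_up (hup n (by omega)) (h n (by omega)),
      ih (fun m hm => hup m (by omega)) (fun m hm => h m (by omega)), Function.iterate_succ_apply]

theorem card_preim [CharZero K]
    (hup : ∀ m < n, Function.Surjective (up : Preim K b c y (m + 1) → _))
    (h : ∀ m < n, critDiff b c y (m + 1) ≠ 0) : Fintype.card (Preim K b c y n) = 2 ^ n := by
  induction n with
  | zero => rw [pow_zero, Fintype.card_unique]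
  | succ n ih =>
    rw [← card_univ, card_eq_sum_card_fiberwise (f := up) (t := univ) (fun _ _ => by simp),
      sum_const_nat (m := 2), card_univ, ih (fun m hm => hup m (by omega))
      (fun m hm => h m (by omega)), pow_succ]
    intro α _
    obtain ⟨s, rfl⟩ := hup n (by omega) α
    have : (univ.filter fun x => up x = up s) = {s, reflect s} := by
      ext t
      rw [mem_insert, mem_singleton, ← up_eq_up_iff, mem_filter_univ, eq_comm]
    rw [this, card_pair (reflect_ne (h n (by omega)) s).symm]

theorem prod_section_sq [CharZero K]
    (hup : ∀ m < n, Function.Surjective (up : Preim K b c y (m + 1) → _))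
    (h : ∀ m < n, critDiff b c y (m + 1) ≠ 0) {s : Preim K b c y n → Preim K b c y (n + 1)}
    (hs : ∀ x, up (s x) = x) :
    (∏ x, ((s x).1 - algebraMap ℚ K (-b / 2))) ^ 2 =
      algebraMap ℚ K ((-1) ^ 2 ^ n * critDiff b c y (n + 1)) := by
  rw [← prod_pow, ← card_preim hup h, map_mul, map_pow, map_neg, map_one, critDiff, map_sub,
    map_iterate_quad, map_intCast, Function.iterate_succ_apply, ← prod_sub_preim hup h,
    ← card_univ, ← prod_const, ← prod_mul_distrib]
  refine prod_congr rfl fun x _ => ?_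
  have h1 : quad b c (s x).1 = x.1 := congrArg Subtype.val (hs x)
  rw [← h1, quad, quad, map_div₀, map_neg, map_intCast, map_ofNat]
  field_simp
  ring

end QuadraticPreimages

section GaloisTree
open Finset NumberField
open scoped Classical

variable {K : Type*} [Field K] [NumberField K] {b c y : ℤ} {N : ℕ}

theorem critDiff_ne_zero_of_not_isSquare {n : ℕ}
    (h : ¬IsSquare ((-1) ^ 2 ^ n * critDiff b c y (n + 1))) : critDiff b c y (n + 1) ≠ 0 := by
  intro h0
  exact h (by rw [h0, mul_zero]; exact IsSquare.zero)

omit [NumberField K] in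
theorem nonempty_preim (hup : ∀ m < N, Function.Surjective (up : Preim K b c y (m + 1) → _))
    {n : ℕ} (hn : n ≤ N) : Nonempty (Preim K b c y n) := by
  induction n with
  | zero => exact ⟨default⟩
  | succ n ih =>
    obtain ⟨x⟩ := ih (by omega)
    exact ⟨(hup n (by omega) x).choose⟩

theorem isPretransitive_preim [IsGalois ℚ K]
    (hup : ∀ m < N, Function.Surjective (up : Preim K b c y (m + 1) → _))
    (hsq : ∀ m < N, ¬IsSquare ((-1) ^ 2 ^ m * critDiff b c y (m + 1))) {n : ℕ} (hn : n ≤ N) :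
    MulAction.IsPretransitive Gal(K/ℚ) (Preim K b c y n) := by
  induction n with
  | zero => exact ⟨fun x z => ⟨1, Subsingleton.elim _ _⟩⟩
  | succ n ih =>
    have := ih (by omega)
    have := nonempty_preim hup (n := n) (by omega)
    by_contra hnot
    obtain ⟨s, hs, hsg⟩ := exists_equivariant_section up_smul reflect_smul up_eq_up_iff
      (hup n (by omega)) hnot
    have hw := prod_section_sq (fun m hm => hup m (by omega))
      (fun m hm => critDiff_ne_zero_of_not_isSquare (hsq m (by omega))) hs
    have hfix : ∏ x, ((s x).1 - algebraMap ℚ K (-b / 2)) ∈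
        (⊥ : IntermediateField ℚ K) := by
      rw [IsGalois.mem_bot_iff_fixed]
      intro σ
      rw [map_prod]
      refine Fintype.prod_equiv (MulAction.toPerm σ) _ _ fun x => ?_
      rw [map_sub, AlgEquiv.commutes, MulAction.toPerm_apply, hsg]
      rfl
    obtain ⟨w, hw'⟩ := IntermediateField.mem_bot.mp hfix
    rw [← hw', ← map_pow] at hw
    refine hsq n (by omega) ⟨w, ?_⟩
    rw [← (algebraMap ℚ K).injective hw, pow_two]

theorem isPGroup_of_preim (hgen : ∀ σ : Gal(K/ℚ), (∀ x : Preim K b c y N, σ • x = x) → σ = 1) :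
    IsPGroup 2 Gal(K/ℚ) := by
  intro g
  refine ⟨N, hgen _ ?_⟩
  have h (n : ℕ) : ∀ x : Preim K b c y n, g ^ 2 ^ n • x = x := by
    induction n with
    | zero => exact fun x => Subsingleton.elim _ _
    | succ n ih =>
      intro x
      have h1 : up (g ^ 2 ^ n • x) = up x := by rw [up_smul, ih]
      rw [pow_succ, pow_mul, pow_two, mul_smul]
      rcases (up_eq_up_iff _ _).mp h1.symm with h2 | h2
      · rw [h2, h2]
      · rw [h2, ← reflect_smul, h2]
        exact preim_ext (sub_sub_cancel _ _)
  exact h N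

variable (K b c y) in
/-- At a good level `n`, the value `critDiff b c y (n + 1)` has no square root in the field
generated by the `n`-th level of the preimage tree. -/
def GoodLevel (n : ℕ) : Prop :=
  ∀ x : K, x ^ 2 = algebraMap ℚ K (critDiff b c y (n + 1)) →
    ∃ ν : Gal(K/ℚ), (∀ r : Preim K b c y n, ν • r = r) ∧ ν x ≠ x

theorem GoodLevel.exists_odd {n : ℕ} (hn : 1 ≤ n) (hg : GoodLevel K b c y n)
    (hup : ∀ m < n, Function.Surjective (up : Preim K b c y (m + 1) → _))
    (h : ∀ m < n, critDiff b c y (m + 1) ≠ 0) {s : Preim K b c y n → Preim K b c y (n + 1)}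
    (hs : ∀ x, up (s x) = x) :
    ∃ ν : Gal(K/ℚ), (∀ x : Preim K b c y n, ν • x = x) ∧ Odd #{x | ν • s x ≠ s x} := by
  have hw := prod_section_sq hup h hs
  rw [Even.neg_one_pow (Nat.even_pow.mpr ⟨even_two, by omega⟩), one_mul] at hw
  obtain ⟨ν, hν, hne⟩ := hg _ hw
  refine ⟨ν, hν, ?_⟩
  by_contra hodd
  rw [Nat.not_odd_iff_even] at hodd
  apply hne
  have h1 (x : Preim K b c y n) : ν ((s x).1 - algebraMap ℚ K (-b / 2)) =
      (if ν • s x ≠ s x then -1 else 1) * ((s x).1 - algebraMap ℚ K (-b / 2)) := by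
    rw [map_sub, AlgEquiv.commutes, ← coe_smul_preim]
    split_ifs with h2
    · have h3 := smul_section_eq (π := up) (ι := reflect) up_smul up_eq_up_iff hs ν x
      rw [hν, or_iff_right h2] at h3
      rw [h3, map_div₀, map_neg, map_intCast, map_ofNat]
      change -(b : K) - (s x).1 - _ = _
      field_simp
      ring
    · rw [not_ne_iff.mp h2, one_mul]
  rw [map_prod, prod_congr rfl fun x _ => h1 x, prod_mul_distrib, prod_ite, prod_const,
    prod_const_one, hodd.neg_one_pow, one_mul, one_mul]

theorem card_fixing_le [IsGalois ℚ K]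
    (hup : ∀ m < N, Function.Surjective (up : Preim K b c y (m + 1) → _))
    (hsq : ∀ m < N, ¬IsSquare ((-1) ^ 2 ^ m * critDiff b c y (m + 1)))
    (hgen : ∀ σ : Gal(K/ℚ), (∀ x : Preim K b c y N, σ • x = x) → σ = 1) (T : ℕ) {n : ℕ}
    (hn : n ≤ N) :
    (#{σ : Gal(K/ℚ) | ∃ x : Preim K b c y n, σ • x = x} : ℝ) ≤
      (1 / (T + 1) + (1 - 1 / 2 ^ T) ^ #{m ∈ range n | 1 ≤ m ∧ GoodLevel K b c y m}) *
        Fintype.card Gal(K/ℚ) := by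
  have hr0 : (0 : ℝ) ≤ 1 - 1 / 2 ^ T := by
    rw [sub_nonneg, div_le_one (by positivity)]
    exact one_le_pow₀ one_le_two
  induction n with
  | zero =>
    have : (#{σ : Gal(K/ℚ) | ∃ x : Preim K b c y 0, σ • x = x} : ℝ) ≤ Fintype.card Gal(K/ℚ) := by
      exact_mod_cast card_filter_le _ _
    refine this.trans (le_mul_of_one_le_left (by positivity) ?_)
    simp only [range_zero, filter_empty, card_empty, pow_zero, le_add_iff_nonneg_left]
    positivity
  | succ n ih =>
    specialize ih (by omega)
    have hmono : #{σ : Gal(K/ℚ) | ∃ x : Preim K b c y (n + 1), σ • x = x} ≤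
        #{σ : Gal(K/ℚ) | ∃ x : Preim K b c y n, σ • x = x} := by
      refine card_le_card fun σ => ?_
      simp only [mem_filter_univ]
      rintro ⟨x, hx⟩
      exact ⟨up x, by rw [← up_smul, hx]⟩
    rw [range_add_one, filter_insert]
    split_ifs with hg
    · rw [card_insert_of_notMem (by simp), pow_succ]
      have := isPretransitive_preim hup hsq (n := n) (by omega)
      have := nonempty_preim hup (n := n) (by omega)
      have hs : ∀ x : Preim K b c y n, up (Function.surjInv (hup n (by omega)) x) = x :=
        Function.surjInv_eq _
      have hD (m) (hm : m < N) := critDiff_ne_zero_of_not_isSquare (hsq m hm)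
      have hstep := exists_fix_card_step (isPGroup_of_preim hgen) up_smul reflect_smul
        up_eq_up_iff (reflect_ne (hD n (by omega))) hs (hg.2.exists_odd hg.1
          (fun m hm => hup m (by omega)) (fun m hm => hD m (by omega)) hs) T
      set A : ℝ := (#{σ : Gal(K/ℚ) | ∃ x : Preim K b c y n, σ • x = x} : ℝ)
      set B : ℝ := (#{σ : Gal(K/ℚ) | ∃ x : Preim K b c y (n + 1), σ • x = x} : ℝ)
      set q : ℝ := (1 - 1 / 2 ^ T) ^ #{m ∈ range n | 1 ≤ m ∧ GoodLevel K b c y m}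
      set C : ℝ := (Fintype.card Gal(K/ℚ) : ℝ)
      have h2 : (0 : ℝ) < 2 ^ T := by positivity
      have h3 : B - C / (T + 1) ≤ (1 - 1 / 2 ^ T) * (A - C / (T + 1)) := by
        have h4 : (A - C / (T + 1)) / 2 ^ T ≤ A - B := by
          rw [div_le_iff₀ h2]; linarith
        have h5 : (1 - 1 / 2 ^ T) * (A - C / (T + 1)) =
          (A - C / (T + 1)) - (A - C / (T + 1)) / 2 ^ T := by ring
        linarith
      have h6 : A - C / (T + 1) ≤ q * C := by
        have : (1 / (T + 1) + q) * C = C / (T + 1) + q * C := by ring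
        linarith
      have h7 := mul_le_mul_of_nonneg_left h6 hr0
      have h8 : (1 / (T + 1) + q * (1 - 1 / 2 ^ T)) * C =
        C / (T + 1) + (1 - 1 / 2 ^ T) * (q * C) := by ring
      linarith
    · exact le_trans (by exact_mod_cast hmono) ih

end GaloisTree

section SplittingTree
open Finset NumberField Polynomial
open scoped Classical

theorem natDegree_iterate_quad {R : Type*} [CommRing R] [IsDomain R] (b c : ℤ) (n : ℕ) :
    ((quad b c)^[n] (X : R[X])).natDegree = 2 ^ n ∧ ((quad b c)^[n] (X : R[X])).Monic := by
  induction n with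
  | zero => simp [monic_X]
  | succ n ih =>
    rw [Function.iterate_succ_apply']
    obtain ⟨h1, h2⟩ := ih
    set p := (quad b c)^[n] (X : R[X])
    have h3 : quad b c p = p ^ 2 + (C (b : R) * p + C (c : R)) := by
      simp [quad, add_assoc]
    have h4 : (C (b : R) * p + C (c : R)).natDegree < (p ^ 2).natDegree := by
      rw [natDegree_pow, h1, natDegree_add_C]
      refine (natDegree_C_mul_le _ _).trans_lt ?_
      rw [h1]
      have := Nat.two_pow_pos n
      omega
    have h5 := degree_lt_degree h4
    rw [h3]
    exact ⟨by rw [natDegree_add_eq_left_of_natDegree_lt h4, natDegree_pow, h1, pow_succ']; ,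
      (h2.pow 2).add_of_left h5⟩

theorem iterate_quad_sub_dvd {R : Type*} [CommRing R] (b c : ℤ) (n : ℕ) (u v : R) :
    u - v ∣ (quad b c)^[n] u - (quad b c)^[n] v := by
  induction n generalizing u v with
  | zero => exact dvd_rfl
  | succ n ih => exact (Dvd.intro _ (quad_sub_quad b c v u).symm).trans (ih _ _)

theorem degree_iterate_quad_sub_pos {R : Type*} [CommRing R] [IsDomain R] (b c : ℤ) (n : ℕ)
    (r : R) : 0 < ((quad b c)^[n] (X : R[X]) - C r).degree := by
  rw [← natDegree_pos_iff_degree_pos, natDegree_sub_C, (natDegree_iterate_quad b c n).1]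
  exact Nat.two_pow_pos n

theorem surjective_up_and_eq_one_of_isSplittingField {b c y : ℤ} {N : ℕ} {P : ℚ[X]}
    (hP : P = (quad b c)^[N] X - C (y : ℚ)) {K : Type*} [Field K] [NumberField K]
    [IsSplittingField ℚ K P] :
    (∀ m < N, Function.Surjective (up : Preim K b c y (m + 1) → _)) ∧
      ∀ σ : Gal(K/ℚ), (∀ x : Preim K b c y N, σ • x = x) → σ = 1 := by
  have hmap : P.map (algebraMap ℚ K) = (quad b c)^[N] X - C (y : K) := by
    rw [hP, ← coe_mapRingHom, map_sub, map_iterate_quad]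
    simp
  have hP0 : P ≠ 0 := by
    rw [hP]
    exact ne_zero_of_degree_gt (degree_iterate_quad_sub_pos b c N (y : ℚ))
  refine ⟨fun m hm α => ?_, fun σ hσ => ?_⟩
  · have hsp : (P.map (algebraMap ℚ K)).Splits := IsSplittingField.splits K P
    have hdvd : (quad b c)^[N - m] X - C α.1 ∣ P.map (algebraMap ℚ K) := by
      have h1 := iterate_quad_sub_dvd b c m ((quad b c)^[N - m] X) (C α.1)
      rw [← Function.iterate_add_apply, show m + (N - m) = N by omega, ← map_iterate_quad,
        α.2] at h1
      rwa [hmap]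
    obtain ⟨β, hβ⟩ := (hsp.of_dvd (Polynomial.map_ne_zero hP0) hdvd).exists_eval_eq_zero
      (degree_iterate_quad_sub_pos b c (N - m) α.1).ne'
    rw [eval_sub, eval_C, sub_eq_zero, ← coe_evalRingHom, map_iterate_quad, coe_evalRingHom,
      eval_X, show N - m = (N - m - 1) + 1 by omega, Function.iterate_succ_apply'] at hβ
    exact ⟨⟨(quad b c)^[N - m - 1] β, by
      rw [Function.iterate_succ_apply, hβ, α.2]⟩, preim_ext hβ⟩
  · have h1 := IsSplittingField.adjoin_rootSet K P
    have h2 : (σ : K →ₐ[ℚ] K) = AlgHom.id ℚ K := by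
      refine AlgHom.ext_of_adjoin_eq_top h1 fun x hx => ?_
      rw [mem_rootSet_of_ne hP0, aeval_def, ← eval_map, hmap, eval_sub, sub_eq_zero,
        ← coe_evalRingHom, map_iterate_quad] at hx
      simp only [coe_evalRingHom, eval_X, eval_C] at hx
      exact congrArg Subtype.val (hσ ⟨x, hx⟩)
    ext x
    exact DFunLike.congr_fun h2 x

theorem exists_splitting_tree (b c y : ℤ) (N : ℕ) :
    ∃ (K : Type) (_ : Field K) (_ : NumberField K), IsGalois ℚ K ∧
      (∀ m < N, Function.Surjective (up : Preim K b c y (m + 1) → _)) ∧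
      ∀ σ : Gal(K/ℚ), (∀ x : Preim K b c y N, σ • x = x) → σ = 1 := by
  obtain ⟨P, hP⟩ : ∃ P : ℚ[X], P = (quad b c)^[N] X - C (y : ℚ) := ⟨_, rfl⟩
  have hs : @IsSplittingField ℚ P.SplittingField _ _ DivisionRing.toRatAlgebra P := by
    convert IsSplittingField.splittingField P
    exact Subsingleton.elim _ _
  have hN : NumberField P.SplittingField :=
    { to_charZero := inferInstance, to_finiteDimensional := inferInstance }
  have hG : IsGalois ℚ P.SplittingField :=
    { to_isSeparable := inferInstance, to_normal := Normal.of_isSplittingField P }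
  exact ⟨P.SplittingField, inferInstance, hN, hG,
    surjective_up_and_eq_one_of_isSplittingField hP⟩

variable {K : Type*} [Field K] {b c y : ℤ} {N : ℕ}

theorem isIntegral_preim [CharZero K] {n : ℕ} (x : Preim K b c y n) : IsIntegral ℤ x.1 := by
  refine ⟨(quad b c)^[n] X - C y, ?_, ?_⟩
  · refine (natDegree_iterate_quad b c n).2.sub_of_left ?_
    refine degree_C_le.trans_lt ?_
    rw [← natDegree_pos_iff_degree_pos, (natDegree_iterate_quad b c n).1]
    exact Nat.two_pow_pos n
  · rw [← aeval_def, map_sub, map_iterate_quad, aeval_X, aeval_C, x.2]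
    simp

end SplittingTree

section TreeDensity
open Finset NumberField Filter
open scoped Classical

variable {K : Type*} [Field K] [NumberField K] {b c y : ℤ} {N : ℕ}

/-- A point of the preimage tree as an algebraic integer. -/
def Preim.toInt {n : ℕ} (x : Preim K b c y n) : 𝓞 K := ⟨x.1, isIntegral_preim x⟩

theorem Preim.coe_toInt {n : ℕ} (x : Preim K b c y n) : (x.toInt : K) = x.1 := rfl

theorem Preim.smul_toInt {n : ℕ} (σ : Gal(K/ℚ)) (x : Preim K b c y n) :
    σ • x.toInt = (σ • x).toInt := RingOfIntegers.ext rfl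

theorem Preim.toInt_injective {n : ℕ} :
    Function.Injective (Preim.toInt : Preim K b c y n → 𝓞 K) := fun _ _ h =>
  preim_ext (congrArg (algebraMap (𝓞 K) K) h)

theorem smul_preim_of_mem_inertia {n : ℕ}
    (hup : ∀ m < n, Function.Surjective (up : Preim K b c y (m + 1) → _))
    (h : ∀ m < n, critDiff b c y (m + 1) ≠ 0) {E : ℕ → ℤ}
    (hE : ∀ m, (E m : ℚ) = 4 ^ 2 ^ m * critDiff b c y (m + 1)) {q : ℕ} (hq : q.Prime)
    (hprim : ∀ j < n, ¬(q : ℤ) ∣ E j) {Q : Ideal (𝓞 K)} [hQ : Q.IsPrime] (hqQ : (q : 𝓞 K) ∈ Q)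
    {τ : Gal(K/ℚ)} (hτ : τ ∈ Q.inertia Gal(K/ℚ)) (x : Preim K b c y n) : τ • x = x := by
  induction n with
  | zero => exact Subsingleton.elim _ _
  | succ n ih =>
    have hup' (m) (hm : m < n) := hup m (hm.trans n.lt_succ_self)
    have h' (m) (hm : m < n) := h m (hm.trans n.lt_succ_self)
    have h1 : up x = up (τ • x) := by
      rw [up_smul, ih hup' h' fun j hj => hprim j (hj.trans n.lt_succ_self)]
    refine ((up_eq_up_iff _ _).mp h1).resolve_right fun h2 => ?_
    have h3 : (2 * x.toInt + b : 𝓞 K) ∈ Q := by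
      have := hτ x.toInt
      rw [Preim.smul_toInt, h2] at this
      have e : (reflect x).toInt - x.toInt = -(2 * x.toInt + b) :=
        RingOfIntegers.ext (by
          simp only [map_sub, map_neg, map_add, map_mul, map_intCast, map_ofNat]
          change (-b - x.1) - x.1 = -(2 * x.1 + b)
          ring)
      replace this : (reflect x).toInt - x.toInt ∈ Q := this
      rwa [e, neg_mem_iff] at this
    have h4 : ((E n : ℤ) : 𝓞 K) =
        ∏ α : Preim K b c y n, ((4 * c - b ^ 2 : ℤ) - 4 * α.toInt : 𝓞 K) := by
      apply RingOfIntegers.ext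
      change algebraMap (𝓞 K) K _ = algebraMap (𝓞 K) K _
      have e1 : ((E n : ℤ) : K) = algebraMap ℚ K (E n) := by simp
      rw [map_intCast, e1, hE, map_mul, map_pow, ← card_preim hup' h', critDiff, map_sub,
        map_iterate_quad, map_intCast, Function.iterate_succ_apply, ← prod_sub_preim hup' h',
        ← card_univ, ← prod_const, ← prod_mul_distrib, map_prod]
      refine prod_congr rfl fun α _ => ?_
      simp only [map_sub, map_mul, map_intCast, map_ofNat, map_div₀, map_neg, quad,
        Preim.coe_toInt]
      push_cast
      field_simp
      ring
    have h5 : ((4 * c - b ^ 2 : ℤ) - 4 * (up x).toInt : 𝓞 K) = -(2 * x.toInt + b) ^ 2 := by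
      apply RingOfIntegers.ext
      simp only [map_sub, map_mul, map_intCast, map_ofNat, map_neg, map_pow, map_add,
        Preim.coe_toInt]
      change _ - 4 * quad b c x.1 = _
      rw [quad]
      push_cast
      ring
    have h6 : ((E n : ℤ) : 𝓞 K) ∈ Q := by
      rw [h4]
      refine Ideal.mem_of_dvd _ (dvd_prod_of_mem _ (mem_univ (up x))) ?_
      rw [h5]
      exact Q.neg_mem (Q.pow_mem_of_mem h3 2 two_pos)
    obtain ⟨u, v, huv⟩ := ((Nat.prime_iff_prime_int.mp hq).coprime_iff_not_dvd).mpr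
      (hprim n n.lt_succ_self)
    apply hQ.ne_top
    rw [Ideal.eq_top_iff_one]
    have h7 : (u : 𝓞 K) * (q : 𝓞 K) + v * (E n : ℤ) = 1 := by exact_mod_cast congrArg (Int.cast) huv
    rw [← h7]
    exact Q.add_mem (Q.mul_mem_left _ hqQ) (Q.mul_mem_left _ h6)

theorem goodLevel_of_odd_padicValInt [IsGalois ℚ K] {n : ℕ}
    (hup : ∀ m < n, Function.Surjective (up : Preim K b c y (m + 1) → _))
    (h : ∀ m < n, critDiff b c y (m + 1) ≠ 0) {E : ℕ → ℤ}
    (hE : ∀ m, (E m : ℚ) = 4 ^ 2 ^ m * critDiff b c y (m + 1)) {q : ℕ} (hq : q.Prime)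
    (hprim : ∀ j < n, ¬(q : ℤ) ∣ E j) (hodd : Odd (padicValInt q (E n))) :
    GoodLevel K b c y n := by
  intro x hx
  by_contra! hfix
  have hx2 : (2 ^ 2 ^ n * x) ^ 2 = ((E n : ℤ) : K) := by
    have e1 : ((E n : ℤ) : K) = algebraMap ℚ K (E n) := by simp
    rw [mul_pow, hx, e1, hE, map_mul, ← pow_mul, mul_comm (2 ^ n), pow_mul]
    norm_num
  have hint : IsIntegral ℤ (2 ^ 2 ^ n * x) := by
    apply IsIntegral.of_pow two_pos
    rw [hx2]
    exact isIntegral_algebraMap (R := ℤ)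
  have : (Ideal.span {(q : ℤ)}).IsMaximal :=
    PrincipalIdealRing.isMaximal_of_irreducible (Nat.prime_iff_prime_int.mp hq).irreducible
  obtain ⟨Q, hQ, hlies⟩ := Ideal.exists_maximal_ideal_liesOver_of_isIntegral (S := 𝓞 K)
    (Ideal.span {(q : ℤ)})
  have hqQ : (q : 𝓞 K) ∈ Q := by
    have : (q : ℤ) ∈ Q.under ℤ := hlies.over ▸ Ideal.mem_span_singleton_self _
    simpa using this
  refine Nat.not_even_iff_odd.mpr hodd (even_padicValInt_of_inertia hq Q hqQ
    (x := ⟨2 ^ 2 ^ n * x, hint⟩) ?_ ?_ ?_)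
  · rintro h0
    simp [h0] at hodd
  · exact RingOfIntegers.ext hx2
  · intro τ hτ
    refine RingOfIntegers.ext ?_
    change τ (2 ^ 2 ^ n * x) = 2 ^ 2 ^ n * x
    rw [map_mul, map_pow, map_ofNat, hfix τ (smul_preim_of_mem_inertia hup h hE hq hprim hqQ hτ)]

theorem exists_card_primes_le (hsq : ∀ m, ¬IsSquare ((-1) ^ 2 ^ m * critDiff b c y (m + 1)))
    {E : ℕ → ℤ} (hE : ∀ m, (E m : ℚ) = 4 ^ 2 ^ m * critDiff b c y (m + 1)) (S : Finset ℕ)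
    (hS : ∀ n ∈ S, 1 ≤ n ∧ n < N ∧
      ∃ q : ℕ, q.Prime ∧ (∀ j < n, ¬(q : ℤ) ∣ E j) ∧ Odd (padicValInt q (E n))) (T : ℕ) :
    ∃ C : ℝ, ∀ᶠ X : ℕ in atTop,
      (#{p ∈ (range (X + 1) : Finset ℕ) | Nat.Prime p ∧
        ∃ z : ℤ, (p : ℤ) ∣ (quad b c)^[N] z - y} : ℝ) ≤
      8000 * (1 / (T + 1) + (1 - 1 / 2 ^ T) ^ #S) * Nat.primeCounting X + C := by
  obtain ⟨K, _, _, _, hup, hgen⟩ := exists_splitting_tree b c y N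
  have hD (m) := critDiff_ne_zero_of_not_isSquare (hsq m)
  set s : Multiset (𝓞 K) := (univ : Finset (Preim K b c y N)).val.map Preim.toInt with hs
  have hmem (r : 𝓞 K) : r ∈ s ↔ ∃ x : Preim K b c y N, x.toInt = r := by simp [hs]
  obtain ⟨C, hC⟩ := exists_card_le (isPGroup_of_preim hgen) (fun z => (quad b c)^[N] z - y) s
    (fun z => by
      apply RingOfIntegers.ext
      change algebraMap (𝓞 K) K _ = algebraMap (𝓞 K) K _
      have e : (algebraMap (𝓞 K) K) (((quad b c)^[N] z - y : ℤ) : 𝓞 K) =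
          (quad b c)^[N] (z : K) - y := by
        rw [map_intCast, Int.cast_sub, ← eq_intCast (Int.castRingHom K) ((quad b c)^[N] z),
          map_iterate_quad, eq_intCast]
      rw [e, ← prod_sub_preim hup (fun m _ => hD m), hs, Multiset.map_map]
      change _ = algebraMap (𝓞 K) K (∏ x : Preim K b c y N, ((z : 𝓞 K) - x.toInt))
      rw [map_prod]
      exact prod_congr rfl fun x _ => by rw [map_sub, map_intCast]; rfl)
    (fun σ r hr => by
      obtain ⟨x, rfl⟩ := (hmem r).mp hr
      exact (hmem _).mpr ⟨σ • x, (Preim.smul_toInt σ x).symm⟩)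
  have hfixeq : (#{σ : Gal(K/ℚ) | ∃ r ∈ s, σ • r = r} : ℝ) =
      #{σ : Gal(K/ℚ) | ∃ x : Preim K b c y N, σ • x = x} := by
    congr 2
    ext σ
    simp only [mem_filter_univ]
    constructor
    · rintro ⟨r, hr, h⟩
      obtain ⟨x, rfl⟩ := (hmem r).mp hr
      rw [Preim.smul_toInt] at h
      exact ⟨x, Preim.toInt_injective h⟩
    · rintro ⟨x, hx⟩
      exact ⟨x.toInt, (hmem _).mpr ⟨x, rfl⟩, by rw [Preim.smul_toInt, hx]⟩
  have hfix := card_fixing_le hup (fun m _ => hsq m) hgen T le_rfl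
  have hG : (0 : ℝ) < Fintype.card Gal(K/ℚ) := by exact_mod_cast Fintype.card_pos
  have hr0 : (0 : ℝ) ≤ 1 - 1 / 2 ^ T := by
    rw [sub_nonneg, div_le_one (by positivity)]
    exact one_le_pow₀ one_le_two
  have hcard : #S ≤ #{m ∈ range N | 1 ≤ m ∧ GoodLevel K b c y m} := by
    refine card_le_card fun n hn => ?_
    obtain ⟨h1, h2, q, hq, h3, h4⟩ := hS n hn
    rw [mem_filter, Finset.mem_range]
    exact ⟨h2, h1, goodLevel_of_odd_padicValInt (fun m hm => hup m (hm.trans h2))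
      (fun m _ => hD m) hE hq h3 h4⟩
  have hpow : (1 - 1 / 2 ^ T : ℝ) ^ #{m ∈ range N | 1 ≤ m ∧ GoodLevel K b c y m} ≤
      (1 - 1 / 2 ^ T) ^ #S := by
    refine pow_le_pow_of_le_one hr0 ?_ hcard
    rw [sub_le_self_iff]
    positivity
  refine ⟨C / Fintype.card Gal(K/ℚ), ?_⟩
  filter_upwards [hC] with X hX
  rw [hfixeq, Nat.card_eq_fintype_card] at hX
  rw [← mul_le_mul_iff_left₀ hG, add_mul, div_mul_cancel₀ _ hG.ne']
  refine hX.trans ?_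
  have h1 := hfix.trans (mul_le_mul_of_nonneg_right (add_le_add_right hpow (1 / (T + 1 : ℝ))) hG.le)
  have h2 : (0 : ℝ) ≤ Nat.primeCounting X := by positivity
  have h3 := mul_le_mul_of_nonneg_right h1 h2
  linarith

/-- If infinitely many levels of the preimage tree are good, the primes modulo which the `N`-th
level has a rational point have small upper density for large `N`. -/
theorem exists_forall_card_primes_le
    (hsq : ∀ m, ¬IsSquare ((-1) ^ 2 ^ m * critDiff b c y (m + 1)))
    {E : ℕ → ℤ} (hE : ∀ m, (E m : ℚ) = 4 ^ 2 ^ m * critDiff b c y (m + 1))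
    (hinf : ∀ n₀ : ℕ, ∃ n ≥ n₀,
      ∃ q : ℕ, q.Prime ∧ (∀ j < n, ¬(q : ℤ) ∣ E j) ∧ Odd (padicValInt q (E n)))
    {ε : ℝ} (hε : 0 < ε) :
    ∃ N₀, ∀ N ≥ N₀, ∀ᶠ X : ℕ in atTop,
      (#{p ∈ (range (X + 1) : Finset ℕ) | Nat.Prime p ∧
        ∃ z : ℤ, (p : ℤ) ∣ (quad b c)^[N] z - y} : ℝ) ≤ ε * Nat.primeCounting X := by
  obtain ⟨T, hT⟩ := exists_nat_one_div_lt (show (0 : ℝ) < ε / 40000 by positivity)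
  have hr1 : (1 - 1 / 2 ^ T : ℝ) < 1 := by
    rw [sub_lt_self_iff]; positivity
  obtain ⟨M, hM⟩ := exists_pow_lt_of_lt_one (show (0 : ℝ) < ε / 40000 by positivity) hr1
  have hI : {n : ℕ | 1 ≤ n ∧ ∃ q : ℕ, q.Prime ∧ (∀ j < n, ¬(q : ℤ) ∣ E j) ∧
      Odd (padicValInt q (E n))}.Infinite := by
    rw [Set.infinite_iff_exists_gt]
    intro a
    obtain ⟨n, hn, hq⟩ := hinf (a + 1)
    exact ⟨n, ⟨by omega, hq⟩, by omega⟩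
  obtain ⟨S, hS, hScard⟩ := hI.exists_subset_card_eq M
  refine ⟨S.sup id + 1, fun N hN => ?_⟩
  obtain ⟨C, hC⟩ := exists_card_primes_le (N := N) hsq hE S (fun n hn => by
    have h1 := hS hn
    have h2 : n ≤ S.sup id := le_sup (f := id) hn
    exact ⟨h1.1, by omega, h1.2⟩) T
  have hlim : Tendsto (fun X : ℕ => (Nat.primeCounting X : ℝ)) atTop atTop :=
    tendsto_natCast_atTop_atTop.comp Nat.tendsto_primeCounting
  filter_upwards [hC, hlim.eventually_ge_atTop (2 * C / ε)] with X h1 h2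
  rw [hScard] at h1
  rw [div_le_iff₀ hε] at h2
  have h3 : (0 : ℝ) ≤ Nat.primeCounting X := by positivity
  have h4 : 8000 * (1 / (T + 1) + (1 - 1 / 2 ^ T : ℝ) ^ M) ≤ ε / 2 := by linarith
  have h5 := mul_le_mul_of_nonneg_right h4 h3
  linarith

end TreeDensity

section PellGrowth
open Filter Topology

theorem exists_int_add_sqrt_pow (x w : ℤ) (δ : ℕ) (m : ℕ) :
    ∃ A B : ℤ, (x + w * √δ : ℝ) ^ m = A + B * √δ ∧ (x - w * √δ : ℝ) ^ m = A - B * √δ := by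
  induction m with
  | zero => exact ⟨1, 0, by simp, by simp⟩
  | succ m ih =>
    obtain ⟨A, B, h1, h2⟩ := ih
    have hs : √(δ : ℝ) ^ 2 = δ := Real.sq_sqrt (Nat.cast_nonneg _)
    refine ⟨A * x + B * w * δ, A * w + B * x, ?_, ?_⟩
    · rw [pow_succ, h1]; push_cast; linear_combination (B * w : ℝ) * hs
    · rw [pow_succ, h2]; push_cast; linear_combination (B * w : ℝ) * hs

theorem tendsto_add_sqrt_div {l : Filter ℕ} {x : ℕ → ℝ} (hx : Tendsto x l atTop) (N : ℝ) :
    Tendsto (fun n => (x n + √(x n ^ 2 - N)) / x n) l (𝓝 2) := by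
  have h1 : Tendsto (fun n => 1 + √(1 - N / x n ^ 2)) l (𝓝 (1 + √(1 - 0))) :=
    tendsto_const_nhds.add ((tendsto_const_nhds.sub
      (((tendsto_pow_atTop two_ne_zero).comp hx).const_div_atTop N)).sqrt)
  rw [sub_zero, Real.sqrt_one, one_add_one_eq_two] at h1
  refine h1.congr' ?_
  filter_upwards [hx.eventually_gt_atTop 0] with n hn
  rw [add_div, div_self hn.ne']
  congr 1
  rw [eq_div_iff hn.ne']
  nth_rw 2 [← Real.sqrt_sq hn.le]
  rw [← Real.sqrt_mul' _ (sq_nonneg _)]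
  congr 1
  field_simp

theorem sqrt_mul_abs {w : ℤ} {δ : ℕ} {t : ℝ} (h : t = δ * (w : ℝ) ^ 2) :
    √t = ((|w| : ℤ) : ℝ) * √δ := by
  rw [h, Real.sqrt_mul (Nat.cast_nonneg _), Real.sqrt_sq_eq_abs, Int.cast_abs, mul_comm]

/-- If `x² - N` and `X² - N` both lie in `δ` times the squares, where `X ∼ x ^ m` and `x → ∞`,
then `N ^ (m - 1) = 4 ^ (m - 1)`. -/
theorem pow_eq_four_pow_of_tendsto {l : Filter ℕ} [l.NeBot] {x X : ℕ → ℤ} {N : ℤ} {δ m : ℕ}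
    (hN : N ≠ 0) (hm : m ≠ 0)
    (hδ : Irrational √δ) (hx : Tendsto (fun n => (x n : ℝ)) l atTop)
    (hX : Tendsto (fun n => (X n / x n ^ m : ℝ)) l (𝓝 1))
    (hw : ∀ᶠ n in l, ∃ w, x n ^ 2 - N = δ * w ^ 2)
    (hW : ∀ᶠ n in l, ∃ w, X n ^ 2 - N = δ * w ^ 2) : N ^ (m - 1) = 4 ^ (m - 1) := by
  have hXt : Tendsto (fun n => (X n : ℝ)) l atTop := by
    have := hX.pos_mul_atTop one_pos ((tendsto_pow_atTop hm).comp hx)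
    refine this.congr' ?_
    filter_upwards [hx.eventually_gt_atTop 0] with n hn
    simp only [Function.comp_apply]
    field_simp
  set v : ℕ → ℝ := fun n => x n + √((x n : ℝ) ^ 2 - N) with hv
  set V : ℕ → ℝ := fun n => X n + √((X n : ℝ) ^ 2 - N) with hV
  have h2m : (2 : ℝ) ^ (m - 1) * 2 = 2 ^ m := pow_sub_one_mul hm 2
  have hratio : Tendsto (fun n => v n ^ m / V n) l (𝓝 (2 ^ (m - 1))) := by
    have h1 := (((tendsto_add_sqrt_div hx N).pow m).div (tendsto_add_sqrt_div hXt N)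
      two_ne_zero).div hX one_ne_zero
    rw [div_one, ← h2m, mul_div_cancel_right₀ _ two_ne_zero] at h1
    refine h1.congr' ?_
    filter_upwards [hx.eventually_gt_atTop 0, hXt.eventually_gt_atTop 0] with n hn hn'
    have : 0 < V n := by positivity
    simp only [Pi.div_apply, hv, hV, div_pow] at *
    field_simp
  have hlim : Tendsto (fun n => N * (v n ^ m / V n) - N ^ m * (v n ^ m / V n)⁻¹) l
      (𝓝 (N * 2 ^ (m - 1) - N ^ m * (2 ^ (m - 1))⁻¹)) :=
    (hratio.const_mul _).sub ((hratio.inv₀ (by positivity)).const_mul _)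
  have hs : √(δ : ℝ) ≠ 0 := hδ.ne_zero
  have hlim2 := hlim.div_const (2 * √δ)
  have hmem : (N * 2 ^ (m - 1) - N ^ m * (2 ^ (m - 1))⁻¹ : ℝ) / (2 * √δ) ∈
      Set.range ((↑) : ℤ → ℝ) := by
    refine Int.isClosedEmbedding_coe_real.isClosed_range.mem_of_tendsto hlim2 ?_
    filter_upwards [hx.eventually_gt_atTop 0, hXt.eventually_gt_atTop 0, hw, hW]
      with n hn hn' ⟨w, hw⟩ ⟨W, hW⟩
    have e1 := sqrt_mul_abs (w := w) (δ := δ) (t := (x n : ℝ) ^ 2 - N) (by exact_mod_cast hw)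
    have e2 := sqrt_mul_abs (w := W) (δ := δ) (t := (X n : ℝ) ^ 2 - N) (by exact_mod_cast hW)
    have f1 : √((x n : ℝ) ^ 2 - N) ^ 2 = (x n : ℝ) ^ 2 - N := by
      apply Real.sq_sqrt
      have : ((x n ^ 2 - N : ℤ) : ℝ) = δ * w ^ 2 := by exact_mod_cast hw
      push_cast at this
      rw [this]
      positivity
    have f2 : √((X n : ℝ) ^ 2 - N) ^ 2 = (X n : ℝ) ^ 2 - N := by
      apply Real.sq_sqrt
      have : ((X n ^ 2 - N : ℤ) : ℝ) = δ * W ^ 2 := by exact_mod_cast hW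
      push_cast at this
      rw [this]
      positivity
    obtain ⟨A, B, hA, hB⟩ := exists_int_add_sqrt_pow (x n) |w| δ m
    rw [← e1] at hA hB
    have hv0 : 0 < v n := by positivity
    have hV0 : 0 < V n := by positivity
    have g1 : (N : ℝ) = v n * (x n - √((x n : ℝ) ^ 2 - N)) := by
      simp only [hv]; linear_combination f1
    have g2 : (N : ℝ) = V n * (X n - √((X n : ℝ) ^ 2 - N)) := by
      simp only [hV]; linear_combination f2
    have g3 : (N : ℝ) * (v n ^ m / V n) - N ^ m * (v n ^ m / V n)⁻¹ =
        v n ^ m * (X n - √((X n : ℝ) ^ 2 - N)) - (x n - √((x n : ℝ) ^ 2 - N)) ^ m * V n := by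
      nth_rw 1 [g2]
      rw [g1, mul_pow]
      simp only [← g1]
      field_simp
    refine ⟨X n * B - A * |W|, ?_⟩
    rw [g3, hA, hB]
    simp only [hV]
    rw [e2, eq_div_iff (by positivity)]
    push_cast
    ring
  obtain ⟨Q, hQ⟩ := hmem
  have hQ0 : Q = 0 := by
    by_contra hQ0
    have := ((hδ.intCast_mul hQ0).natCast_mul two_ne_zero).ne_rat
      (N * 2 ^ (m - 1) - N ^ m * (2 ^ (m - 1))⁻¹)
    apply this
    push_cast
    rw [eq_div_iff (by positivity)] at hQ
    linarith
  rw [hQ0, Int.cast_zero, eq_comm, div_eq_zero_iff, or_iff_left (by positivity), sub_eq_zero,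
    ← div_eq_mul_inv, eq_div_iff (by positivity), ← pow_sub_one_mul hm] at hQ
  have hN' : (N : ℝ) ≠ 0 := by exact_mod_cast hN
  have h := mul_right_cancel₀ hN' ((by ring : (2 : ℝ) ^ (m - 1) * 2 ^ (m - 1) * N = _).trans hQ)
  rw [← mul_pow] at h
  norm_num at h
  exact_mod_cast h.symm

end PellGrowth

section EvenValuations
open Filter Topology

theorem exists_dvd_mul_sq_of_even {M : ℕ} {z : ℤ} (hz : 0 < z)
    (h : ∀ q : ℕ, q.Prime → ¬q ∣ M → Even (padicValInt q z)) :
    ∃ δ : ℕ, δ ∣ M ∧ ∃ w : ℤ, z = δ * w ^ 2 := by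
  lift z to ℕ using hz.le
  obtain ⟨a, b, rfl, ha⟩ := Nat.sq_mul_squarefree z
  have h0 : b ≠ 0 ∧ a ≠ 0 := by
    constructor <;> rintro rfl <;> simp at hz
  refine ⟨a, ?_, b, by push_cast; ring⟩
  rw [← Nat.prod_primeFactors_of_squarefree ha]
  refine Finset.prod_primes_dvd M (fun q hq => (Nat.prime_of_mem_primeFactors hq).prime)
    fun q hq => ?_
  by_contra hqM
  have hq' := Nat.prime_of_mem_primeFactors hq
  have he := h q hq' hqM
  have : Fact q.Prime := ⟨hq'⟩
  have hv : padicValNat q a = 1 := by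
    have h1 := (Nat.squarefree_iff_factorization_le_one ha.ne_zero).mp ha q
    have h2 := hq'.factorization_pos_of_dvd ha.ne_zero (Nat.dvd_of_mem_primeFactors hq)
    rw [Nat.factorization_def _ hq'] at h1 h2
    omega
  rw [padicValInt.of_nat, padicValNat.mul (pow_ne_zero 2 h0.1) h0.2, padicValNat.pow,
    hv] at he
  exact Nat.not_even_bit1 _ he

theorem tendsto_div_pow_of_recurrence {x : ℕ → ℤ} {κ : ℤ} (hx : ∀ n, x (n + 1) = x n ^ 2 + κ)
    (ht : Tendsto (fun n => (x n : ℝ)) atTop atTop) (d : ℕ) :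
    Tendsto (fun n => (x (n + d) / x n ^ 2 ^ d : ℝ)) atTop (𝓝 1) := by
  induction d with
  | zero =>
    refine tendsto_const_nhds.congr' ?_
    filter_upwards [ht.eventually_gt_atTop 0] with n hn
    simp [hn.ne']
  | succ d ih =>
    have h := (ih.pow 2).add (((tendsto_pow_atTop (pow_ne_zero (d + 1) two_ne_zero)).comp
      ht).const_div_atTop (κ : ℝ))
    rw [one_pow, add_zero] at h
    refine h.congr' ?_
    filter_upwards [ht.eventually_gt_atTop 0] with n hn
    rw [← add_assoc, hx]
    simp only [Function.comp_apply]
    push_cast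
    rw [div_pow, ← pow_mul, ← pow_succ, add_div]

theorem not_frequently_sq_sub_eq_sq {l : Filter ℕ} {x : ℕ → ℤ} {N : ℤ} (hN : N ≠ 0)
    (ht : Tendsto x l atTop) : ∀ᶠ n in l, ¬∃ w, x n ^ 2 - N = w ^ 2 := by
  filter_upwards [ht.eventually_gt_atTop |N|] with n hn
  rintro ⟨w, hw⟩
  have h1 : (x n - |w|) * (x n + |w|) = N := by
    linear_combination hw - sq_abs w
  have h2 := Int.le_of_dvd (abs_pos.mpr hN) ((dvd_abs _ _).mpr ⟨_, (mul_comm _ _).trans h1 |>.symm⟩)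
  have := abs_nonneg w
  omega

theorem false_of_even_padicValInt {x : ℕ → ℤ} {κ N : ℤ} (hx : ∀ n, x (n + 1) = x n ^ 2 + κ)
    (ht : Tendsto x atTop atTop) (hN : N ≠ 0) (hN4 : N ≠ 4) {M L r : ℕ} (hM : M ≠ 0) (hL : 0 < L)
    (h : ∀ᶠ i in atTop, ∀ q : ℕ, q.Prime → ¬q ∣ M →
      Even (padicValInt q (x (r + i * L) ^ 2 - N))) : False := by
  set P : ℕ → ℕ → Prop := fun δ i => ∃ w, x (r + i * L) ^ 2 - N = δ * w ^ 2 with hP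
  have htr : Tendsto (fun n => (x n : ℝ)) atTop atTop := tendsto_intCast_atTop_atTop.comp ht
  have hshift : Tendsto (fun i => r + i * L) atTop atTop :=
    tendsto_atTop_mono (fun i => (Nat.le_mul_of_pos_right i hL).trans (Nat.le_add_left _ _))
      tendsto_id
  have hev : ∀ᶠ i in atTop, ∃ δ ∈ M.divisors, P δ i := by
    filter_upwards [h, (ht.comp hshift).eventually_gt_atTop |N|] with i hi hi'
    have hpos : 0 < x (r + i * L) ^ 2 - N := by
      simp only [Function.comp_apply] at hi'
      have := le_abs_self N
      have := abs_nonneg N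
      nlinarith
    obtain ⟨δ, h1, w, h2⟩ := exists_dvd_mul_sq_of_even hpos hi
    exact ⟨δ, Nat.mem_divisors.mpr ⟨h1, hM⟩, w, h2⟩
  set K := M.divisors.card
  obtain ⟨i₀, hi₀⟩ := eventually_atTop.mp hev
  choose! δ hδ hPδ using hi₀
  have hfreq : ∃ᶠ i in atTop, ∃ t ∈ M.divisors ×ˢ Finset.range (K + 1) ×ˢ Finset.range (K + 1),
      t.2.1 < t.2.2 ∧ P t.1 (i + t.2.1) ∧ P t.1 (i + t.2.2) := by
    refine Eventually.frequently ?_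
    filter_upwards [eventually_ge_atTop i₀] with i hi
    obtain ⟨a, ha, b, hb, hab, he⟩ := Finset.exists_ne_map_eq_of_card_lt_of_maps_to
      (s := Finset.range (K + 1)) (t := M.divisors) (f := fun a => δ (i + a)) (by simp [K])
      (fun a _ => hδ _ (by omega))
    wlog hlt : a < b generalizing a b
    · exact this b hb a ha hab.symm he.symm (by omega)
    refine ⟨(δ (i + a), a, b), Finset.mem_product.mpr ⟨hδ _ (by omega), Finset.mk_mem_product ha hb⟩,
      hlt, hPδ _ (by omega), ?_⟩
    simp only at he ⊢
    rw [he]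
    exact hPδ _ (by omega)
  obtain ⟨⟨δ, a, b⟩, -, hlt, hfreq⟩ : ∃ t : ℕ × ℕ × ℕ,
      t ∈ M.divisors ×ˢ Finset.range (K + 1) ×ˢ Finset.range (K + 1) ∧
      t.2.1 < t.2.2 ∧ ∃ᶠ i in atTop, P t.1 (i + t.2.1) ∧ P t.1 (i + t.2.2) := by
    by_contra! hcon
    refine hfreq ?_
    have := (Filter.eventually_all_finset (l := atTop)
      (M.divisors ×ˢ Finset.range (K + 1) ×ˢ Finset.range (K + 1))
      (p := fun t i => ¬(t.2.1 < t.2.2 ∧ P t.1 (i + t.2.1) ∧ P t.1 (i + t.2.2)))).mpr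
      (fun t ht => by
        by_cases hl : t.2.1 < t.2.2
        · filter_upwards [hcon t ht hl] with i hi h2 using hi h2.2.1 h2.2.2
        · exact Eventually.of_forall fun i h2 => hl h2.1)
    filter_upwards [this] with i hi
    rintro ⟨t, ht, h2⟩
    exact hi t ht h2
  simp only at hlt hfreq
  obtain ⟨e, rfl⟩ := Nat.exists_eq_add_of_lt hlt
  have hshift2 (a : ℕ) : Tendsto (fun i => r + (i + a) * L) atTop atTop :=
    hshift.comp (tendsto_add_atTop_nat a)
  by_cases hsq : IsSquare δ
  · obtain ⟨k, rfl⟩ := hsq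
    obtain ⟨i, ⟨⟨w, hw⟩, -⟩, hi⟩ := (hfreq.and_eventually
      (not_frequently_sq_sub_eq_sq hN (ht.comp (hshift2 a)))).exists
    exact hi ⟨k * w, by simp only [Function.comp_apply]; rw [hw]; push_cast; ring⟩
  · have hne := frequently_iff_neBot.mp hfreq
    have hle : atTop ⊓ 𝓟 {i | P δ (i + a) ∧ P δ (i + (a + e + 1))} ≤ atTop := inf_le_left
    have hm : ∀ᶠ i in atTop ⊓ 𝓟 {i | P δ (i + a) ∧ P δ (i + (a + e + 1))},
      P δ (i + a) ∧ P δ (i + (a + e + 1)) := mem_inf_of_right (mem_principal_self _)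
    have key := pow_eq_four_pow_of_tendsto (x := fun i => x (r + (i + a) * L))
      (X := fun i => x (r + (i + (a + e + 1)) * L)) (m := 2 ^ ((e + 1) * L)) (δ := δ) hN
      (by positivity)
      (irrational_sqrt_natCast_iff.mpr hsq) ((htr.comp (hshift2 a)).mono_left hle)
      ((((tendsto_div_pow_of_recurrence hx htr ((e + 1) * L)).comp (hshift2 a)).mono_left hle).congr
        fun i => by simp only [Function.comp_apply]; congr 3; ring_nf)
      (hm.mono fun i hi => hi.1) (hm.mono fun i hi => hi.2)
    refine hN4 (Odd.strictMono_pow ?_ |>.injective key)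
    exact Nat.Even.sub_odd (Nat.one_le_two_pow) (even_two.pow_of_ne_zero (by positivity)) odd_one
end EvenValuations

section CriticalOrbit
open Filter Topology

/-- The primes modulo which the `N`-th iterate of `quad b c` takes the value `y` have upper
density tending to `0` with `N`. -/
def HasSparseRoots (b c y : ℤ) : Prop :=
  ∀ ε : ℝ, 0 < ε → ∃ N₀, ∀ N ≥ N₀, ∀ᶠ X : ℕ in atTop,
    (({p : ℕ | p.Prime ∧ (∃ z : ℤ, (p : ℤ) ∣ (quad b c)^[N] z - y) ∧ p ≤ X}).ncard : ℝ) ≤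
      ε * Nat.primeCounting X

theorem hasSparseRoots_of_infinite {b c y : ℤ}
    (hsq : ∀ m, ¬IsSquare ((-1) ^ 2 ^ m * critDiff b c y (m + 1)))
    {E : ℕ → ℤ} (hE : ∀ m, (E m : ℚ) = 4 ^ 2 ^ m * critDiff b c y (m + 1))
    (hinf : ∀ n₀ : ℕ, ∃ n ≥ n₀,
      ∃ q : ℕ, q.Prime ∧ (∀ j < n, ¬(q : ℤ) ∣ E j) ∧ Odd (padicValInt q (E n))) :
    HasSparseRoots b c y := by
  classical
  intro ε hε
  obtain ⟨N₀, h⟩ := exists_forall_card_primes_le hsq hE hinf hε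
  refine ⟨N₀, fun N hN => (h N hN).mono fun X hX => ?_⟩
  convert hX
  rw [← Set.ncard_coe_finset]
  congr 1
  ext p
  simp only [Set.mem_ofPred_eq, Finset.coe_filter, Finset.mem_range, Nat.lt_succ_iff]
  tauto

theorem not_isSquare_sq_sub {x κ N : ℤ} (hx : |κ| ≤ |x|) (hN : N ≠ 0) (h1 : N < 2 * |κ| - 1)
    (h2 : -N < 2 * |κ| + 1) : ¬IsSquare (x ^ 2 - N) := by
  rintro ⟨w, hw⟩
  rw [← sq_abs x, ← abs_mul_abs_self w] at hw
  have hw0 := abs_nonneg w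
  have hκ0 := abs_nonneg κ
  rcases lt_trichotomy |w| |x| with h | h | h
  · nlinarith
  · rw [h] at hw
    exact hN (by linarith)
  · nlinarith

/-- The orbit of `0` under `x ↦ x² + κ`. -/
def critOrbit (κ : ℤ) (n : ℕ) : ℤ := (quad 0 κ)^[n] 0

variable {κ Y : ℤ}

theorem critOrbit_succ (n : ℕ) : critOrbit κ (n + 1) = critOrbit κ n ^ 2 + κ := by
  rw [critOrbit, Function.iterate_succ_apply', quad, critOrbit]
  simp

theorem critOrbit_one : critOrbit κ 1 = κ := by simp [critOrbit, quad]

theorem le_critOrbit (hκ : 1 ≤ κ ∨ κ ≤ -3) (n : ℕ) : |κ| + n ≤ critOrbit κ (n + 2) := by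
  induction n with
  | zero =>
    rw [zero_add, critOrbit_succ, critOrbit_one, Nat.cast_zero, add_zero]
    rcases hκ with h | h
    · rw [abs_of_nonneg (by omega)]; nlinarith
    · rw [abs_of_nonpos (by omega)]; nlinarith
  | succ n ih =>
    rw [add_right_comm n 1 2, critOrbit_succ]
    push_cast
    rcases hκ with h | h
    · rw [abs_of_nonneg (by omega)] at ih ⊢; nlinarith
    · rw [abs_of_nonpos (by omega)] at ih ⊢; nlinarith

theorem tendsto_critOrbit (hκ : 1 ≤ κ ∨ κ ≤ -3) : Tendsto (critOrbit κ) atTop atTop := by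
  rw [← tendsto_add_atTop_iff_nat 2]
  refine tendsto_atTop_mono (fun n => ?_) tendsto_natCast_atTop_atTop
  have := le_critOrbit hκ n
  have := abs_nonneg κ
  omega

theorem abs_le_abs_critOrbit (hκ : 1 ≤ κ ∨ κ ≤ -3) (n : ℕ) : |κ| ≤ |critOrbit κ (n + 1)| := by
  cases n with
  | zero => rw [zero_add, critOrbit_one]
  | succ n =>
    have := le_critOrbit hκ n
    exact (show |κ| ≤ critOrbit κ (n + 2) by omega).trans (le_abs_self _)

theorem critOrbit_ne_zero (hκ : 1 ≤ κ ∨ κ ≤ -3) {n : ℕ} (hn : n ≠ 0) : critOrbit κ n ≠ 0 := by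
  obtain ⟨n, rfl⟩ := Nat.exists_eq_succ_of_ne_zero hn
  exact abs_pos.mp ((abs_pos.mpr (show κ ≠ 0 by omega)).trans_le (abs_le_abs_critOrbit hκ n))

theorem hasSparseRoots_of_critOrbit (hκ : 1 ≤ κ ∨ κ ≤ -3) (hsq : ¬IsSquare (Y - κ))
    (h1 : Y - κ < 2 * |κ| - 1) (h2 : -(Y - κ) < 2 * |κ| + 1)
    (h : ∀ n₀ : ℕ, ∃ M L r : ℕ, M ≠ 0 ∧ 0 < L ∧ ∀ i, ∀ q : ℕ, q.Prime → ¬q ∣ M →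
      Odd (padicValInt q (critOrbit κ (r + i * L + 1) - Y)) →
      ∃ n ≥ n₀, q ≠ 2 ∧ (∀ j < n, ¬(q : ℤ) ∣ critOrbit κ (j + 1) - Y) ∧
        Odd (padicValInt q (critOrbit κ (n + 1) - Y))) : HasSparseRoots 0 κ Y := by
  have hN : Y - κ ≠ 0 := fun h => hsq (h ▸ IsSquare.zero)
  have hN4 : Y - κ ≠ 4 := fun h => hsq (h ▸ ⟨2, rfl⟩)
  have hstep (n : ℕ) : critOrbit κ (n + 1) - Y = critOrbit κ n ^ 2 - (Y - κ) := by
    rw [critOrbit_succ]; ring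
  have hcd (n : ℕ) : critDiff 0 κ Y (n + 1) = ((critOrbit κ (n + 1) - Y : ℤ) : ℚ) := by
    rw [critDiff, critOrbit, Int.cast_sub, ← eq_intCast (Int.castRingHom ℚ) (_^[n + 1] 0),
      map_iterate_quad]
    simp
  have hnsq (m : ℕ) : ¬IsSquare (critOrbit κ (m + 2) - Y) := by
    rw [hstep]
    exact not_isSquare_sq_sub (abs_le_abs_critOrbit hκ m) hN h1 h2
  have hne (m : ℕ) : critOrbit κ (m + 1) - Y ≠ 0 := by
    cases m with
    | zero => rw [zero_add, critOrbit_one]; omega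
    | succ m => exact fun h => hnsq m (h ▸ IsSquare.zero)
  refine hasSparseRoots_of_infinite (E := fun m => 4 ^ 2 ^ m * (critOrbit κ (m + 1) - Y))
    (fun m => ?_) (fun m => by rw [hcd]; push_cast; rfl) fun n₀ => ?_
  · rw [hcd]
    cases m with
    | zero =>
      rw [zero_add, critOrbit_one, pow_zero, pow_one, neg_one_mul, ← Int.cast_neg,
        Rat.isSquare_intCast_iff, neg_sub]
      exact hsq
    | succ m =>
      rw [pow_succ 2, pow_mul, pow_right_comm, neg_one_sq, one_pow, one_mul,
        Rat.isSquare_intCast_iff]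
      exact hnsq m
  · obtain ⟨M, L, r, hM, hL, h⟩ := h n₀
    by_contra! hcon
    refine false_of_even_padicValInt (critOrbit_succ (κ := κ)) (tendsto_critOrbit hκ) hN hN4 hM hL
      (r := r) (Eventually.of_forall fun i q hq hqM => ?_)
    by_contra hodd
    rw [Nat.not_even_iff_odd, ← hstep] at hodd
    obtain ⟨n, hn, hq2, hj, hv⟩ := h i q hq hqM hodd
    have hqp := Nat.prime_iff_prime_int.mp hq
    have hq4 (m : ℕ) : ¬(q : ℤ) ∣ 4 ^ 2 ^ m := by
      intro h4
      have h5 : q ∣ 4 := by exact_mod_cast hqp.dvd_of_dvd_pow h4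
      exact hq2 ((Nat.prime_dvd_prime_iff_eq hq Nat.prime_two).mp
        (hq.dvd_of_dvd_pow (show q ∣ 2 ^ 2 from h5)))
    have : Fact q.Prime := ⟨hq⟩
    refine (hcon n hn q hq fun j hjn hd => ?_) ?_
    · exact (hqp.dvd_or_dvd hd).elim (hq4 j) (hj j hjn)
    · rw [padicValInt.mul (by positivity) (hne n), padicValInt.eq_zero_of_not_dvd (hq4 n), zero_add]
      exact hv

theorem critOrbit_add (m n : ℕ) : critOrbit κ (m + n) = (quad 0 κ)^[m] (critOrbit κ n) :=
  Function.iterate_add_apply ..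

theorem dvd_critOrbit_add_sub (m n : ℕ) :
    critOrbit κ n ∣ critOrbit κ (m + n) - critOrbit κ m := by
  have := iterate_quad_sub_dvd 0 κ m (critOrbit κ n) 0
  rwa [sub_zero, ← critOrbit_add] at this

theorem sq_dvd_critOrbit_add_sub {m : ℕ} (hm : m ≠ 0) (n : ℕ) :
    critOrbit κ n ^ 2 ∣ critOrbit κ (m + n) - critOrbit κ m := by
  obtain ⟨m, rfl⟩ := Nat.exists_eq_succ_of_ne_zero hm
  have := iterate_quad_sub_dvd 0 κ m (critOrbit κ (n + 1)) (critOrbit κ 1)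
  rw [← critOrbit_add, ← critOrbit_add, critOrbit_succ, critOrbit_one, add_sub_cancel_right] at this
  rw [← add_assoc, add_right_comm] at this
  exact this

theorem dvd_critOrbit_mul (m n : ℕ) : critOrbit κ n ∣ critOrbit κ (n * m) := by
  induction m with
  | zero => exact dvd_zero _
  | succ m ih =>
    rw [Nat.mul_succ]
    exact (dvd_iff_dvd_of_dvd_sub (dvd_critOrbit_add_sub (n * m) n)).mpr ih

theorem padicValInt_eq_of_pow_dvd_sub {q : ℕ} [Fact q.Prime] {a b : ℤ} (hb : b ≠ 0)
    (h : (q : ℤ) ^ (padicValInt q b + 1) ∣ a - b) : padicValInt q a = padicValInt q b := by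
  have hq : ¬(q : ℤ) ^ (padicValInt q b + 1) ∣ a := fun ha => by
    have := ((padicValInt_dvd_iff _ _).mp ((dvd_iff_dvd_of_dvd_sub h).mp ha)).resolve_left hb
    omega
  have ha : a ≠ 0 := fun ha => hq (ha ▸ dvd_zero _)
  have h1 := (dvd_iff_dvd_of_dvd_sub ((pow_dvd_pow _ (Nat.le_succ _)).trans h)).mpr
    (padicValInt_dvd b)
  refine le_antisymm ?_ (((padicValInt_dvd_iff _ _).mp h1).resolve_left ha)
  by_contra! hlt
  exact hq ((padicValInt_dvd_iff _ _).mpr (Or.inr hlt))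

theorem padicValInt_critOrbit_mul (hκ : 1 ≤ κ ∨ κ ≤ -3) {q : ℕ} [Fact q.Prime]
    {s t : ℕ} (hs : s ≠ 0) (ht : t ≠ 0) (h : (q : ℤ) ∣ critOrbit κ s) :
    padicValInt q (critOrbit κ (s * t)) = padicValInt q (critOrbit κ s) := by
  induction t with
  | zero => exact absurd rfl ht
  | succ t ih =>
    rcases eq_or_ne t 0 with rfl | ht
    · simp
    have h0 := critOrbit_ne_zero hκ hs
    have hv : 1 ≤ padicValInt q (critOrbit κ s) := by
      exact ((padicValInt_dvd_iff 1 _).mp (by rwa [pow_one])).resolve_left h0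
    refine padicValInt_eq_of_pow_dvd_sub h0 ?_
    rw [Nat.mul_succ, add_comm (s * t)]
    refine dvd_trans ?_ (sq_dvd_critOrbit_add_sub hs (s * t))
    refine (pow_dvd_pow _ (show _ ≤ padicValInt q (critOrbit κ s) * 2 by omega)).trans ?_
    rw [pow_mul]
    exact pow_dvd_pow_of_dvd ((padicValInt_dvd _).trans (dvd_critOrbit_mul t s)) 2

theorem exists_rank {q m : ℕ} (hm : m ≠ 0) (h : (q : ℤ) ∣ critOrbit κ m) :
    ∃ s ≠ 0, s ∣ m ∧ (q : ℤ) ∣ critOrbit κ s ∧ ∀ j < s, j ≠ 0 → ¬(q : ℤ) ∣ critOrbit κ j := by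
  classical
  have hex : ∃ s, s ≠ 0 ∧ (q : ℤ) ∣ critOrbit κ s := ⟨m, hm, h⟩
  obtain ⟨h0, h1⟩ := Nat.find_spec hex
  have hmin (j) (hj : j < Nat.find hex) (hj0 : j ≠ 0) : ¬(q : ℤ) ∣ critOrbit κ j := fun h =>
    Nat.find_min hex hj ⟨hj0, h⟩
  refine ⟨Nat.find hex, h0, ?_, h1, hmin⟩
  rw [Nat.dvd_iff_mod_eq_zero]
  by_contra hmod
  refine hmin _ (Nat.mod_lt m (Nat.pos_of_ne_zero h0)) hmod ?_
  have := (h1.trans (dvd_critOrbit_mul _ _)).trans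
    (dvd_critOrbit_add_sub (κ := κ) (m % Nat.find hex) (Nat.find hex * (m / Nat.find hex)))
  rw [Nat.mod_add_div] at this
  exact (dvd_iff_dvd_of_dvd_sub this).mp h

end CriticalOrbit

section SparseRoots

theorem not_isSquare_of_lt_of_lt {z w : ℤ} (hw : 0 ≤ w) (h1 : w ^ 2 < z) (h2 : z < (w + 1) ^ 2) :
    ¬IsSquare z := by
  rintro ⟨v, rfl⟩
  rw [← pow_two] at h1 h2
  have h3 := abs_lt_of_sq_lt_sq h2 (by omega)
  have h4 := sq_lt_sq.mp h1
  rw [abs_of_nonneg hw] at h4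
  omega

theorem ne_two_of_not_dvd {q k : ℕ} (h : ¬q ∣ 2 * k) : q ≠ 2 := by
  rintro rfl
  exact h (dvd_mul_right _ _)

theorem hasSparseRoots_zero {c : ℤ} (hc : 1 ≤ c ∨ c ≤ -3) (hsq : ¬IsSquare (-c)) :
    HasSparseRoots 0 c 0 := by
  refine hasSparseRoots_of_critOrbit hc (by rwa [zero_sub])
    (by rcases abs_cases c with h | h <;> omega) (by rcases abs_cases c with h | h <;> omega)
    fun n₀ => ⟨2 * c.natAbs, n₀.factorial, 0, by omega, n₀.factorial_pos, fun i q hq hqM hodd => ?_⟩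
  simp only [sub_zero, zero_add] at hodd ⊢
  have : Fact q.Prime := ⟨hq⟩
  have hd : (q : ℤ) ∣ critOrbit c (i * n₀.factorial + 1) := by
    by_contra hd
    simp [padicValInt.eq_zero_of_not_dvd hd] at hodd
  obtain ⟨s, hs, ⟨t, ht⟩, hqs, hmin⟩ := exists_rank (Nat.succ_ne_zero _) hd
  have hs1 : s ≠ 1 := by
    rintro rfl
    rw [critOrbit_one] at hqs
    exact hqM (dvd_mul_of_dvd_right (Int.natCast_dvd.mp hqs) 2)
  have hsn : n₀ < s := by
    by_contra! hle
    refine hs1 (Nat.dvd_one.mp ?_)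
    exact (Nat.dvd_add_right ((Nat.dvd_factorial (Nat.pos_of_ne_zero hs) hle).mul_left i)).mp
      ⟨t, ht⟩
  refine ⟨s - 1, by omega, ne_two_of_not_dvd hqM, fun j hj => hmin _ (by omega) (by omega), ?_⟩
  rw [Nat.sub_add_cancel (by omega), ← padicValInt_critOrbit_mul hc hs (t := t) ?_ hqs, ← ht]
  · exact hodd
  · rintro rfl
    omega

theorem hasSparseRoots_neg_sq {k Y : ℤ} (hk : 2 ≤ k) (hY : Y = k ∨ Y = -k) :
    HasSparseRoots 0 (-k ^ 2) Y := by
  have hc : 1 ≤ -k ^ 2 ∨ -k ^ 2 ≤ -3 := Or.inr (by nlinarith)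
  have hY2 : Y ^ 2 = k ^ 2 := by rcases hY with rfl | rfl <;> ring
  have habs : |-k ^ 2| = k ^ 2 := by rw [abs_neg, abs_of_nonneg (sq_nonneg k)]
  have hfac (m : ℕ) : critOrbit (-k ^ 2) (m + 1) =
      (critOrbit (-k ^ 2) m - Y) * (critOrbit (-k ^ 2) m + Y) := by
    rw [critOrbit_succ]; linear_combination hY2
  refine hasSparseRoots_of_critOrbit hc ?_ (by rw [habs]; rcases hY with rfl | rfl <;> nlinarith)
    (by rw [habs]; rcases hY with rfl | rfl <;> nlinarith)
    fun n₀ => ⟨2 * k.natAbs, (n₀ + 1).factorial, (n₀ + 1).factorial - 1, by omega,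
      Nat.factorial_pos _, fun i q hq hqM hodd => ?_⟩
  · rcases hY with rfl | rfl
    · exact not_isSquare_of_lt_of_lt (w := Y) (by omega) (by nlinarith) (by nlinarith)
    · exact not_isSquare_of_lt_of_lt (w := k - 1) (by omega) (by nlinarith) (by nlinarith)
  set L := (n₀ + 1).factorial with hL
  have hL0 : 0 < L := Nat.factorial_pos _
  have hm : L - 1 + i * L + 1 = (i + 1) * L := by
    rw [add_mul, one_mul]; omega
  rw [hm] at hodd
  have : Fact q.Prime := ⟨hq⟩
  have hqp := Nat.prime_iff_prime_int.mp hq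
  have hq2 : ¬(q : ℤ) ∣ 2 * Y := fun h => hqM (by
    have := Int.natCast_dvd.mp h
    rcases hY with rfl | rfl <;> simpa [Int.natAbs_mul] using this)
  have hval {m : ℕ} (hm : m ≠ 0) (h : (q : ℤ) ∣ critOrbit (-k ^ 2) m - Y) :
      padicValInt q (critOrbit (-k ^ 2) (m + 1)) = padicValInt q (critOrbit (-k ^ 2) m - Y) := by
    have h0 := critOrbit_ne_zero hc (Nat.succ_ne_zero m)
    rw [Nat.succ_eq_add_one, hfac] at h0
    rw [hfac, padicValInt.mul (left_ne_zero_of_mul h0) (right_ne_zero_of_mul h0),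
      padicValInt.eq_zero_of_not_dvd (z := _ + Y), add_zero]
    intro h'
    exact hq2 ((dvd_sub h' h).trans (dvd_of_eq (by ring)))
  have hd : (q : ℤ) ∣ critOrbit (-k ^ 2) ((i + 1) * L) - Y := by
    by_contra hd
    simp [padicValInt.eq_zero_of_not_dvd hd] at hodd
  have hd1 : (q : ℤ) ∣ critOrbit (-k ^ 2) ((i + 1) * L + 1) := by
    rw [hfac]; exact dvd_mul_of_dvd_left hd _
  obtain ⟨s, hs, ⟨t, ht⟩, hqs, hmin⟩ := exists_rank (Nat.succ_ne_zero _) hd1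
  have ht0 : t ≠ 0 := by
    rintro rfl
    omega
  have hs1 : s ≠ 1 := by
    rintro rfl
    rw [critOrbit_one, dvd_neg, ← hY2] at hqs
    exact hq2 (dvd_mul_of_dvd_right (hqp.dvd_of_dvd_pow hqs) 2)
  have hsn : n₀ + 1 < s := by
    by_contra! hle
    refine hs1 (Nat.dvd_one.mp ?_)
    exact (Nat.dvd_add_right ((Nat.dvd_factorial (Nat.pos_of_ne_zero hs) hle).mul_left (i + 1))).mp
      ⟨t, ht⟩
  have hds : (q : ℤ) ∣ critOrbit (-k ^ 2) (s - 1) - Y := by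
    obtain ⟨t, rfl⟩ := Nat.exists_eq_succ_of_ne_zero ht0
    have h1 := (hqs.trans (dvd_critOrbit_mul t s)).trans
      (dvd_critOrbit_add_sub (κ := -k ^ 2) (s - 1) (s * t))
    have h2 : s - 1 + s * t = (i + 1) * L := by
      rw [Nat.mul_succ] at ht; omega
    rw [h2] at h1
    exact (dvd_sub hd h1).trans (dvd_of_eq (by ring))
  refine ⟨s - 2, by omega, ne_two_of_not_dvd hqM, fun j hj hdj => ?_, ?_⟩
  · refine hmin (j + 2) (by omega) (by omega) ?_
    rw [hfac]
    exact dvd_mul_of_dvd_left hdj _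
  · rw [show s - 2 + 1 = s - 1 by omega, ← hval (by omega) hds, Nat.sub_add_cancel (by omega),
      ← padicValInt_critOrbit_mul hc hs ht0 hqs, ← ht, hval (by positivity) hd]
    exact hodd

theorem hasSparseRoots_sub_sq {e : ℤ} (he : e ≤ -2 ∨ 3 ≤ e) :
    HasSparseRoots 0 (e - e ^ 2) (-e) := by
  have hc : 1 ≤ e - e ^ 2 ∨ e - e ^ 2 ≤ -3 := Or.inr (by rcases he with h | h <;> nlinarith)
  have habs : |e - e ^ 2| = e ^ 2 - e := by
    rw [abs_of_nonpos (by rcases he with h | h <;> nlinarith), neg_sub]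
  refine hasSparseRoots_of_critOrbit hc ?_ (by rw [habs]; rcases he with h | h <;> nlinarith)
    (by rw [habs]; rcases he with h | h <;> nlinarith)
    fun n₀ => ⟨2 * e.natAbs, 1, n₀, by omega, one_pos, fun i q hq hqM hodd => ?_⟩
  · rcases he with h | h
    · exact not_isSquare_of_lt_of_lt (w := -e) (by omega) (by nlinarith) (by nlinarith)
    · exact not_isSquare_of_lt_of_lt (w := e - 2) (by omega) (by nlinarith) (by nlinarith)
  rw [mul_one] at hodd
  refine ⟨n₀ + i, by omega, ne_two_of_not_dvd hqM, fun j hj hd => ?_, hodd⟩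
  have hd1 : (q : ℤ) ∣ critOrbit (e - e ^ 2) (n₀ + i + 1) - -e := by
    by_contra hd
    rw [padicValInt.eq_zero_of_not_dvd hd] at hodd
    exact Nat.not_odd_zero hodd
  have key (m : ℕ) : (q : ℤ) ∣ critOrbit (e - e ^ 2) (j + 2 + m) - e := by
    induction m with
    | zero =>
      rw [add_zero, critOrbit_succ]
      exact (dvd_mul_of_dvd_left hd (critOrbit (e - e ^ 2) (j + 1) - e)).trans (dvd_of_eq (by ring))
    | succ m ih =>
      rw [← add_assoc, critOrbit_succ]
      exact (dvd_mul_of_dvd_left ih (critOrbit (e - e ^ 2) (j + 2 + m) + e)).trans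
        (dvd_of_eq (by ring))
  have h1 := key (n₀ + i - (j + 1))
  rw [show j + 2 + (n₀ + i - (j + 1)) = n₀ + i + 1 by omega] at h1
  refine hqM ?_
  have h2 : (q : ℤ) ∣ 2 * e := by
    exact (dvd_sub hd1 h1).trans (dvd_of_eq (by ring))
  simpa [Int.natAbs_mul] using Int.natCast_dvd.mp h2

end SparseRoots

section OddParameter
open scoped NumberTheorySymbols

/-- Numerators of the orbit of the critical point `c / 2` of `x ↦ x² - c x + c`, divided by `c`. -/
def critNum (c : ℤ) : ℕ → ℤ
  | 0 => 4 - c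
  | n + 1 => c * critNum c n ^ 2 - c * critNum c n * 4 ^ 2 ^ n + (4 ^ 2 ^ n) ^ 2

variable {c : ℤ}

theorem critDiff_eq_critNum (n : ℕ) :
    critDiff (-c) c 0 (n + 1) = (c * critNum c n : ℤ) / 4 ^ 2 ^ n := by
  induction n with
  | zero =>
    simp only [critDiff, critNum, quad, Function.iterate_succ_apply, Function.iterate_zero_apply]
    push_cast
    ring
  | succ n ih =>
    rw [critDiff, Int.cast_zero, sub_zero] at ih ⊢
    rw [Function.iterate_succ_apply', ih, quad, critNum, pow_succ 2 n, pow_mul]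
    push_cast
    field_simp
    ring

theorem odd_critNum (hc : Odd c) (n : ℕ) : Odd (critNum c n) := by
  induction n with
  | zero => exact Even.sub_odd ⟨2, rfl⟩ hc
  | succ n ih =>
    have h4 : Even ((4 : ℤ) ^ 2 ^ n) := Even.pow_of_ne_zero (by decide) (pow_ne_zero n two_ne_zero)
    exact ((hc.mul ih.pow).sub_even (h4.mul_left _)).add_even (h4.pow_of_ne_zero two_ne_zero)

theorem isCoprime_critNum (hc : Odd c) (n : ℕ) : IsCoprime c (critNum c n) := by
  have h4 : IsCoprime c 4 := by
    obtain ⟨k, hk⟩ := Int.eight_dvd_sq_sub_one_of_odd hc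
    exact ⟨c, -2 * k, by linear_combination hk⟩
  cases n with
  | zero => simpa [critNum, sub_eq_add_neg] using IsCoprime.add_mul_left_right h4 (-1)
  | succ n =>
    have := IsCoprime.add_mul_left_right ((h4.pow_right (n := 2 ^ n)).pow_right (n := 2))
      (critNum c n ^ 2 - critNum c n * 4 ^ 2 ^ n)
    rwa [show (4 ^ 2 ^ n) ^ 2 + c * (critNum c n ^ 2 - critNum c n * 4 ^ 2 ^ n) =
      critNum c (n + 1) by rw [critNum]; ring] at this

theorem dvd_critNum_sub {d : ℤ} {j : ℕ} (h : d ∣ critNum c j) (n : ℕ) :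
    d ∣ critNum c (j + 1 + n) - 4 ^ 2 ^ (j + 1 + n) := by
  induction n with
  | zero =>
    rw [add_zero, critNum, pow_succ 2, pow_mul]
    exact (dvd_mul_of_dvd_left h (c * (critNum c j - 4 ^ 2 ^ j))).trans (dvd_of_eq (by ring))
  | succ n ih =>
    rw [← add_assoc, critNum, pow_succ 2, pow_mul]
    exact (dvd_mul_of_dvd_left ih (c * critNum c (j + 1 + n))).trans (dvd_of_eq (by ring))

theorem not_dvd_critNum (hc : Odd c) {q : ℕ} (hq : q.Prime) {j n : ℕ} (hjn : j < n)
    (h : (q : ℤ) ∣ critNum c j) : ¬(q : ℤ) ∣ critNum c n := by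
  intro h'
  obtain ⟨k, rfl⟩ := Nat.exists_eq_add_of_le (Nat.succ_le_of_lt hjn)
  have h1 := (dvd_sub_right h').mp (dvd_critNum_sub h k)
  have h2 : q ∣ 2 := by
    have h3 : (q : ℤ) ∣ 2 ^ 2 := (Nat.prime_iff_prime_int.mp hq).dvd_of_dvd_pow h1
    exact_mod_cast (Nat.prime_iff_prime_int.mp hq).dvd_of_dvd_pow h3
  rw [(Nat.prime_dvd_prime_iff_eq hq Nat.prime_two).mp h2] at h
  exact Int.not_even_iff_odd.mpr (odd_critNum hc j) (even_iff_two_dvd.mpr (by exact_mod_cast h))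

theorem critNum_one_mod_eight (hc : Odd c) : critNum c 1 % 8 = (c + 4) % 8 := by
  have h1 := Int.eight_dvd_sq_sub_one_of_odd hc
  obtain ⟨k, hk⟩ := h1
  obtain ⟨l, hl⟩ := hc
  have : critNum c 1 = c + 4 + 8 * (c * k - 4 * k + 1) := by
    simp only [critNum]
    linear_combination (c - 4) * hk
  omega

theorem critNum_add_two_mod_eight (hc : Odd c) (n : ℕ) : critNum c (n + 2) % 8 = c % 8 := by
  obtain ⟨k, hk⟩ := Int.eight_dvd_sq_sub_one_of_odd (odd_critNum hc (n + 1))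
  have : critNum c (n + 2) = c + 8 * (c * k - c * critNum c (n + 1) * (2 * 16 ^ (2 ^ n - 1)) +
      2 * 16 ^ (2 ^ n - 1) * 4 ^ 2 ^ (n + 1)) := by
    have h16 : (4 : ℤ) ^ 2 ^ (n + 1) = 16 * 16 ^ (2 ^ n - 1) := by
      rw [mul_pow_sub_one (by positivity), pow_succ', pow_mul]; norm_num
    rw [critNum, h16]
    linear_combination c * hk
  omega

theorem two_mul_two_pow (n : ℕ) : 2 * (2 : ℤ) ^ (2 ^ (n + 1) - 1) = 4 ^ 2 ^ n := by
  rw [mul_pow_sub_one (by positivity), pow_succ', pow_mul]; norm_num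

theorem critNum_succ (n : ℕ) :
    critNum c (n + 1) = c * (critNum c n - 2 ^ (2 ^ (n + 1) - 1)) ^ 2 +
      (2 ^ (2 ^ (n + 1) - 1)) ^ 2 * (4 - c) := by
  rw [critNum, ← two_mul_two_pow]; ring

theorem sub_dvd_critNum_sub (n : ℕ) : c - 4 ∣ critNum c (n + 1) - 4 ^ 2 ^ (n + 1) := by
  have := dvd_critNum_sub (c := c) (d := c - 4) (j := 0) ⟨-1, by rw [critNum]; ring⟩ n
  rwa [zero_add, add_comm 1 n] at this

theorem four_pow_le_critNum (hc : 4 ≤ c) (n : ℕ) : 4 ^ 2 ^ (n + 1) ≤ critNum c (n + 1) := by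
  induction n with
  | zero => simp only [critNum]; norm_num; nlinarith
  | succ n ih =>
    have h4 : (0 : ℤ) < 4 ^ 2 ^ (n + 1) := by positivity
    have h5 : 0 ≤ c * critNum c (n + 1) * (critNum c (n + 1) - 4 ^ 2 ^ (n + 1)) :=
      mul_nonneg (mul_nonneg (by omega) (by omega)) (by omega)
    rw [critNum, pow_succ 2 (n + 1), pow_mul]
    linarith

theorem two_pow_lt_critNum (hc : c = 1 ∨ 4 ≤ c) (n : ℕ) :
    2 ^ (2 ^ (n + 2) - 1) < critNum c (n + 1) := by
  have h : 2 * (2 : ℤ) ^ (2 ^ (n + 2) - 1) = 4 ^ 2 ^ (n + 1) := two_mul_two_pow (n + 1)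
  have h0 : (0 : ℤ) < 2 ^ (2 ^ (n + 1) - 1) := by positivity
  rcases hc with rfl | hc
  · rw [pow_succ 2 n, pow_mul, ← two_mul_two_pow] at h
    rw [critNum_succ]
    nlinarith
  · have h1 := four_pow_le_critNum hc n
    have : (0 : ℤ) < 2 ^ (2 ^ (n + 2) - 1) := by positivity
    omega

theorem critNum_lt_neg (hc : c ≤ -7) (n : ℕ) : critNum c (n + 1) < -4 ^ 2 ^ (n + 1) := by
  induction n with
  | zero => simp only [critNum]; norm_num; nlinarith
  | succ n ih =>
    have h4 : (1 : ℤ) ≤ 4 ^ 2 ^ (n + 1) := one_le_pow₀ (by norm_num)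
    rw [critNum, pow_succ 2 (n + 1), pow_mul]
    set Q : ℤ := 4 ^ 2 ^ (n + 1)
    set a := critNum c (n + 1)
    have : Q ^ 2 < a * (a - Q) := by nlinarith
    nlinarith

theorem critNum_neg_one_pos (n : ℕ) : 4 ^ 2 ^ n < 2 * critNum (-1) n ∧
    4 * critNum (-1) n ≤ 5 * 4 ^ 2 ^ n := by
  induction n with
  | zero => norm_num [critNum]
  | succ n ih =>
    rw [critNum, pow_succ 2 n, pow_mul]
    set Q : ℤ := 4 ^ 2 ^ n
    set a := critNum (-1) n
    constructor <;> nlinarith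

theorem false_of_jacobiSym_eq_neg_one {b J : ℕ} {s t w : ℤ} (hb : b % 4 = 1) (hJ : Odd J)
    (hbJ : J(b | J) = -1) (hs : s = 1 ∨ s = -1) (ht : IsCoprime t b)
    (h : (b : ℤ) ∣ w ^ 2 - s * J * t ^ 2) : False := by
  have hodd : Odd b := Nat.odd_iff.mpr (by omega)
  have h1 : J(s | b) = 1 := by
    rcases hs with rfl | rfl
    · exact jacobiSym.one_left b
    · rw [jacobiSym.at_neg_one hodd, ZMod.χ₄_nat_one_mod_four hb]
  have h2 : J(w ^ 2 | b) = J(s * J * t ^ 2 | b) :=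
    jacobiSym.mod_left' (Int.modEq_iff_dvd.mpr h).symm
  rw [jacobiSym.mul_left, jacobiSym.mul_left, h1,
    jacobiSym.sq_one' (Int.isCoprime_iff_gcd_eq_one.mp ht),
    ← jacobiSym.quadratic_reciprocity_one_mod_four hb hJ, hbJ, jacobiSym.pow_left] at h2
  nlinarith [sq_nonneg J(w | b)]

theorem critNum_mod_four (hc : Odd c) (n : ℕ) : critNum c (n + 1) % 4 = c % 4 := by
  cases n with
  | zero => have := critNum_one_mod_eight hc; rw [zero_add]; omega
  | succ n =>
    have : critNum c (n + 1 + 1) % 8 = c % 8 := critNum_add_two_mod_eight hc n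
    omega

theorem jacobiSym_two_pow {J k : ℕ} (hJ : J % 8 = 3 ∨ J % 8 = 5) (hk : Odd k) :
    J(2 ^ k | J) = -1 := by
  rw [jacobiSym.pow_left, jacobiSym.at_two (Nat.odd_iff.mpr (by omega)),
    ZMod.χ₈_nat_eq_if_mod_eight]
  rw [if_neg (by omega), if_neg (by omega), hk.neg_one_pow]

theorem critNum_ne_sq_aux {ε w : ℤ} {m : ℕ} (hε : ε = 1 ∨ ε = -1) (hc : Odd c)
    (hc4 : ε * c % 4 = 1) (hJ : (c - 4).natAbs % 8 = 5 ∨ ε = 1 ∧ (c - 4).natAbs % 8 = 3)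
    (hpos : 0 < ε * (critNum c (m + 1) - 2 ^ (2 ^ (m + 2) - 1)))
    (h : ε * critNum c (m + 2) = w ^ 2) : False := by
  obtain ⟨k, hk⟩ : ∃ k, 2 ^ (m + 2) - 1 = 2 * k + 1 :=
    ⟨2 ^ (m + 1) - 1, by have := Nat.one_le_two_pow (n := m + 1); rw [pow_succ 2 (m + 1)]; omega⟩
  have hk0 : k ≠ 0 := by
    rintro rfl
    have := Nat.one_le_two_pow (n := m)
    rw [pow_succ, pow_succ] at hk
    omega
  have h2H : 2 * (2 : ℤ) ^ (2 * k + 1) = 4 ^ 2 ^ (m + 1) := hk ▸ two_mul_two_pow (m + 1)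
  have hsucc : critNum c (m + 2) = _ := critNum_succ (c := c) (m + 1)
  rw [show m + 1 + 1 = m + 2 from rfl, hk] at hsucc
  rw [hk] at hpos
  set H : ℤ := 2 ^ (2 * k + 1) with hH
  have hH4 : (4 : ℤ) ∣ H := by
    rw [hH]; exact pow_dvd_pow (2 : ℤ) (show 2 ≤ 2 * k + 1 by omega)
  have hmod := critNum_mod_four hc m
  obtain ⟨b, hb⟩ := Int.eq_ofNat_of_zero_le hpos.le
  have hb4 : b % 4 = 1 := by
    rcases hε with rfl | rfl <;> omega
  have hJodd : Odd (c - 4).natAbs := Nat.odd_iff.mpr (by omega)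
  have hbJ : J(b | (c - 4).natAbs) = -1 := by
    have h1 : J(b | (c - 4).natAbs) = J(ε * H | (c - 4).natAbs) := by
      refine jacobiSym.mod_left' (Int.ModEq.symm (Int.modEq_iff_dvd.mpr ?_))
      rw [Int.natCast_natAbs, abs_dvd, ← hb]
      exact (dvd_mul_of_dvd_right (sub_dvd_critNum_sub (c := c) m) ε).trans
        (dvd_of_eq (by rw [← h2H]; ring))
    rw [h1, jacobiSym.mul_left, hH, jacobiSym_two_pow (by omega) (odd_two_mul_add_one k)]
    rcases hε with rfl | rfl
    · rw [jacobiSym.one_left, one_mul]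
    · rw [jacobiSym.at_neg_one hJodd, ZMod.χ₄_nat_one_mod_four (by omega), one_mul]
  have hcop : IsCoprime H b := by
    refine IsCoprime.pow_left ?_
    exact ⟨-2 * (b / 4 : ℕ), 1, by omega⟩
  have hs : ∃ s : ℤ, (s = 1 ∨ s = -1) ∧ s * (c - 4).natAbs = ε * (4 - c) := by
    rcases hε with rfl | rfl <;> rcases le_total c 4 with h4 | h4
    · exact ⟨1, by omega⟩
    · exact ⟨-1, by omega⟩
    · exact ⟨-1, by omega⟩
    · exact ⟨1, by omega⟩
  obtain ⟨s, hs, hsJ⟩ := hs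
  refine false_of_jacobiSym_eq_neg_one hb4 hJodd hbJ hs hcop (w := w) ?_
  rw [← h, hsucc, hsJ, ← hb]
  rcases hε with rfl | rfl
  · exact ⟨c * (critNum c (m + 1) - H), by ring⟩
  · exact ⟨c * (critNum c (m + 1) - H), by ring⟩

theorem not_isSquare_natAbs_critNum (hc : Odd c) (m : ℕ) :
    ¬IsSquare (critNum c (m + 2)).natAbs := by
  rintro ⟨w, hw⟩
  have hwodd : Odd (w : ℤ) := by
    have h1 := Int.natAbs_odd.mpr (odd_critNum hc (m + 2))
    rw [hw, Nat.odd_mul] at h1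
    exact_mod_cast h1.1
  obtain ⟨k, hk⟩ := Int.eight_dvd_sq_sub_one_of_odd hwodd
  have hw' : |critNum c (m + 2)| = w ^ 2 := by
    rw [Int.abs_eq_natAbs, hw]; push_cast; ring
  have h8 := critNum_add_two_mod_eight hc m
  have h0 : (0 : ℤ) < 2 ^ (2 ^ (m + 2) - 1) := by positivity
  by_cases hp : c = 1 ∨ 4 ≤ c
  · have h1 := two_pow_lt_critNum hp m
    have h2 := two_pow_lt_critNum hp (m + 1)
    have h2' : 0 < critNum c (m + 2) := lt_trans (by positivity) h2
    rw [abs_of_pos h2'] at hw'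
    exact critNum_ne_sq_aux (Or.inl rfl) hc (by omega) (by omega) (by omega)
      ((one_mul _).trans hw')
  · by_cases hn : c ≤ -7
    · have h1 := critNum_lt_neg hn m
      have h2 := critNum_lt_neg hn (m + 1)
      have h4 : (0 : ℤ) < 4 ^ 2 ^ (m + 1) := by positivity
      have h2' : critNum c (m + 2) < 0 := lt_trans h2 (neg_neg_of_pos (by positivity))
      rw [abs_of_neg h2'] at hw'
      exact critNum_ne_sq_aux (Or.inr rfl) hc (by omega) (by omega) (by omega)
        ((neg_one_mul _).trans hw')
    · have hc1 : c = -1 := by rcases abs_cases (critNum c (m + 2)) with h | h <;> omega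
      subst hc1
      have h1 := (critNum_neg_one_pos (m + 2)).1
      have h4 : (0 : ℤ) < 4 ^ 2 ^ (m + 2) := by positivity
      rw [abs_of_pos (by omega)] at hw'
      omega

theorem not_isSquare_mul_critNum (hc : Odd c) (m : ℕ) :
    ¬IsSquare ((-1) ^ 2 ^ m * (c * critNum c m)) := by
  intro h
  have hodd : Odd ((-1) ^ 2 ^ m * (c * critNum c m)) :=
    ((by decide : Odd (-1 : ℤ)).pow).mul (hc.mul (odd_critNum hc m))
  have h8 := Int.eight_dvd_sq_sub_one_of_odd hc
  obtain ⟨w, hw⟩ := h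
  have hw8 := Int.eight_dvd_sq_sub_one_of_odd (Int.odd_mul.mp (hw ▸ hodd)).1
  rw [pow_two w, ← hw] at hw8
  match m with
  | 0 =>
    obtain ⟨k, rfl⟩ := hc
    simp only [critNum, pow_zero, pow_one] at hw8
    rw [show -1 * ((2 * k + 1) * (4 - (2 * k + 1))) - 1 =
      ((2 * k + 1) ^ 2 - 1) - 8 * (k + 1) + 4 by ring] at hw8
    omega
  | 1 =>
    have h1 := critNum_one_mod_eight hc
    obtain ⟨l, hl⟩ : (8 : ℤ) ∣ critNum c 1 - (c + 4) := by omega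
    obtain ⟨k, rfl⟩ := hc
    rw [eq_add_of_sub_eq hl, show (-1) ^ 2 ^ 1 * ((2 * k + 1) * (8 * l + (2 * k + 1 + 4)))
      - 1 = ((2 * k + 1) ^ 2 - 1) + 8 * ((2 * k + 1) * l + k) + 4 by ring] at hw8
    omega
  | m + 2 =>
    rw [pow_succ, pow_mul', neg_one_sq, one_pow, one_mul, mul_comm, ← pow_two] at hw
    obtain ⟨v, hv⟩ := Int.sq_of_isCoprime (isCoprime_critNum hc (m + 2)).symm hw
    refine not_isSquare_natAbs_critNum hc m ⟨v.natAbs, ?_⟩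
    rcases hv with hv | hv <;> rw [hv] <;> simp [pow_two, Int.natAbs_mul]

theorem hasSparseRoots_odd (hc : Odd c) : HasSparseRoots (-c) c 0 := by
  have hE (m : ℕ) : ((c * critNum c m : ℤ) : ℚ) = 4 ^ 2 ^ m * critDiff (-c) c 0 (m + 1) := by
    rw [critDiff_eq_critNum]; field_simp
  refine hasSparseRoots_of_infinite (fun m hm => ?_) hE fun n₀ => ?_
  · refine not_isSquare_mul_critNum hc m (Rat.isSquare_intCast_iff.mp ?_)
    have h2 : IsSquare ((4 : ℚ) ^ 2 ^ m) := IsSquare.pow _ ⟨2, by norm_num⟩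
    have h3 := h2.mul hm
    rw [mul_left_comm, ← hE] at h3
    exact_mod_cast h3
  · have h0 : critNum c (n₀ + 2) ≠ 0 := by
      intro h
      simpa [h] using odd_critNum hc (n₀ + 2)
    obtain ⟨q, hq, hv⟩ : ∃ q : ℕ, q.Prime ∧ Odd (padicValInt q (critNum c (n₀ + 2))) := by
      by_contra! h
      obtain ⟨δ, hδ, w, hw⟩ := exists_dvd_mul_sq_of_even (M := 1) (z := |critNum c (n₀ + 2)|)
        (abs_pos.mpr h0) fun q hq _ => by
          have := h q hq
          rwa [Nat.not_odd_iff_even, padicValInt, ← Int.natAbs_abs] at this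
      rw [Nat.dvd_one.mp hδ, Nat.cast_one, one_mul] at hw
      refine not_isSquare_natAbs_critNum hc n₀ ⟨w.natAbs, ?_⟩
      rw [← Int.natAbs_abs, hw, Int.natAbs_pow, pow_two]
    have : Fact q.Prime := ⟨hq⟩
    have hqn : (q : ℤ) ∣ critNum c (n₀ + 2) := by
      by_contra hd
      simp [padicValInt.eq_zero_of_not_dvd hd] at hv
    have hqc : ¬(q : ℤ) ∣ c := fun h => (Nat.prime_iff_prime_int.mp hq).not_isUnit
      ((isCoprime_critNum hc (n₀ + 2)).isUnit_of_dvd' h hqn)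
    refine ⟨n₀ + 2, by omega, q, hq, fun j hj hd => ?_, ?_⟩
    · rcases (Nat.prime_iff_prime_int.mp hq).dvd_or_dvd hd with h | h
      · exact hqc h
      · exact not_dvd_critNum hc hq hj h hqn
    · rwa [padicValInt.mul (by rintro rfl; simp at hqc) h0,
        padicValInt.eq_zero_of_not_dvd hqc, zero_add]

end OddParameter

section DensityZero

theorem ncard_primes_le (X : ℕ) : ({p : ℕ | p.Prime ∧ p ≤ X}).ncard = X.primeCounting := by
  rw [Nat.primeCounting, Nat.primeCounting', Nat.count_eq_card_filter_range,
    ← Set.ncard_coe_finset]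
  congr 1
  ext p
  simp [and_comm]

theorem primeCounting_pos {X : ℕ} (hX : 2 ≤ X) : 0 < X.primeCounting := by
  rw [Nat.pos_iff_ne_zero, Ne, Nat.primeCounting_eq_zero_iff]
  omega

theorem finite_primes_le (P : Set ℕ) (X : ℕ) : {p : ℕ | p.Prime ∧ p ∈ P ∧ p ≤ X}.Finite :=
  (Set.finite_Iic X).subset fun _ h => h.2.2

theorem primeDensityZero_of_forall_le {P : Set ℕ} (h : ∀ ε : ℝ, 0 < ε → ∀ᶠ X : ℕ in atTop,
    (({p : ℕ | p.Prime ∧ p ∈ P ∧ p ≤ X}).ncard : ℝ) ≤ ε * X.primeCounting) :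
    PrimeDensityZero P := by
  rw [PrimeDensityZero, Metric.tendsto_nhds]
  intro ε hε
  filter_upwards [h (ε / 2) (half_pos hε), eventually_ge_atTop 2] with X hX hX2
  have h0 : (0 : ℝ) < X.primeCounting := by
    exact_mod_cast primeCounting_pos hX2
  rw [ncard_primes_le, Real.dist_0_eq_abs, abs_of_nonneg (by positivity), div_lt_iff₀ h0]
  nlinarith

theorem _root_.PrimeDensityZero.forall_le {P : Set ℕ} (h : PrimeDensityZero P) {ε : ℝ}
    (hε : 0 < ε) :
    ∀ᶠ X : ℕ in atTop,
      (({p : ℕ | p.Prime ∧ p ∈ P ∧ p ≤ X}).ncard : ℝ) ≤ ε * X.primeCounting := by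
  rw [PrimeDensityZero, Metric.tendsto_nhds] at h
  filter_upwards [h ε hε, eventually_ge_atTop 2] with X hX hX2
  have h0 : (0 : ℝ) < X.primeCounting := by
    exact_mod_cast primeCounting_pos hX2
  rw [ncard_primes_le, Real.dist_0_eq_abs, abs_of_nonneg (by positivity), div_lt_iff₀ h0] at hX
  exact hX.le

theorem primeDensityZero_of_forall_subset {P : Set ℕ} (h : ∀ ε : ℝ, 0 < ε → ∃ Q R : Set ℕ,
    (∀ p, p.Prime → p ∈ P → p ∈ Q ∪ R) ∧ PrimeDensityZero Q ∧ ∀ᶠ X : ℕ in atTop,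
      (({p : ℕ | p.Prime ∧ p ∈ R ∧ p ≤ X}).ncard : ℝ) ≤ ε * X.primeCounting) :
    PrimeDensityZero P := by
  refine primeDensityZero_of_forall_le fun ε hε => ?_
  obtain ⟨Q, R, hP, hQ, hR⟩ := h (ε / 2) (half_pos hε)
  filter_upwards [hQ.forall_le (half_pos hε), hR] with X h1 h2
  have h3 : ({p : ℕ | p.Prime ∧ p ∈ P ∧ p ≤ X}).ncard ≤
      ({p : ℕ | p.Prime ∧ p ∈ Q ∧ p ≤ X}).ncard + ({p : ℕ | p.Prime ∧ p ∈ R ∧ p ≤ X}).ncard := by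
    refine (Set.ncard_le_ncard (fun p hp => ?_)
      ((finite_primes_le Q X).union (finite_primes_le R X))).trans (Set.ncard_union_le _ _)
    exact (hP p hp.1 hp.2.1).imp (fun h => ⟨hp.1, h, hp.2.2⟩) fun h => ⟨hp.1, h, hp.2.2⟩
  have h4 : (({p : ℕ | p.Prime ∧ p ∈ P ∧ p ≤ X}).ncard : ℝ) ≤
      ({p : ℕ | p.Prime ∧ p ∈ Q ∧ p ≤ X}).ncard + ({p : ℕ | p.Prime ∧ p ∈ R ∧ p ≤ X}).ncard := by
    exact_mod_cast h3
  linarith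

theorem _root_.PrimeDensityZero.union {P Q : Set ℕ} (hP : PrimeDensityZero P)
    (hQ : PrimeDensityZero Q) :
    PrimeDensityZero (P ∪ Q) :=
  primeDensityZero_of_forall_subset fun _ hε => ⟨P, Q, fun _ _ h => h, hP, hQ.forall_le hε⟩

theorem _root_.PrimeDensityZero.mono {P Q : Set ℕ} (hQ : PrimeDensityZero Q)
    (h : ∀ p, p.Prime → p ∈ P → p ∈ Q) : PrimeDensityZero P :=
  primeDensityZero_of_forall_subset fun _ hε =>
    ⟨Q, Q, fun p hp hpP => Or.inl (h p hp hpP), hQ, hQ.forall_le hε⟩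

theorem primeDensityZero_of_finite {P : Set ℕ} (hP : P.Finite) : PrimeDensityZero P := by
  refine primeDensityZero_of_forall_le fun ε hε => ?_
  have h := (tendsto_natCast_atTop_atTop (R := ℝ)).comp Nat.tendsto_primeCounting
  filter_upwards [h.eventually_ge_atTop (P.ncard / ε)] with X hX
  rw [div_le_iff₀ hε] at hX
  refine le_trans ?_ (hX.trans (mul_comm _ _).le)
  exact_mod_cast Set.ncard_le_ncard (fun p (hp : _ ∧ _ ∧ _) => hp.2.1) hP

theorem finite_setOf_dvd_of_ne_zero (z : ℤ) : {p : ℕ | z ≠ 0 ∧ (p : ℤ) ∣ z}.Finite := by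
  by_cases hz : z = 0
  · simp [hz]
  · refine (Set.finite_Iic z.natAbs).subset fun p hp => ?_
    exact Nat.le_of_dvd (Int.natAbs_pos.mpr hz) (Int.natCast_dvd.mp hp.2)

theorem HasSparseRoots.primeDensityZero {b c y : ℤ} (h : HasSparseRoots b c y) (a : ℤ) :
    PrimeDensityZero {p : ℕ | ∃ n, (quad b c)^[n] a - y ≠ 0 ∧ (p : ℤ) ∣ (quad b c)^[n] a - y} := by
  refine primeDensityZero_of_forall_subset fun ε hε => ?_
  obtain ⟨N, hN⟩ := h ε hε
  refine ⟨⋃ n ∈ Set.Iio N, {p : ℕ | (quad b c)^[n] a - y ≠ 0 ∧ (p : ℤ) ∣ (quad b c)^[n] a - y},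
    {p : ℕ | ∃ z : ℤ, (p : ℤ) ∣ (quad b c)^[N] z - y}, ?_,
    primeDensityZero_of_finite
      ((Set.finite_Iio N).biUnion fun n _ => finite_setOf_dvd_of_ne_zero _), hN N le_rfl⟩
  rintro p - ⟨n, hn⟩
  rcases lt_or_ge n N with hnN | hnN
  · exact Or.inl (Set.mem_biUnion hnN hn)
  · refine Or.inr ⟨(quad b c)^[n - N] a, ?_⟩
    rw [← Function.iterate_add_apply, Nat.add_sub_cancel' hnN]
    exact hn.2

theorem card_primeFactors_le_of_le_pow {m C k : ℕ} (hm : m ≠ 0) (h : m ≤ C ^ k) :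
    m.primeFactors.card ≤ C * k := by
  refine (Nat.pow_le_pow_iff_right one_lt_two).mp ?_
  calc 2 ^ m.primeFactors.card ≤ ∏ p ∈ m.primeFactors, p :=
        Finset.pow_card_le_prod _ _ _ fun p hp => (Nat.prime_of_mem_primeFactors hp).two_le
    _ ≤ m := Nat.le_of_dvd (Nat.pos_of_ne_zero hm) (Nat.prod_primeFactors_dvd m)
    _ ≤ C ^ k := h
    _ ≤ (2 ^ C) ^ k := Nat.pow_le_pow_left Nat.lt_two_pow_self.le k
    _ = 2 ^ (C * k) := (pow_mul _ _ _).symm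

theorem two_pow_dvd_sub_one_or_add_one {p k : ℕ} (hp : Odd p) (h : 2 ^ (k + 1) ∣ p ^ 2 - 1) :
    2 ^ k ∣ p - 1 ∨ 2 ^ k ∣ p + 1 := by
  obtain ⟨t, rfl⟩ := hp
  have h1 : (2 * t + 1) ^ 2 - 1 = 2 ^ 2 * (t * (t + 1)) := by
    rw [Nat.sub_eq_iff_eq_add (Nat.one_le_pow _ _ (by omega))]; ring
  cases k with
  | zero => simp
  | succ k =>
    rw [h1, add_assoc, add_comm k, pow_add, Nat.mul_dvd_mul_iff_left (by norm_num)] at h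
    have h2 : 2 ^ k ∣ t ∨ 2 ^ k ∣ t + 1 := by
      rcases Nat.even_or_odd t with ht | ht
      · exact Or.inl (Nat.Coprime.dvd_of_dvd_mul_right
          (Nat.Coprime.pow_left k (Nat.coprime_two_left.mpr ht.add_one)) h)
      · exact Or.inr (Nat.Coprime.dvd_of_dvd_mul_left
          (Nat.Coprime.pow_left k (Nat.coprime_two_left.mpr ht)) h)
    rw [pow_succ', Nat.add_sub_cancel, show 2 * t + 1 + 1 = 2 * (t + 1) by ring,
      Nat.mul_dvd_mul_iff_left two_pos, Nat.mul_dvd_mul_iff_left two_pos]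
    exact h2

theorem mod_mem_of_two_pow_dvd {p k : ℕ} (hp : Odd p) (h : 2 ^ (k + 1) ∣ p ^ 2 - 1) :
    p % 2 ^ k ∈ ({1 % 2 ^ k, 2 ^ k - 1} : Finset ℕ) := by
  rw [Finset.mem_insert, Finset.mem_singleton]
  have h0 : 0 < 2 ^ k := by positivity
  obtain ⟨t, ht⟩ := hp
  rcases two_pow_dvd_sub_one_or_add_one ⟨t, ht⟩ h with h | h
  · exact Or.inl ((Nat.modEq_iff_dvd' (by omega)).mpr h).symm
  · obtain ⟨s, hs⟩ := h
    have hs0 : s ≠ 0 := by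
      rintro rfl
      omega
    obtain ⟨s, rfl⟩ := Nat.exists_eq_succ_of_ne_zero hs0
    rw [show p = (2 ^ k - 1) + 2 ^ k * s by rw [Nat.mul_succ] at hs; omega,
      Nat.add_mul_mod_self_left,
      Nat.mod_eq_of_lt (by omega)]
    exact Or.inr rfl

theorem card_filter_mod_le {m X : ℕ} (S T : Finset ℕ) (hS : ∀ p ∈ S, p ≤ X)
    (hT : ∀ p ∈ S, p % m ∈ T) : S.card ≤ (X / m + 1) * T.card := by
  rw [← Finset.card_range (X / m + 1), ← Finset.card_product]
  refine Finset.card_le_card_of_injOn (fun p => (p / m, p % m)) (fun p hp => ?_)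
    fun p _ q _ hpq => ?_
  · simp only [Finset.coe_product, Set.mem_prod, Finset.mem_coe, Finset.mem_range]
    exact ⟨Nat.lt_succ_of_le (Nat.div_le_div_right (hS p hp)), hT p hp⟩
  · rw [Prod.mk.injEq] at hpq
    rw [← Nat.div_add_mod p m, ← Nat.div_add_mod q m, hpq.1, hpq.2]

theorem card_le_of_two_pow_dvd {b : ℕ → ℤ} {C : ℕ} (hb : ∀ n, (b n).natAbs ≤ C ^ 2 ^ n)
    (h : ∀ (n p : ℕ), p.Prime → Odd p → b n ≠ 0 → (p : ℤ) ∣ b n → 2 ^ n ∣ p ^ 2 - 1)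
    {k X : ℕ} (hX : X < 4 ^ (k + 1)) :
    ({p : ℕ | p.Prime ∧ p ∈ {p : ℕ | ∃ n, b n ≠ 0 ∧ (p : ℤ) ∣ b n} ∧ p ≤ X}).ncard ≤
      (2 * C + 11) * 2 ^ k := by
  classical
  set U := (Finset.range (k + 1)).biUnion fun n => (b n).natAbs.primeFactors with hU
  set V := (Finset.range (X + 1)).filter fun p => Odd p ∧ 2 ^ (k + 1) ∣ p ^ 2 - 1 with hV
  have hsub : {p : ℕ | p.Prime ∧ p ∈ {p : ℕ | ∃ n, b n ≠ 0 ∧ (p : ℤ) ∣ b n} ∧ p ≤ X} ⊆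
      (({2} ∪ U ∪ V : Finset ℕ) : Set ℕ) := by
    rintro p ⟨hp, ⟨n, hn, hpn⟩, hpX⟩
    rw [Finset.mem_coe, Finset.mem_union, Finset.mem_union, Finset.mem_singleton, or_assoc]
    rcases hp.eq_two_or_odd' with h2 | hodd
    · exact Or.inl h2
    · rcases lt_or_ge n (k + 1) with hnk | hnk
      · refine Or.inr (Or.inl (Finset.mem_biUnion.mpr ⟨n, Finset.mem_range.mpr hnk, ?_⟩))
        exact Nat.mem_primeFactors.mpr ⟨hp, Int.natCast_dvd.mp hpn, Int.natAbs_ne_zero.mpr hn⟩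
      · refine Or.inr (Or.inr (Finset.mem_filter.mpr
          ⟨Finset.mem_range.mpr (Nat.lt_succ_of_le hpX), hodd, ?_⟩))
        exact (pow_dvd_pow 2 hnk).trans (h n p hp hodd hn hpn)
  have h1 : U.card ≤ C * 2 ^ (k + 1) := by
    calc U.card ≤ ∑ n ∈ Finset.range (k + 1), (b n).natAbs.primeFactors.card :=
          Finset.card_biUnion_le
      _ ≤ ∑ n ∈ Finset.range (k + 1), C * 2 ^ n := by
          refine Finset.sum_le_sum fun n _ => ?_
          by_cases hn : b n = 0
          · simp [hn]
          · exact card_primeFactors_le_of_le_pow (Int.natAbs_ne_zero.mpr hn) (hb n)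
      _ ≤ C * 2 ^ (k + 1) := by
          rw [← Finset.mul_sum]
          exact Nat.mul_le_mul_left C (Nat.geomSum_lt le_rfl (by simp)).le
  have h2 : V.card ≤ (X / 2 ^ k + 1) * 2 := by
    refine (card_filter_mod_le (m := 2 ^ k) V {1 % 2 ^ k, 2 ^ k - 1}
      (fun p hp => ?_) fun p hp => ?_).trans (Nat.mul_le_mul_left _ Finset.card_le_two)
    · exact Nat.le_of_lt_succ (Finset.mem_range.mp (Finset.mem_filter.mp hp).1)
    · exact mod_mem_of_two_pow_dvd (Finset.mem_filter.mp hp).2.1 (Finset.mem_filter.mp hp).2.2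
  have h3 : X / 2 ^ k < 4 * 2 ^ k := by
    rw [Nat.div_lt_iff_lt_mul (by positivity), mul_assoc, ← mul_pow]
    rwa [pow_succ'] at hX
  have h4 : 1 ≤ 2 ^ k := Nat.one_le_two_pow
  have h5 := Finset.card_union_le ({2} ∪ U) V
  have h6 := Finset.card_union_le {2} U
  rw [Finset.card_singleton] at h6
  refine (Set.ncard_le_ncard hsub (Finset.finite_toSet _)).trans ?_
  rw [Set.ncard_coe_finset]
  rw [pow_succ] at h1
  nlinarith

theorem primeDensityZero_of_two_pow_dvd {b : ℕ → ℤ} {C : ℕ} (hb : ∀ n, (b n).natAbs ≤ C ^ 2 ^ n)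
    (h : ∀ (n p : ℕ), p.Prime → Odd p → b n ≠ 0 → (p : ℤ) ∣ b n → 2 ^ n ∣ p ^ 2 - 1) :
    PrimeDensityZero {p : ℕ | ∃ n, b n ≠ 0 ∧ (p : ℤ) ∣ b n} := by
  refine primeDensityZero_of_forall_le fun ε hε => ?_
  have hlog : Tendsto (Nat.log 4) atTop atTop :=
    tendsto_atTop.mpr fun k => (eventually_ge_atTop (4 ^ k)).mono fun X hX =>
      Nat.le_log_of_pow_le (by norm_num) hX
  have hlim : Tendsto (fun k : ℕ => 4 * (2 * C + 11) * ((k : ℝ) ^ 1 / 2 ^ k)) atTop (nhds 0) := by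
    simpa using (tendsto_pow_const_div_const_pow_of_one_lt 1 (one_lt_two (α := ℝ))).const_mul
      (4 * (2 * C + 11) : ℝ)
  filter_upwards [hlog.eventually (hlim.eventually_lt_const hε),
    hlog.eventually (eventually_ge_atTop 2), eventually_ge_atTop 1] with X h1 h2 h3
  set k := Nat.log 4 X
  have h4 := card_le_of_two_pow_dvd hb h
    (Nat.lt_pow_succ_log_self (by norm_num) X : X < 4 ^ (k + 1))
  have h5 : ((2 : ℝ) ^ (2 * k)) / (2 * (2 * k : ℕ)) ≤ X.primeCounting := by
    refine (primeCounting_two_pow_ge (by omega)).trans ?_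
    have : 2 ^ (2 * k) ≤ X := by
      rw [pow_mul]; exact Nat.pow_log_le_self 4 (by omega)
    exact_mod_cast Nat.monotone_primeCounting this
  have hk : (0 : ℝ) < k := by exact_mod_cast (by omega : 0 < k)
  have h6 : ((2 * C + 11 : ℝ)) * 2 ^ k ≤ ε * (2 ^ (2 * k) / (2 * (2 * k : ℕ))) := by
    rw [pow_one, mul_div_assoc', div_lt_iff₀ (by positivity)] at h1
    rw [mul_div_assoc', le_div_iff₀ (by positivity), mul_comm 2 k, pow_mul]
    push_cast
    have h7 : (0 : ℝ) < 2 ^ k := by positivity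
    nlinarith
  calc _ ≤ (((2 * C + 11) * 2 ^ k : ℕ) : ℝ) := by exact_mod_cast h4
    _ = (2 * C + 11 : ℝ) * 2 ^ k := by push_cast; ring
    _ ≤ _ := h6.trans (by gcongr)

end DensityZero

section ChebyshevOrbits

theorem two_pow_dvd_of_pow_eq_neg_one {K : Type*} [Field K] {p m n : ℕ} [CharP K p] (hp : Odd p)
    (hp1 : p ≠ 1) {x : K} (hx : x ^ 2 ^ n = -1) (hm : x ^ m = 1) : 2 ^ (n + 1) ∣ m := by
  have hne : (-1 : K) ≠ 1 := by
    intro h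
    have h2 : ((2 : ℕ) : K) = 0 := by
      push_cast; linear_combination -h
    rw [CharP.cast_eq_zero_iff K p] at h2
    have := (Nat.dvd_prime Nat.prime_two).mp h2
    rcases this with h | h
    · exact hp1 h
    · rw [h] at hp
      exact absurd hp (by decide)
  have h1 : orderOf x = 2 ^ (n + 1) :=
    orderOf_eq_prime_pow (by rw [hx]; exact hne) (by rw [pow_succ, pow_mul, hx, neg_one_sq])
  rw [← h1]
  exact orderOf_dvd_of_pow_eq_one hm

theorem exists_add_inv_eq (p : ℕ) [Fact p.Prime] (a : ℤ) :
    ∃ u : AlgebraicClosure (ZMod p), u ≠ 0 ∧ u + u⁻¹ = a ∧ u ^ (p ^ 2 - 1) = 1 := by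
  set K := AlgebraicClosure (ZMod p)
  have hchar : CharP K p := charP_of_injective_algebraMap (algebraMap (ZMod p) K).injective p
  obtain ⟨u, hu⟩ : ∃ u : K, u ^ 2 - a * u + 1 = 0 := by
    have hdeg : (Polynomial.C (1 : K) * Polynomial.X ^ 2 + Polynomial.C (-a : K) * Polynomial.X +
      Polynomial.C 1).degree = 2 := Polynomial.degree_quadratic one_ne_zero
    obtain ⟨u, hu⟩ := IsAlgClosed.exists_root _ (by rw [hdeg]; exact two_ne_zero)
    refine ⟨u, ?_⟩
    simp only [Polynomial.IsRoot.def, Polynomial.eval_add, Polynomial.eval_mul, Polynomial.eval_C,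
      Polynomial.eval_pow, Polynomial.eval_X] at hu
    linear_combination hu
  have hu0 : u ≠ 0 := by
    rintro rfl
    simp at hu
  refine ⟨u, hu0, by field_simp; linear_combination hu, ?_⟩
  have hup : (u ^ p) ^ 2 - a * u ^ p + 1 = 0 := by
    have h := congrArg (frobenius K p) hu
    rw [map_add, map_sub, map_mul, map_pow, map_one, map_zero, map_intCast] at h
    exact h
  have hmul : (u ^ p - u) * (u ^ p * u - 1) = 0 := by
    linear_combination u * hup - u ^ p * hu
  have hp1 : 1 ≤ p := (Fact.out : p.Prime).one_le
  have hsq : p ^ 2 - 1 = (p + 1) * (p - 1) := by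
    simpa using Nat.sq_sub_sq p 1
  rw [hsq]
  rcases mul_eq_zero.mp hmul with h | h
  · have h1 : u ^ (p - 1) = 1 := by
      refine mul_right_cancel₀ hu0 ?_
      rw [← pow_succ, Nat.sub_add_cancel hp1, one_mul]
      exact sub_eq_zero.mp h
    rw [mul_comm, pow_mul, h1, one_pow]
  · rw [pow_mul, pow_succ, sub_eq_zero.mp h, one_pow]

theorem cast_iterate_quad_zero_neg_two {K : Type*} [Field K] {a : ℤ} {u : K} (hu0 : u ≠ 0)
    (hu : u + u⁻¹ = a) (n : ℕ) : (((quad 0 (-2))^[n] a : ℤ) : K) = u ^ 2 ^ n + (u ^ 2 ^ n)⁻¹ := by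
  induction n with
  | zero => simp [hu]
  | succ n ih =>
    rw [Function.iterate_succ_apply', quad]
    push_cast
    rw [ih, pow_succ 2 n, pow_mul]
    have : u ^ 2 ^ n ≠ 0 := pow_ne_zero _ hu0
    field_simp
    ring

theorem natAbs_iterate_quad_zero_neg_two_le (a : ℤ) (n : ℕ) :
    ((quad 0 (-2))^[n] a).natAbs ≤ (a.natAbs + 2) ^ 2 ^ n := by
  induction n with
  | zero => simp
  | succ n ih =>
    rw [Function.iterate_succ_apply', pow_succ 2 n, pow_mul]
    have h2 : 2 ≤ (a.natAbs + 2) ^ 2 ^ n :=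
      (by omega : 2 ≤ a.natAbs + 2).trans (Nat.le_self_pow (by positivity) _)
    zify at ih h2 ⊢
    simp only [quad, abs_le, Int.cast_id] at *
    constructor <;> nlinarith

theorem primeDensityZero_quad_zero_neg_two (a : ℤ) :
    PrimeDensityZero {p : ℕ | ∃ n, (quad 0 (-2))^[n] a ≠ 0 ∧ (p : ℤ) ∣ (quad 0 (-2))^[n] a} := by
  refine primeDensityZero_of_two_pow_dvd (natAbs_iterate_quad_zero_neg_two_le a)
    fun n p hp hodd _ hd => ?_
  have : Fact p.Prime := ⟨hp⟩
  have hchar : CharP (AlgebraicClosure (ZMod p)) p :=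
    charP_of_injective_algebraMap (algebraMap (ZMod p) _).injective p
  obtain ⟨u, hu0, hu, hup⟩ := exists_add_inv_eq p a
  have h := cast_iterate_quad_zero_neg_two hu0 hu n
  rw [(CharP.intCast_eq_zero_iff _ p _).mpr hd] at h
  have h0 : u ^ 2 ^ n ≠ 0 := pow_ne_zero _ hu0
  field_simp at h
  have h1 : u ^ 2 ^ (n + 1) = -1 := by
    rw [pow_succ 2, pow_mul]; linear_combination -h
  exact (pow_dvd_pow 2 (by omega)).trans (two_pow_dvd_of_pow_eq_neg_one hodd hp.ne_one h1 hup)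

theorem primeDensityZero_quad_zero_neg_two_sub_one (a : ℤ) :
    PrimeDensityZero {p : ℕ | ∃ n, (quad 0 (-2))^[n] a - 1 ≠ 0 ∧
      (p : ℤ) ∣ (quad 0 (-2))^[n] a - 1} := by
  refine primeDensityZero_of_two_pow_dvd (C := a.natAbs + 3) (fun n => ?_)
    fun n p hp hodd _ hd => ?_
  · have h1 := natAbs_iterate_quad_zero_neg_two_le a n
    have h2 := pow_add_pow_le (Nat.zero_le (a.natAbs + 2)) zero_le_one
      (pow_ne_zero n two_ne_zero)
    rw [one_pow] at h2
    exact le_trans (by omega) h2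
  have : Fact p.Prime := ⟨hp⟩
  have hchar : CharP (AlgebraicClosure (ZMod p)) p :=
    charP_of_injective_algebraMap (algebraMap (ZMod p) _).injective p
  obtain ⟨u, hu0, hu, hup⟩ := exists_add_inv_eq p a
  have h := cast_iterate_quad_zero_neg_two hu0 hu n
  have h' := (CharP.intCast_eq_zero_iff (AlgebraicClosure (ZMod p)) p _).mpr hd
  push_cast at h'
  rw [sub_eq_zero.mp h'] at h
  have h0 : u ^ 2 ^ n ≠ 0 := pow_ne_zero _ hu0
  field_simp at h
  have h1 : (u ^ 3) ^ 2 ^ n = -1 := by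
    rw [← pow_mul, mul_comm, pow_mul]; linear_combination -(u ^ 2 ^ n + 1) * h
  refine (pow_dvd_pow 2 (Nat.le_succ n)).trans
    (two_pow_dvd_of_pow_eq_neg_one hodd hp.ne_one h1 ?_)
  rw [← pow_mul, mul_comm, pow_mul, hup, one_pow]

theorem primeDensityZero_pow_two_pow_add_one (a : ℤ) :
    PrimeDensityZero {p : ℕ | ∃ n, a ^ 2 ^ n + 1 ≠ 0 ∧ (p : ℤ) ∣ a ^ 2 ^ n + 1} := by
  refine primeDensityZero_of_two_pow_dvd (C := a.natAbs + 1) (fun n => ?_)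
    fun n p hp hodd _ hd => ?_
  · have h2 := pow_add_pow_le (Nat.zero_le a.natAbs) zero_le_one (pow_ne_zero n two_ne_zero)
    rw [one_pow, ← Int.natAbs_pow] at h2
    exact le_trans (by omega) h2
  have : Fact p.Prime := ⟨hp⟩
  have h' := (CharP.intCast_eq_zero_iff (ZMod p) p _).mpr hd
  push_cast at h'
  have h1 := eq_neg_of_add_eq_zero_left h'
  have h0 : (a : ZMod p) ≠ 0 := by
    intro h
    rw [h, zero_pow (by positivity)] at h1
    simp at h1
  refine (pow_dvd_pow 2 (Nat.le_succ n)).trans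
    ((two_pow_dvd_of_pow_eq_neg_one hodd hp.ne_one h1 (ZMod.pow_card_sub_one_eq_one h0)).trans ?_)
  exact ⟨p + 1, by simpa [mul_comm] using Nat.sq_sub_sq p 1⟩

theorem primeDensityZero_pow_two_pow (a : ℤ) :
    PrimeDensityZero {p : ℕ | ∃ n, a ^ 2 ^ n ≠ 0 ∧ (p : ℤ) ∣ a ^ 2 ^ n} := by
  refine (primeDensityZero_of_finite (finite_setOf_dvd_of_ne_zero a)).mono ?_
  rintro p hp ⟨n, hn, hd⟩
  refine ⟨?_, (Nat.prime_iff_prime_int.mp hp).dvd_of_dvd_pow hd⟩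
  rintro rfl
  exact hn (zero_pow (by positivity))

end ChebyshevOrbits

section Supports

/-- The primes dividing some nonzero term `f^[n] a` with `1 ≤ n`. -/
def orbitSupport (f : ℤ → ℤ) (a : ℤ) : Set ℕ :=
  {p : ℕ | ∃ n : ℕ, 1 ≤ n ∧ f^[n] a ≠ 0 ∧ (p : ℤ) ∣ f^[n] a}

theorem iterate_eq_add_of_conj {f F : ℤ → ℤ} {s : ℤ} (h : ∀ x, f x = F (x - s) + s) (a : ℤ)
    (n : ℕ) : f^[n] a = F^[n] (a - s) + s := by
  induction n with
  | zero => simp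
  | succ n ih => rw [Function.iterate_succ_apply', Function.iterate_succ_apply', h, ih,
      add_sub_cancel_right]

theorem primeDensityZero_orbitSupport {f F : ℤ → ℤ} {s : ℤ} (h : ∀ x, f x = F (x - s) + s) (a : ℤ)
    (hF : PrimeDensityZero {p : ℕ | ∃ n, F^[n] (a - s) + s ≠ 0 ∧ (p : ℤ) ∣ F^[n] (a - s) + s}) :
    PrimeDensityZero (orbitSupport f a) := by
  refine hF.mono ?_
  rintro p - ⟨n, -, hn⟩
  rw [iterate_eq_add_of_conj h] at hn
  exact ⟨n, hn⟩

theorem primeDensityZero_orbitSupport_mul {f F G H : ℤ → ℤ} {s : ℤ}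
    (h : ∀ x, f x = F (x - s) + s) (hGH : ∀ x, F x + s = G x * H x) (a : ℤ)
    (hG : PrimeDensityZero {p : ℕ | ∃ n, G (F^[n] (a - s)) ≠ 0 ∧ (p : ℤ) ∣ G (F^[n] (a - s))})
    (hH : PrimeDensityZero {p : ℕ | ∃ n, H (F^[n] (a - s)) ≠ 0 ∧ (p : ℤ) ∣ H (F^[n] (a - s))}) :
    PrimeDensityZero (orbitSupport f a) := by
  refine (hG.union hH).mono ?_
  rintro p hp ⟨n, hn1, hn⟩
  obtain ⟨n, rfl⟩ := Nat.exists_eq_succ_of_ne_zero (Nat.one_le_iff_ne_zero.mp hn1)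
  rw [iterate_eq_add_of_conj h, Function.iterate_succ_apply', hGH] at hn
  rcases (Nat.prime_iff_prime_int.mp hp).dvd_or_dvd hn.2 with h | h
  · exact Or.inl ⟨n, left_ne_zero_of_mul hn.1, h⟩
  · exact Or.inr ⟨n, right_ne_zero_of_mul hn.1, h⟩

theorem quad_zero_zero_iterate (a : ℤ) (n : ℕ) : (quad 0 0)^[n] a = a ^ 2 ^ n := by
  induction n with
  | zero => simp
  | succ n ih => rw [Function.iterate_succ_apply', ih, quad, pow_succ 2, pow_mul]; ring

theorem primeDensityZero_sq_add (a : ℤ) {c : ℤ} (hc : c ≠ -1) :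
    PrimeDensityZero (orbitSupport (fun x => x ^ 2 + c) a) := by
  have hconj (x : ℤ) : x ^ 2 + c = quad 0 c (x - 0) + 0 := by simp [quad]
  rcases eq_or_ne c 0 with rfl | h0
  · refine primeDensityZero_orbitSupport hconj a ?_
    simp only [quad_zero_zero_iterate, sub_zero, add_zero]
    exact primeDensityZero_pow_two_pow a
  rcases eq_or_ne c (-2) with rfl | h2
  · refine primeDensityZero_orbitSupport hconj a ?_
    simp only [sub_zero, add_zero]
    exact primeDensityZero_quad_zero_neg_two a
  have hc' : 1 ≤ c ∨ c ≤ -3 := by omega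
  by_cases hsq : IsSquare (-c)
  · obtain ⟨k, hk⟩ : ∃ k : ℤ, 0 ≤ k ∧ c = -k ^ 2 := by
      obtain ⟨k, hk⟩ := hsq
      exact ⟨|k|, abs_nonneg k, by rw [sq_abs, pow_two, ← hk, neg_neg]⟩
    obtain ⟨hk0, rfl⟩ := hk
    have hk2 : 2 ≤ k := by
      by_contra!
      interval_cases k <;> simp at h0 hc
    refine primeDensityZero_orbitSupport_mul (G := fun x => x - k) (H := fun x => x - -k) hconj
      (fun x => by simp only [quad, Int.cast_id]; ring) a ?_ ?_
    · exact (hasSparseRoots_neg_sq hk2 (Or.inl rfl)).primeDensityZero _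
    · exact (hasSparseRoots_neg_sq hk2 (Or.inr rfl)).primeDensityZero _
  · refine primeDensityZero_orbitSupport hconj a ?_
    simpa using (hasSparseRoots_zero hc' hsq).primeDensityZero a

theorem primeDensityZero_sq_sub_mul_add (a c : ℤ) :
    PrimeDensityZero (orbitSupport (fun x => x ^ 2 - c * x + c) a) := by
  rcases Int.even_or_odd c with ⟨e, rfl⟩ | hc
  · have hconj (x : ℤ) : x ^ 2 - (e + e) * x + (e + e) = quad 0 (e - e ^ 2) (x - e) + e := by
      simp only [quad, Int.cast_id]; ring
    rcases (by omega : (e ≤ -2 ∨ 3 ≤ e) ∨ e = -1 ∨ e = 0 ∨ e = 1 ∨ e = 2) with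
      he | rfl | rfl | rfl | rfl
    · refine primeDensityZero_orbitSupport hconj a ?_
      simpa using (hasSparseRoots_sub_sq he).primeDensityZero (a - e)
    · refine primeDensityZero_orbitSupport hconj a ?_
      exact primeDensityZero_quad_zero_neg_two_sub_one (a - -1)
    · refine primeDensityZero_orbitSupport hconj a ?_
      simpa [quad_zero_zero_iterate] using primeDensityZero_pow_two_pow a
    · refine primeDensityZero_orbitSupport hconj a ?_
      simpa [quad_zero_zero_iterate] using primeDensityZero_pow_two_pow_add_one (a - 1)
    · refine primeDensityZero_orbitSupport_mul (G := id) (H := id) hconj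
        (fun x => by simp only [quad, id, Int.cast_id]; ring) a ?_ ?_ <;>
      exact primeDensityZero_quad_zero_neg_two (a - 2)
  · refine primeDensityZero_orbitSupport (F := quad (-c) c) (s := 0)
      (fun x => by simp only [quad, Int.cast_id]; ring) a ?_
    simpa using (hasSparseRoots_odd hc).primeDensityZero a

end Supports

end JonesDensity

/-- Jones: for a ∈ ℤ,
(a) for every c ∈ ℤ with c ≠ −1 and f(x) = x² + c, the set of primes dividing some nonzero
term f^n(a) (n ≥ 1) has natural density 0;
(b) for every c ∈ ℤ and f(x) = x² − cx + c, the same conclusion holds. -/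
theorem jones_density_zero (a : ℤ) :
    (∀ c : ℤ, c ≠ -1 →
      PrimeDensityZero {p : ℕ | ∃ n : ℕ, 1 ≤ n ∧
        (fun x : ℤ => x ^ 2 + c)^[n] a ≠ 0 ∧ (p : ℤ) ∣ (fun x : ℤ => x ^ 2 + c)^[n] a}) ∧
    (∀ c : ℤ,
      PrimeDensityZero {p : ℕ | ∃ n : ℕ, 1 ≤ n ∧
        (fun x : ℤ => x ^ 2 - c * x + c)^[n] a ≠ 0 ∧
          (p : ℤ) ∣ (fun x : ℤ => x ^ 2 - c * x + c)^[n] a}) :=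
  ⟨fun _ hc => JonesDensity.primeDensityZero_sq_add a hc,
    JonesDensity.primeDensityZero_sq_sub_mul_add a⟩
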